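/- arXiv:math/0602144 — 4 statements merged into one kernel-verified Lean document; each statement's English description precedes it below -/
import Mathlib

section
/- Let k be a totally real number field and ℓ a totally complex quadratic extension of k. For every integer j ≥ 2, ζ_k(j)^{1/2} · L_{ℓ|k}(j+1) > 1, where L_{ℓ|k}(s) := ζ_ℓ(s)/ζ_k(s); equivalently, ζ_k(j) · ζ_ℓ(j+1)^2 > ζ_k(j+1)^2. -/
open NumberField

/-- The Dedekind zeta function of a number field `K`, evaluated at a real argument `s`:
`ζ_K(s) = ∑_{I ≠ 0} (N I)^{-s}`, the sum running over the nonzero ideals of the ring of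
integers of `K`. -/
noncomputable def dedekindZetaReal (K : Type*) [Field K] [NumberField K] (s : ℝ) : ℝ :=
  ∑' I : {I : Ideal (𝓞 K) // I ≠ ⊥}, (Ideal.absNorm I.1 : ℝ) ^ (-s)

/-- Convergence of the Dedekind zeta series at real `s > 1`. -/
theorem aux_summable (K : Type*) [Field K] [NumberField K] (s : ℝ) (hs : 1 < s) :
    Summable (fun I : {I : Ideal (𝓞 K) // I ≠ ⊥} => (Ideal.absNorm I.1 : ℝ) ^ (-s)) := by
  have hlim : Filter.Tendsto (fun n : ℕ => (∑ m ∈ Finset.Icc 1 n,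
      (Nat.card {I : Ideal (𝓞 K) // Ideal.absNorm I = m} : ℝ)) / n) Filter.atTop
      (nhds (dedekindZeta_residue K)) := by
    refine ((Ideal.tendsto_norm_le_div_atTop₀ K).comp tendsto_natCast_atTop_atTop).congr
      fun n => ?_
    simp only [Function.comp_apply, Nat.cast_le, ← Nat.cast_sum]
    congr
    rw [← add_left_inj 1, ← Ideal.card_norm_le_eq_card_norm_le_add_one,
      show Finset.Icc 1 n = Finset.Ioc 0 n from Finset.Icc_succ_left_eq_Ioc _ _,
      show 1 = Nat.card {I : Ideal (𝓞 K) // Ideal.absNorm I = 0} by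
        simp [Ideal.absNorm_eq_zero_iff],
      Finset.sum_Ioc_add_eq_sum_Icc (n.zero_le),
      ← Finset.card_preimage_eq_sum_card_image_eq
        (fun k _ => Ideal.finite_setOfPred_absNorm_eq k)]
    simp [Set.coe_eq_subtype]
  have hO : (fun n : ℕ => ∑ m ∈ Finset.Icc 1 n,
      (Nat.card {I : Ideal (𝓞 K) // Ideal.absNorm I = m} : ℝ)) =O[Filter.atTop]
      fun n : ℕ => (n : ℝ) ^ (1 : ℝ) := by
    simp only [Real.rpow_one]
    refine Asymptotics.isBigO_of_div_tendsto_nhds ?_ _ hlim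
    filter_upwards [Filter.eventually_ne_atTop 0] with n hn h
    exact absurd h (by exact_mod_cast hn)
  have hL := LSeriesSummable_of_sum_norm_bigO_and_nonneg (s := (s : ℂ)) hO
    (fun _ => Nat.cast_nonneg _) zero_le_one (by simpa using hs)
  have hL2 := hL.norm
  rw [← (Equiv.sigmaFiberEquiv
    (fun I : {I : Ideal (𝓞 K) // I ≠ ⊥} => Ideal.absNorm I.1)).summable_iff]
  rw [summable_sigma_of_nonneg (fun _ => by
    simp only [Function.comp_apply]; positivity)]
  have hfin : ∀ n : ℕ, Finite {I : {I : Ideal (𝓞 K) // I ≠ ⊥} // Ideal.absNorm I.1 = n} := by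
    intro n
    have := (Ideal.finite_setOfPred_absNorm_eq (S := 𝓞 K) n).to_subtype
    exact Finite.of_injective
      (fun I => (⟨I.1.1, I.2⟩ : {I : Ideal (𝓞 K) | Ideal.absNorm I = n}))
      (fun a b h => Subtype.ext (Subtype.ext (Subtype.mk.inj h)))
  refine ⟨fun n => by have := hfin n; exact Summable.of_finite, ?_⟩
  refine Summable.of_nonneg_of_le (fun n => tsum_nonneg fun _ => by
    simp only [Function.comp_apply]; positivity) (fun n => ?_) hL2
  have h1 : ∀ x : {I : {I : Ideal (𝓞 K) // I ≠ ⊥} // Ideal.absNorm I.1 = n},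
      ((fun I : {I : Ideal (𝓞 K) // I ≠ ⊥} => (Ideal.absNorm I.1 : ℝ) ^ (-s)) ∘
      (Equiv.sigmaFiberEquiv
        (fun I : {I : Ideal (𝓞 K) // I ≠ ⊥} => Ideal.absNorm I.1))) ⟨n, x⟩ = (n : ℝ) ^ (-s) := by
    intro x
    show (Ideal.absNorm x.1.1 : ℝ) ^ (-s) = _
    rw [x.2]
  simp_rw [h1]
  rw [tsum_const, nsmul_eq_mul]
  rcases eq_or_ne n 0 with rfl | hn
  · have : IsEmpty {I : {I : Ideal (𝓞 K) // I ≠ ⊥} // Ideal.absNorm I.1 = 0} :=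
      ⟨fun I => I.1.2 (Ideal.absNorm_eq_zero_iff.mp I.2)⟩
    simp
  · rw [LSeries.norm_term_eq, if_neg hn]
    have hc : Nat.card {I : {I : Ideal (𝓞 K) // I ≠ ⊥} // Ideal.absNorm I.1 = n} ≤
        Nat.card {I : Ideal (𝓞 K) // Ideal.absNorm I = n} := by
      have := (Ideal.finite_setOfPred_absNorm_eq (S := 𝓞 K) n).to_subtype
      have : Finite {I : Ideal (𝓞 K) // Ideal.absNorm I = n} := this
      exact Nat.card_le_card_of_injective
        (fun I => (⟨I.1.1, I.2⟩ : {I : Ideal (𝓞 K) // Ideal.absNorm I = n}))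
        (fun a b h => Subtype.ext (Subtype.ext (Subtype.mk.inj h)))
    rw [Real.rpow_neg (Nat.cast_nonneg _), ← div_eq_mul_inv]
    simp only [Complex.ofReal_natCast, Complex.norm_natCast, Complex.ofReal_re]
    gcongr

/-- A nonzero ideal has at most `N I` divisors. -/
theorem aux_divisors (K : Type*) [Field K] [NumberField K] (I : Ideal (𝓞 K)) :
    I ≠ 0 → {D : Ideal (𝓞 K) | D ∣ I}.Finite ∧
      {D : Ideal (𝓞 K) | D ∣ I}.ncard ≤ Ideal.absNorm I := by
  induction I using UniqueFactorizationMonoid.induction_on_prime with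
  | h₁ => intro h; exact absurd rfl h
  | h₂ x hx =>
    intro _
    have : {D : Ideal (𝓞 K) | D ∣ x} = {1} := by
      ext D
      rw [Set.mem_singleton_iff, Ideal.one_eq_top, ← Ideal.isUnit_iff]
      exact ⟨fun h => isUnit_of_dvd_unit h hx, fun h => h.dvd⟩
    rw [this]
    have hx1 : x = ⊤ := Ideal.isUnit_iff.mp hx
    subst hx1
    simp
  | h₃ a p ha hp ih =>
    intro _
    obtain ⟨hf, hcard⟩ := ih ha
    have hsub : {D : Ideal (𝓞 K) | D ∣ p * a} ⊆
        {D : Ideal (𝓞 K) | D ∣ a} ∪ (fun D => p * D) '' {D : Ideal (𝓞 K) | D ∣ a} := by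
      rintro D ⟨E, hE⟩
      have hE' : p * a = D * E := hE
      rcases hp.dvd_or_dvd (hE' ▸ dvd_mul_right p a : p ∣ D * E) with ⟨F, hF⟩ | ⟨F, hF⟩
      · right
        refine ⟨F, ⟨E, mul_left_cancel₀ hp.ne_zero ?_⟩, hF.symm⟩
        rw [hE', hF, mul_assoc]
      · left
        refine ⟨F, mul_left_cancel₀ hp.ne_zero ?_⟩
        rw [hE', hF, mul_left_comm]
    have hf2 := hf.union (hf.image (fun D => p * D))
    refine ⟨hf2.subset hsub, ?_⟩
    have hp2 : 2 ≤ Ideal.absNorm p := by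
      have h0 : Ideal.absNorm p ≠ 0 := fun h => hp.ne_zero (Ideal.absNorm_eq_zero_iff.mp h)
      have h1 : Ideal.absNorm p ≠ 1 := fun h =>
        hp.not_unit (Ideal.isUnit_iff.mpr (Ideal.absNorm_eq_one_iff.mp h))
      omega
    calc _ ≤ _ := Set.ncard_le_ncard hsub hf2
      _ ≤ _ := Set.ncard_union_le _ _
      _ ≤ {D : Ideal (𝓞 K) | D ∣ a}.ncard + {D : Ideal (𝓞 K) | D ∣ a}.ncard :=
          Nat.add_le_add_left (Set.ncard_image_le hf) _
      _ ≤ Ideal.absNorm p * Ideal.absNorm a := by nlinarith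
      _ = _ := (map_mul _ _ _).symm

/-- `ζ_K(s+1)^2 ≤ ζ_K(s)` for `s > 1`. -/
theorem aux_sq_le (K : Type*) [Field K] [NumberField K] (s : ℝ) (hs : 1 < s) :
    dedekindZetaReal K (s + 1) ^ 2 ≤ dedekindZetaReal K s := by
  have hS := aux_summable K s hs
  have hS1 := aux_summable K (s + 1) (by linarith)
  have hP := hS1.mul_of_nonneg hS1 (fun _ => by positivity) (fun _ => by positivity)
  unfold dedekindZetaReal
  rw [sq, hS1.tsum_mul_tsum hS1 hP]
  let m : {I : Ideal (𝓞 K) // I ≠ ⊥} × {I : Ideal (𝓞 K) // I ≠ ⊥} →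
      {I : Ideal (𝓞 K) // I ≠ ⊥} := fun z => ⟨z.1.1 * z.2.1, mul_ne_zero z.1.2 z.2.2⟩
  have hP' := (Equiv.sigmaFiberEquiv m).summable_iff.mpr hP
  rw [← (Equiv.sigmaFiberEquiv m).tsum_eq]
  have hP'' := hP'
  simp only [Function.comp_def] at hP''
  rw [hP''.tsum_sigma]
  refine Summable.tsum_le_tsum (fun I => ?_) hP''.sigma hS
  have h1 : ∀ x : {z // m z = I},
      (Ideal.absNorm ((Equiv.sigmaFiberEquiv m) ⟨I, x⟩).1.1 : ℝ) ^ (-(s + 1)) *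
      (Ideal.absNorm ((Equiv.sigmaFiberEquiv m) ⟨I, x⟩).2.1 : ℝ) ^ (-(s + 1)) =
      (Ideal.absNorm I.1 : ℝ) ^ (-(s + 1)) := by
    intro x
    show (Ideal.absNorm x.1.1.1 : ℝ) ^ (-(s + 1)) * (Ideal.absNorm x.1.2.1 : ℝ) ^ (-(s + 1)) = _
    rw [← Real.mul_rpow (Nat.cast_nonneg _) (Nat.cast_nonneg _), ← Nat.cast_mul, ← map_mul]
    have : x.1.1.1 * x.1.2.1 = I.1 := congrArg Subtype.val x.2
    rw [this]
  simp_rw [h1]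
  rw [tsum_const, nsmul_eq_mul]
  obtain ⟨hf, hcard⟩ := aux_divisors K I.1 I.2
  have hc : Nat.card {z // m z = I} ≤ Ideal.absNorm I.1 := by
    refine le_trans ?_ hcard
    rw [← Nat.card_coe_set_eq]
    have := hf.to_subtype
    refine Nat.card_le_card_of_injective
      (fun z : {z // m z = I} => (⟨z.1.1.1, ⟨z.1.2.1, (congrArg Subtype.val z.2).symm⟩⟩ :
        {D : Ideal (𝓞 K) | D ∣ I.1})) ?_
    intro a b h
    have h2 : a.1.1.1 = b.1.1.1 := Subtype.mk.inj h
    have ha : a.1.1.1 * a.1.2.1 = I.1 := congrArg Subtype.val a.2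
    have hb : b.1.1.1 * b.1.2.1 = I.1 := congrArg Subtype.val b.2
    have h3 : a.1.2.1 = b.1.2.1 := by
      apply mul_left_cancel₀ (a := a.1.1.1) a.1.1.2
      rw [ha, h2, hb]
    exact Subtype.ext (Prod.ext (Subtype.ext h2) (Subtype.ext h3))
  have hpos : (0 : ℝ) < Ideal.absNorm I.1 := by
    exact_mod_cast Nat.pos_of_ne_zero fun h => I.2 (Ideal.absNorm_eq_zero_iff.mp h)
  calc _ ≤ (Ideal.absNorm I.1 : ℝ) * (Ideal.absNorm I.1 : ℝ) ^ (-(s + 1)) := by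
        gcongr
    _ = _ := by
        rw [neg_add, Real.rpow_add hpos, Real.rpow_neg_one]
        field_simp

/-- `1 < ζ_K(s)` for `s > 1`. -/
theorem aux_one_lt (K : Type*) [Field K] [NumberField K] (s : ℝ) (hs : 1 < s) :
    1 < dedekindZetaReal K s := by
  have hS := aux_summable K s hs
  have h2 : (Ideal.span {(2 : 𝓞 K)}) ≠ ⊥ := by simp
  have hne : (⟨⊤, top_ne_bot⟩ : {I : Ideal (𝓞 K) // I ≠ ⊥}) ≠ ⟨Ideal.span {(2 : 𝓞 K)}, h2⟩ := by
    intro h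
    have h' : (⊤ : Ideal (𝓞 K)) = Ideal.span {(2 : 𝓞 K)} := congrArg Subtype.val h
    have hn := congrArg Ideal.absNorm h'
    rw [Ideal.absNorm_top, Ideal.absNorm_span_singleton,
      show (2 : 𝓞 K) = algebraMap ℤ (𝓞 K) 2 by simp, Algebra.norm_algebraMap,
      Int.natAbs_pow] at hn
    have hr : Module.finrank ℤ (𝓞 K) ≠ 0 := by
      rw [RingOfIntegers.rank]; exact Module.finrank_pos.ne'
    exact absurd hn (Nat.one_lt_pow hr (by norm_num)).ne
  have h := hS.sum_le_tsum {⟨⊤, top_ne_bot⟩, ⟨Ideal.span {(2 : 𝓞 K)}, h2⟩}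
    (fun _ _ => by positivity)
  rw [Finset.sum_pair hne] at h
  have hpos : (0 : ℝ) < Ideal.absNorm (Ideal.span {(2 : 𝓞 K)}) := by
    exact_mod_cast Nat.pos_of_ne_zero fun h => h2 (Ideal.absNorm_eq_zero_iff.mp h)
  have := Real.rpow_pos_of_pos hpos (-s)
  simp only [Ideal.absNorm_top, Nat.cast_one, Real.one_rpow] at h
  unfold dedekindZetaReal
  linarith

/-- Let `k` be a totally real number field and `ℓ` a totally complex quadratic extension
of `k`. For every integer `j ≥ 2`, `ζ_k(j)^{1/2} · L_{ℓ|k}(j+1) > 1`, where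
`L_{ℓ|k}(s) = ζ_ℓ(s)/ζ_k(s)`. -/
theorem stmt_1 (k ℓ : Type*) [Field k] [NumberField k] [Field ℓ] [NumberField ℓ]
    [Algebra k ℓ] (hquad : Module.finrank k ℓ = 2)
    (hreal : ∀ v : InfinitePlace k, v.IsReal)
    (hcomplex : ∀ w : InfinitePlace ℓ, w.IsComplex)
    (j : ℕ) (hj : 2 ≤ j) :
    1 < Real.sqrt (dedekindZetaReal k j) *
      (dedekindZetaReal ℓ (j + 1) / dedekindZetaReal k (j + 1)) := by
  have hj' : (1 : ℝ) < j := by exact_mod_cast hj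
  have h1 := aux_sq_le k j hj'
  have h2 := aux_one_lt ℓ (j + 1) (by linarith)
  have h3 := aux_one_lt k (j + 1) (by linarith)
  have h4 : dedekindZetaReal k (j + 1) ≤ Real.sqrt (dedekindZetaReal k j) :=
    Real.le_sqrt_of_sq_le h1
  rw [← mul_div_assoc, lt_div_iff₀ (by linarith)]
  nlinarith
end

section
/- Let k be a totally real number field of degree d over ℚ with k ≠ ℚ (so d ≥ 2). Then the absolute value D_k of the discriminant of k satisfies D_k^{1/d} ≥ √5; equivalently, D_k^2 ≥ 5^d. -/
open NumberField

lemma pow_add_mul_le_aux (a j : ℕ) : a ^ j * a + (j + 1) * a ^ j ≤ (a + 1) ^ (j + 1) := by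
  induction j with
  | zero => simp
  | succ j ih =>
    have h := Nat.mul_le_mul_right (a + 1) ih
    rw [← pow_succ] at h
    refine le_trans ?_ h
    rw [pow_succ a j]
    nlinarith [Nat.zero_le ((j + 1) * a ^ j)]

lemma minkowski_aux (n : ℕ) (hn : 3 ≤ n) : 5 ^ n * (n.factorial) ^ 4 ≤ n ^ (4 * n) := by
  induction n, hn using Nat.le_induction with
  | base => decide
  | succ n hn ih =>
    have h2 : 2 * n ^ n ≤ (n + 1) ^ n := by
      obtain ⟨m, rfl⟩ : ∃ m, n = m + 1 := ⟨n - 1, by omega⟩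
      have h := pow_add_mul_le_aux (m + 1) m
      rw [pow_succ (m + 1) m]
      linarith
    have h3 : 5 * n ^ (4 * n) ≤ (n + 1) ^ (4 * n) := by
      have h4 := Nat.pow_le_pow_left h2 4
      rw [mul_pow, ← pow_mul, ← pow_mul, mul_comm n 4] at h4
      nlinarith [Nat.zero_le (n ^ (4 * n))]
    calc 5 ^ (n + 1) * ((n + 1).factorial) ^ 4
        = 5 * (n + 1) ^ 4 * (5 ^ n * n.factorial ^ 4) := by
          rw [Nat.factorial_succ]; ring
      _ ≤ 5 * (n + 1) ^ 4 * n ^ (4 * n) := Nat.mul_le_mul_left _ ih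
      _ = (n + 1) ^ 4 * (5 * n ^ (4 * n)) := by ring
      _ ≤ (n + 1) ^ 4 * (n + 1) ^ (4 * n) := Nat.mul_le_mul_left _ h3
      _ = (n + 1) ^ (4 * (n + 1)) := by ring

lemma quad_discr_ne_four (k : Type*) [Field k] [NumberField k]
    (hd : Module.finrank ℚ k = 2) : NumberField.discr k ≠ 4 := by
  intro h4
  -- an element of trace zero
  have hker : ∃ x : k, x ≠ 0 ∧ Algebra.trace ℚ k x = 0 := by
    by_contra! hcon
    have hinj : Function.Injective (Algebra.trace ℚ k) := by
      rw [injective_iff_map_eq_zero]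
      intro a ha
      by_contra hne
      exact hcon a hne ha
    have := LinearMap.finrank_le_finrank_of_injective hinj
    rw [hd, Module.finrank_self] at this
    omega
  obtain ⟨x, hx0, hx⟩ := hker
  let b0 := integralBasis k
  have hcard : Fintype.card (Module.Free.ChooseBasisIndex ℤ (𝓞 k)) = 2 := by
    rw [← Module.finrank_eq_card_basis b0, hd]
  let e := Fintype.equivFinOfCardEq hcard
  let b := b0.reindex e
  have hb : Algebra.discr ℚ b = 4 := by
    have := coe_discr k
    rw [h4] at this
    rw [Module.Basis.coe_reindex, Algebra.discr_reindex, ← this]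
    norm_num
  -- the square of x is rational
  obtain ⟨m, hm⟩ : ∃ m : ℚ, x ^ 2 = algebraMap ℚ k m := by
    have hc := (Algebra.leftMulMatrix b x).aeval_self_charpoly
    rw [(Algebra.leftMulMatrix b x).charpoly_of_card_eq_two (Fintype.card_fin 2)] at hc
    rw [← Algebra.trace_eq_matrix_trace b, hx] at hc
    refine ⟨-(Algebra.leftMulMatrix b x).det, ?_⟩
    apply Algebra.leftMulMatrix_injective b
    rw [AlgHom.commutes, map_pow]
    simp at hc
    rw [map_neg]
    exact eq_neg_of_add_eq_zero_left hc
  have hdis : Algebra.discr ℚ (![1, x] : Fin 2 → k) = 4 * m := by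
    rw [Algebra.discr_def, Matrix.det_fin_two]
    simp only [Algebra.traceMatrix_apply, Algebra.traceForm_apply, Matrix.cons_val_zero,
      Matrix.cons_val_one, one_mul, mul_one, hx, ← pow_two, hm, Algebra.trace_algebraMap, hd]
    have h1 : Algebra.trace ℚ k 1 = 2 := by
      have := Algebra.trace_algebraMap (S := k) (1 : ℚ)
      rw [map_one, hd] at this
      simpa using this
    simp [h1]
    ring
  have hdis2 := Algebra.discr_of_matrix_vecMul (b : Fin 2 → k) (b.toMatrix ![1, x])
  rw [Module.Basis.toMatrix_map_vecMul, hdis, hb] at hdis2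
  set r := (b.toMatrix ![1, x]).det
  have hmr : m = r ^ 2 := by linarith
  rw [hmr, map_pow] at hm
  have key : ∀ s : ℚ, x ≠ algebraMap ℚ k s := by
    rintro s rfl
    rw [Algebra.trace_algebraMap, hd] at hx
    have : s = 0 := by simpa using hx
    simp [this] at hx0
  rcases sq_eq_sq_iff_eq_or_eq_neg.mp hm with h | h
  · exact key r h
  · exact key (-r) (by rw [h, map_neg])

/-- Let `k` be a totally real number field of degree `d` over `ℚ` with `k ≠ ℚ`, i.e. `d ≥ 2`.
Then the absolute value `D_k` of the discriminant of `k` satisfies `D_k^{1/d} ≥ √5`,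
equivalently `D_k² ≥ 5^d`. -/
theorem stmt_4 (k : Type*) [Field k] [NumberField k]
    (hreal : ∀ v : InfinitePlace k, v.IsReal)
    (d : ℕ) (hd : Module.finrank ℚ k = d) (hd2 : 2 ≤ d) :
    (5 : ℤ) ^ d ≤ |NumberField.discr k| ^ 2 := by
  have hr2 : InfinitePlace.nrComplexPlaces k = 0 :=
    nrComplexPlaces_eq_zero_iff.mpr ⟨hreal⟩
  have hM := abs_discr_ge' k
  rw [hr2, hd] at hM
  simp only [mul_zero, pow_zero, one_mul] at hM
  have hfac : (0 : ℝ) < (d.factorial : ℝ) ^ 2 := by positivity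
  rw [div_le_iff₀ hfac] at hM
  have hN : (d : ℤ) ^ (2 * d) ≤ |discr k| * (d.factorial : ℤ) ^ 2 := by exact_mod_cast hM
  rcases hd2.eq_or_lt with h2 | h3
  · subst h2
    have hs := sign_discr k
    rw [hr2, pow_zero, Int.sign_eq_one_iff_pos] at hs
    rw [abs_of_pos hs] at hN ⊢
    have hne := quad_discr_ne_four k hd
    norm_num [Nat.factorial] at hN
    have : 5 ≤ discr k := by omega
    nlinarith
  · have haux : (5 : ℤ) ^ d * (d.factorial : ℤ) ^ 4 ≤ (d : ℤ) ^ (4 * d) := by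
      exact_mod_cast minkowski_aux d h3
    have hsq := pow_le_pow_left₀ (by positivity) hN 2
    have hpos : (0 : ℤ) < (d.factorial : ℤ) ^ 4 := by positivity
    refine le_of_mul_le_mul_right ?_ hpos
    calc _ ≤ (d : ℤ) ^ (4 * d) := haux
      _ = ((d : ℤ) ^ (2 * d)) ^ 2 := by rw [← pow_mul]; congr 1; ring
      _ ≤ _ := hsq
      _ = _ := by ring
end

section
/- Let k be a totally real number field of degree d ≥ 3 over ℚ. Then the absolute value D_k of the discriminant of k satisfies D_k^{1/d} ≥ 49^{1/3}; equivalently, D_k^3 ≥ 49^d. -/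
open NumberField
open Module

theorem aux_exists_basis {M : Type*} [AddCommGroup M] {n : ℕ} (b : Basis (Fin (n+1)) ℤ M) (v : M)
    (hv : ∀ (c : ℤ) (w : M), v = c • w → IsUnit c) :
    ∃ b' : Basis (Fin (n+1)) ℤ M, b' 0 = v := by
  classical
  have hfree : Module.Free ℤ M := Module.Free.of_basis b
  have hfin : Module.Finite ℤ M := Module.Finite.of_basis b
  obtain ⟨f, hf⟩ : ∃ f : M →ₗ[ℤ] ℤ, f v = 1 := by
    let I : Ideal ℤ := LinearMap.range (LinearMap.applyₗ (R := ℤ) (M₂ := ℤ) v)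
    obtain ⟨g, hg⟩ := IsPrincipalIdealRing.principal I
    have hdvd : ∀ i, g ∣ b.repr v i := by
      intro i
      have : b.coord i v ∈ I := ⟨b.coord i, rfl⟩
      rw [hg] at this
      exact Ideal.mem_span_singleton.mp this
    choose c hc using hdvd
    have h1 : v = g • ∑ i, c i • b i := by
      conv_lhs => rw [← b.sum_repr v]
      rw [Finset.smul_sum]
      refine Finset.sum_congr rfl fun i _ => ?_
      rw [hc i, mul_smul]
    have hu := hv g _ h1
    have h2 : (1 : ℤ) ∈ I := by
      have : I = ⊤ := by
        rw [hg]; exact Ideal.span_singleton_eq_top.mpr hu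
      rw [this]; trivial
    obtain ⟨f, hf⟩ := h2
    exact ⟨f, hf⟩
  let N := LinearMap.ker f
  obtain ⟨m, ⟨bN⟩⟩ := Submodule.nonempty_basis_of_pid b N
  let b' := Basis.mkFinCons (N := N) v bN
    (by
      intro c x hx h
      have := congrArg f h
      have hx' : f x = 0 := hx
      simpa [hx', hf] using this)
    (by
      intro z
      refine ⟨- f z, ?_⟩
      change f _ = 0
      simp [hf])
  have hb0 : b' 0 = v := by
    simp [b', Basis.coe_mkFinCons]
  have hcard : m + 1 = n + 1 := by
    simpa using Fintype.card_congr (b'.indexEquiv b)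
  obtain rfl : m = n := by omega
  exact Exists.intro b' hb0

noncomputable def gramDet {M : Type*} [AddCommGroup M] {n : ℕ} (B : LinearMap.BilinForm ℤ M)
    (b : Fin n → M) : ℤ := (Matrix.of fun i j => B (b i) (b j)).det

theorem gramDet_eq {M : Type*} [AddCommGroup M] {n : ℕ} (B : LinearMap.BilinForm ℤ M)
    (b c : Basis (Fin n) ℤ M) : gramDet B b = gramDet B c := by
  have h : ∀ b : Basis (Fin n) ℤ M, gramDet B b = (LinearMap.BilinForm.toMatrix b B).det := by
    intro b
    unfold gramDet
    congr 1
    ext i j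
    simp [LinearMap.BilinForm.toMatrix_apply]
  rw [h, h, ← LinearMap.BilinForm.toMatrix_mul_basis_toMatrix b c B]
  rw [Matrix.det_mul, Matrix.det_mul, Matrix.det_transpose]
  have hu : IsUnit (b.toMatrix c).det := by
    have := Basis.toMatrix_mul_toMatrix_flip b c
    have h2 := congrArg Matrix.det this
    rw [Matrix.det_mul, Matrix.det_one] at h2
    exact IsUnit.of_mul_eq_one _ h2
  rcases Int.isUnit_iff.mp hu with h1 | h1 <;> rw [h1] <;> ring

theorem aux_exists_min {M : Type*} [AddCommGroup M] [Nontrivial M] (B : LinearMap.BilinForm ℤ M)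
    (hpos : ∀ x, x ≠ 0 → 0 < B x x) :
    ∃ v, v ≠ 0 ∧ ∀ x, x ≠ 0 → B v v ≤ B x x := by
  obtain ⟨x0, hx0⟩ := exists_ne (0 : M)
  let S : Set ℕ := {k | ∃ x, x ≠ 0 ∧ B x x = k}
  have hS : S.Nonempty := ⟨(B x0 x0).toNat, x0, hx0, (Int.toNat_of_nonneg (hpos _ hx0).le).symm⟩
  obtain ⟨v, hv, hvv⟩ := Nat.sInf_mem hS
  refine ⟨v, hv, fun x hx => ?_⟩
  have h1 : (B x x).toNat ∈ S := ⟨x, hx, (Int.toNat_of_nonneg (hpos _ hx).le).symm⟩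
  have h2 := Nat.sInf_le h1
  have h3 := hpos x hx
  omega

theorem aux_min_prim {M : Type*} [AddCommGroup M] (B : LinearMap.BilinForm ℤ M)
    (hpos : ∀ x, x ≠ 0 → 0 < B x x) (v : M) (hv : v ≠ 0) (hmin : ∀ x, x ≠ 0 → B v v ≤ B x x)
    (c : ℤ) (w : M) (h : v = c • w) : IsUnit c := by
  have hw : w ≠ 0 := by rintro rfl; simp at h; exact hv h
  have hc : c ≠ 0 := by rintro rfl; simp at h; exact hv h
  have h1 := hmin w hw
  have h2 := hpos w hw
  have h3 : B v v = c ^ 2 * B w w := by rw [h]; simp; ring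
  rw [h3] at h1
  have h4 : c ^ 2 ≤ 1 := by nlinarith
  have h5 : c ≤ 1 := by nlinarith
  have h6 : -1 ≤ c := by nlinarith
  rw [Int.isUnit_iff]; omega

theorem aux_min_basis {M : Type*} [AddCommGroup M] {n : ℕ} (B : LinearMap.BilinForm ℤ M)
    (b : Basis (Fin (n+1)) ℤ M) (hpos : ∀ x, x ≠ 0 → 0 < B x x) :
    ∃ b' : Basis (Fin (n+1)) ℤ M, ∀ x, x ≠ 0 → B (b' 0) (b' 0) ≤ B x x := by
  have : Nontrivial M := ⟨⟨b 0, 0, b.ne_zero 0⟩⟩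
  obtain ⟨v, hv, hmin⟩ := aux_exists_min B hpos
  obtain ⟨b', hb'⟩ := aux_exists_basis b v (aux_min_prim B hpos v hv hmin)
  exact ⟨b', by rw [hb']; exact hmin⟩

theorem aux_round (a h : ℤ) (ha : 0 < a) : ∃ t : ℤ, 4 * (h - t * a) ^ 2 ≤ a ^ 2 := by
  refine ⟨(2 * h + a) / (2 * a), ?_⟩
  have h1 := Int.emod_add_mul_ediv (2 * h + a) (2 * a)
  have h2 := Int.emod_nonneg (2 * h + a) (b := 2 * a) (by omega)
  have h3 := Int.emod_lt_of_pos (2 * h + a) (b := 2 * a) (by omega)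
  set t := (2 * h + a) / (2 * a)
  set r := (2 * h + a) % (2 * a)
  have h4 : 2 * (h - t * a) = r - a := by linarith
  nlinarith

theorem aux_reduce {M : Type*} [AddCommGroup M] (B : LinearMap.BilinForm ℤ M)
    (hs : ∀ x y, B x y = B y x) (v : M) (hv : 0 < B v v) (hmin : ∀ x, x ≠ 0 → B v v ≤ B x x)
    (x : M) (hx : ∀ t : ℤ, x ≠ t • v) :
    3 * (B v v) ^ 2 ≤ 4 * (B v v * B x x - B x v * B x v) := by
  obtain ⟨t, ht⟩ := aux_round (B v v) (B x v) hv
  have h1 := hmin (x - t • v) (sub_ne_zero.mpr (hx t))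
  have h2 : B (x - t • v) (x - t • v) = B x x - 2 * t * B x v + t ^ 2 * B v v := by
    simp [hs v x]; ring
  rw [h2] at h1
  nlinarith

theorem aux_notmul {M : Type*} [AddCommGroup M] {n : ℕ} (b : Basis (Fin (n+1)) ℤ M)
    (x : Fin n → ℤ) (hx : x ≠ 0) (s t : ℤ) (hs : s ≠ 0) :
    s • Fintype.linearCombination ℤ (fun i : Fin n => b i.succ) x ≠ t • b 0 := by
  intro h
  apply hx
  funext i
  have := congrArg (fun z => b.repr z i.succ) h
  simpa [Fintype.linearCombination_apply, Finsupp.single_apply, hs, Fin.succ_ne_zero,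
    (Fin.succ_ne_zero _).symm] using this

noncomputable def projForm {M : Type*} [AddCommGroup M] {n : ℕ} (B : LinearMap.BilinForm ℤ M)
    (b : Fin (n+1) → M) : LinearMap.BilinForm ℤ (Fin n → ℤ) :=
  LinearMap.mk₂ ℤ (fun x y =>
    B (b 0) (b 0) * B (Fintype.linearCombination ℤ (fun i : Fin n => b i.succ) x)
      (Fintype.linearCombination ℤ (fun i : Fin n => b i.succ) y)
    - B (Fintype.linearCombination ℤ (fun i : Fin n => b i.succ) x) (b 0)
      * B (Fintype.linearCombination ℤ (fun i : Fin n => b i.succ) y) (b 0))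
    (by intros; simp; ring)
    (by intros; simp only [map_smul, LinearMap.smul_apply, smul_eq_mul]; ring)
    (by intros; simp; ring)
    (by intros; simp only [map_smul, LinearMap.smul_apply, smul_eq_mul]; ring)

theorem projForm_apply {M : Type*} [AddCommGroup M] {n : ℕ} (B : LinearMap.BilinForm ℤ M)
    (b : Fin (n+1) → M) (x y) : projForm B b x y =
    B (b 0) (b 0) * B (Fintype.linearCombination ℤ (fun i : Fin n => b i.succ) x)
      (Fintype.linearCombination ℤ (fun i : Fin n => b i.succ) y)
    - B (Fintype.linearCombination ℤ (fun i : Fin n => b i.succ) x) (b 0)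
      * B (Fintype.linearCombination ℤ (fun i : Fin n => b i.succ) y) (b 0) := rfl

theorem projForm_single {M : Type*} [AddCommGroup M] {n : ℕ} (B : LinearMap.BilinForm ℤ M)
    (b : Fin (n+1) → M) (i j : Fin n) :
    projForm B b (Pi.basisFun ℤ (Fin n) i) (Pi.basisFun ℤ (Fin n) j) =
    B (b 0) (b 0) * B (b i.succ) (b j.succ) - B (b i.succ) (b 0) * B (b j.succ) (b 0) := by
  rw [projForm_apply]
  simp [Fintype.linearCombination_apply_single]

theorem projForm_symm {M : Type*} [AddCommGroup M] {n : ℕ} (B : LinearMap.BilinForm ℤ M)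
    (hs : ∀ x y, B x y = B y x)
    (b : Fin (n+1) → M) (x y) : projForm B b x y = projForm B b y x := by
  rw [projForm_apply, projForm_apply, hs (Fintype.linearCombination ℤ _ x)
    (Fintype.linearCombination ℤ _ y)]
  ring

theorem gramDet_proj2 {M : Type*} [AddCommGroup M] (B : LinearMap.BilinForm ℤ M)
    (hs : ∀ x y, B x y = B y x) (b : Fin 3 → M) :
    gramDet (projForm B b) (Pi.basisFun ℤ (Fin 2)) = B (b 0) (b 0) * gramDet B b := by
  unfold gramDet
  rw [Matrix.det_fin_two, Matrix.det_fin_three]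
  simp only [Matrix.of_apply, projForm_single]
  simp only [Fin.succ_zero_eq_one, Fin.succ_one_eq_two, Fin.isValue]
  rw [hs (b 1) (b 0), hs (b 2) (b 0), hs (b 2) (b 1)]
  ring

theorem gramDet_proj3 {M : Type*} [AddCommGroup M] (B : LinearMap.BilinForm ℤ M)
    (hs : ∀ x y, B x y = B y x) (b : Fin 4 → M) :
    gramDet (projForm B b) (Pi.basisFun ℤ (Fin 3)) = B (b 0) (b 0) ^ 2 * gramDet B b := by
  unfold gramDet
  rw [Matrix.det_fin_three, Matrix.det_succ_row_zero]
  simp only [Matrix.det_fin_three, Matrix.submatrix_apply, Fin.sum_univ_four,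
    Matrix.of_apply, projForm_single]
  have e1 : (0 : Fin 3).succ = (1 : Fin 4) := rfl
  have e2 : (1 : Fin 3).succ = (2 : Fin 4) := rfl
  have e3 : (2 : Fin 3).succ = (3 : Fin 4) := rfl
  simp only [e1, e2, e3]
  simp [Fin.succAbove, Fin.lt_def, e1, e2, e3]
  rw [hs (b 1) (b 0), hs (b 2) (b 0), hs (b 3) (b 0), hs (b 2) (b 1), hs (b 3) (b 1),
    hs (b 3) (b 2)]
  ring

theorem herm2 {M : Type*} [AddCommGroup M] (B : LinearMap.BilinForm ℤ M)
    (hs : ∀ x y, B x y = B y x)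
    (b : Basis (Fin 2) ℤ M) (hpos : ∀ x, x ≠ 0 → 0 < B x x) :
    ∃ x, x ≠ 0 ∧ 3 * (B x x) ^ 2 ≤ 4 * gramDet B b := by
  obtain ⟨b', hb'⟩ := aux_min_basis B b hpos
  refine ⟨b' 0, b'.ne_zero 0, ?_⟩
  rw [gramDet_eq B b b']
  have h := aux_reduce B hs (b' 0) (hpos _ (b'.ne_zero 0)) hb' (b' 1) (by
    intro t h
    have := congrArg (fun z => b'.repr z 1) h
    simp at this)
  unfold gramDet
  rw [Matrix.det_fin_two]
  simp only [Matrix.of_apply]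
  rw [hs (b' 0) (b' 1)]
  exact h

theorem herm3 {M : Type*} [AddCommGroup M] (B : LinearMap.BilinForm ℤ M)
    (hs : ∀ x y, B x y = B y x)
    (b : Basis (Fin 3) ℤ M) (hpos : ∀ x, x ≠ 0 → 0 < B x x) :
    ∃ x, x ≠ 0 ∧ 27 * (B x x) ^ 3 ≤ 64 * gramDet B b := by
  obtain ⟨b', hb'⟩ := aux_min_basis B b hpos
  refine ⟨b' 0, b'.ne_zero 0, ?_⟩
  rw [gramDet_eq B b b']
  have ha := hpos _ (b'.ne_zero 0)
  have key : ∀ x : Fin 2 → ℤ, x ≠ 0 →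
      3 * (B (b' 0) (b' 0)) ^ 2 ≤ 4 * projForm B b' x x := by
    intro x hx
    rw [projForm_apply]
    exact aux_reduce B hs (b' 0) ha hb' _ (by
      intro t
      simpa using aux_notmul b' x hx 1 t one_ne_zero)
  obtain ⟨x, hx, h⟩ := herm2 (projForm B b') (projForm_symm B hs b') (Pi.basisFun ℤ (Fin 2))
    (fun x hx => by nlinarith [key x hx])
  rw [gramDet_proj2 B hs] at h
  have h1 := key x hx
  generalize B (b' 0) (b' 0) = a at *
  generalize projForm B b' x x = q at *
  generalize gramDet B b' = D at *
  have h2 : 9 * a ^ 4 ≤ 16 * q ^ 2 := by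
    have := pow_le_pow_left₀ (by positivity) h1 2
    nlinarith
  have h3 : a * (27 * a ^ 3) ≤ a * (64 * D) := by nlinarith
  exact le_of_mul_le_mul_left h3 ha

theorem aux_embeddings (k : Type*) [Field k] [NumberField k]
    (hreal : ∀ v : InfinitePlace k, v.IsReal)
    (d : ℕ) (hd : Module.finrank ℚ k = d) :
    ∃ r : Fin d → (𝓞 k →+* ℝ), (∀ i, Function.Injective (r i)) ∧
      (∀ x, ((Algebra.trace ℤ (𝓞 k) x : ℤ) : ℝ) = ∑ i, r i x) ∧
      (∀ x, ((Algebra.norm ℤ x : ℤ) : ℝ) = ∏ i, r i x) := by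
  classical
  have htr : IsTotallyReal k := ⟨hreal⟩
  have hcard : Fintype.card (k →ₐ[ℚ] ℂ) = d := by rw [AlgHom.card, hd]
  let e : Fin d ≃ (k →ₐ[ℚ] ℂ) := (Fintype.equivFinOfCardEq hcard).symm
  have hr : ∀ σ : k →ₐ[ℚ] ℂ, ComplexEmbedding.IsReal (σ : k →+* ℂ) :=
    fun σ => IsTotallyReal.complexEmbedding_isReal _
  let r : Fin d → (𝓞 k →+* ℝ) := fun i => ((hr (e i)).embedding).comp (algebraMap (𝓞 k) k)
  have hrc : ∀ i (x : 𝓞 k), ((r i x : ℝ) : ℂ) = e i (x : k) := by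
    intro i x
    exact ComplexEmbedding.IsReal.coe_embedding_apply (hr (e i)) (x : k)
  refine ⟨r, ?_, ?_, ?_⟩
  · intro i
    exact ((hr (e i)).embedding.injective).comp RingOfIntegers.coe_injective
  · intro x
    have h1 := trace_eq_sum_embeddings (K := ℚ) (L := k) ℂ (x := (x : k))
    rw [← Algebra.coe_trace_int] at h1
    have h2 : (((Algebra.trace ℤ (𝓞 k) x : ℤ) : ℝ) : ℂ) = ((∑ i, r i x : ℝ) : ℂ) := by
      push_cast
      simp_rw [hrc]
      rw [Equiv.sum_comp e (fun σ : k →ₐ[ℚ] ℂ => σ (x : k)), ← h1]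
      simp
    exact_mod_cast h2
  · intro x
    have h1 := Algebra.norm_eq_prod_embeddings ℚ ℂ (x : k)
    rw [← Algebra.coe_norm_int] at h1
    have h2 : (((Algebra.norm ℤ x : ℤ) : ℝ) : ℂ) = ((∏ i, r i x : ℝ) : ℂ) := by
      push_cast
      simp_rw [hrc]
      rw [Equiv.prod_comp e (fun σ : k →ₐ[ℚ] ℂ => σ (x : k)), ← h1]
      simp
    exact_mod_cast h2

theorem aux_parity (k : Type*) [Field k] [NumberField k] (x : 𝓞 k) :
    (2 : ℤ) ∣ Algebra.trace ℤ (𝓞 k) (x ^ 2) - (Algebra.trace ℤ (𝓞 k) x) ^ 2 := by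
  classical
  let b := RingOfIntegers.basis k
  have h := ZMod.trace_pow_card (p := 2) ((Algebra.leftMulMatrix b x).map (Int.castRingHom (ZMod 2)))
  rw [Algebra.trace_eq_matrix_trace b, Algebra.trace_eq_matrix_trace b, map_pow]
  refine (ZMod.intCast_zmod_eq_zero_iff_dvd _ 2).mp ?_
  push_cast
  have h3 : ∀ A : Matrix (Free.ChooseBasisIndex ℤ (𝓞 k)) (Free.ChooseBasisIndex ℤ (𝓞 k)) ℤ,
      ((A.trace : ℤ) : ZMod 2) =
      (A.map (Int.castRingHom (ZMod 2))).trace := by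
    intro A; simp [Matrix.trace]
  rw [h3, h3, sub_eq_zero, ← h]
  congr 1
  exact map_pow (RingHom.mapMatrix (Int.castRingHom (ZMod 2))) _ 2

theorem aux_trace_ge {k : Type*} [Field k] [NumberField k] {d : ℕ} (hd3 : 0 < d)
    (r : Fin d → (𝓞 k →+* ℝ)) (hinj : ∀ i, Function.Injective (r i))
    (htr : ∀ x, ((Algebra.trace ℤ (𝓞 k) x : ℤ) : ℝ) = ∑ i, r i x)
    (hnm : ∀ x, ((Algebra.norm ℤ x : ℤ) : ℝ) = ∏ i, r i x)
    (x : 𝓞 k) (hx : ∀ t : ℤ, x ≠ t) : (d : ℤ) + 1 ≤ Algebra.trace ℤ (𝓞 k) (x ^ 2) := by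
  by_contra hcon
  have hle : Algebra.trace ℤ (𝓞 k) (x ^ 2) ≤ d := by omega
  have hx0 : x ≠ 0 := by simpa using hx 0
  have hri : ∀ i, r i x ≠ 0 := fun i h => hx0 (hinj i (by rw [h, map_zero]))
  have hpos : ∀ i, 0 < r i x ^ 2 := fun i => by have := hri i; positivity
  have hle' : ∑ i, r i x ^ 2 ≤ (d : ℝ) := by
    have h1 := htr (x ^ 2)
    simp only [map_pow] at h1
    rw [← h1]; exact_mod_cast hle
  have hN : Algebra.norm ℤ x ≠ 0 := by
    intro h
    have h1 := hnm x
    rw [h] at h1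
    exact (Finset.prod_ne_zero_iff.mpr fun i _ => hri i) (by rw [← h1]; simp)
  have hprod : 1 ≤ ∏ i, r i x ^ 2 := by
    rw [Finset.prod_pow, ← hnm x]
    have : 1 ≤ (Algebra.norm ℤ x) ^ 2 := by
      have : 0 < (Algebra.norm ℤ x) ^ 2 := by positivity
      omega
    exact_mod_cast this
  have hlog : 0 ≤ ∑ i, Real.log (r i x ^ 2) := by
    rw [← Real.log_prod (fun i _ => (hpos i).ne')]
    exact Real.log_nonneg hprod
  have hex : ∃ i, r i x ^ 2 = 1 := by
    by_contra hne
    push Not at hne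
    have : Nonempty (Fin d) := ⟨⟨0, hd3⟩⟩
    have h1 : ∑ i, Real.log (r i x ^ 2) < ∑ i, (r i x ^ 2 - 1) :=
      Finset.sum_lt_sum_of_nonempty Finset.univ_nonempty
        fun i _ => Real.log_lt_sub_one_of_pos (hpos i) (hne i)
    rw [Finset.sum_sub_distrib] at h1
    simp only [Finset.sum_const, Finset.card_univ, Fintype.card_fin, nsmul_eq_mul,
      mul_one] at h1
    linarith
  obtain ⟨i, hi⟩ := hex
  rcases (show r i x = 1 ∨ r i x = -1 from by simpa using hi) with h | h
  · exact hx 1 (hinj i (by simp [h]))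
  · exact hx (-1) (hinj i (by simp [h]))

theorem aux_trace_int {k : Type*} [Field k] [NumberField k] {d : ℕ}
    (hd : Module.finrank ℚ k = d) (t : ℤ) : Algebra.trace ℤ (𝓞 k) (t : 𝓞 k) = d * t := by
  have h := Algebra.trace_algebraMap (R := ℤ) (S := 𝓞 k) t
  rw [RingOfIntegers.rank, hd] at h
  simpa using h

theorem aux_shift {k : Type*} [Field k] [NumberField k] {d : ℕ}
    (hd : Module.finrank ℚ k = d) (x : 𝓞 k) (t : ℤ) :
    Algebra.trace ℤ (𝓞 k) (x - t) = Algebra.trace ℤ (𝓞 k) x - d * t ∧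
    d * Algebra.trace ℤ (𝓞 k) ((x - t) ^ 2) - (Algebra.trace ℤ (𝓞 k) (x - t)) ^ 2 =
    d * Algebra.trace ℤ (𝓞 k) (x ^ 2) - (Algebra.trace ℤ (𝓞 k) x) ^ 2 := by
  have h1 : Algebra.trace ℤ (𝓞 k) (x - t) = Algebra.trace ℤ (𝓞 k) x - d * t := by
    rw [map_sub, aux_trace_int hd]
  refine ⟨h1, ?_⟩
  have h2 : (x - t) ^ 2 = x ^ 2 - (2 * t) • x + ((t ^ 2 : ℤ) : 𝓞 k) := by
    rw [zsmul_eq_mul]; push_cast; ring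
  rw [h1, h2, map_add, map_sub, map_smul, aux_trace_int hd, smul_eq_mul]
  ring

theorem aux_L4 {k : Type*} [Field k] [NumberField k]
    (hd : Module.finrank ℚ k = 4)
    (r : Fin 4 → (𝓞 k →+* ℝ)) (hinj : ∀ i, Function.Injective (r i))
    (htr : ∀ x, ((Algebra.trace ℤ (𝓞 k) x : ℤ) : ℝ) = ∑ i, r i x)
    (hnm : ∀ x, ((Algebra.norm ℤ x : ℤ) : ℝ) = ∏ i, r i x)
    (x : 𝓞 k) (hx : ∀ t : ℤ, x ≠ t) :
    19 ≤ 4 * Algebra.trace ℤ (𝓞 k) (x ^ 2) - (Algebra.trace ℤ (𝓞 k) x) ^ 2 := by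
  obtain ⟨h1, h2⟩ := aux_shift hd x ((Algebra.trace ℤ (𝓞 k) x + 1) / 4)
  set t := (Algebra.trace ℤ (𝓞 k) x + 1) / 4 with ht
  push_cast at h1 h2
  rw [← h2]
  have hy : ∀ s : ℤ, x - t ≠ s := by
    intro s h
    exact hx (s + t) (by push_cast; rw [← h]; ring)
  have h3 := aux_trace_ge (by norm_num) r hinj htr hnm (x - t) hy
  have h4 := aux_parity k (x - t)
  have h5 : -1 ≤ Algebra.trace ℤ (𝓞 k) (x - t) := by omega
  have h6 : Algebra.trace ℤ (𝓞 k) (x - t) ≤ 2 := by omega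
  generalize Algebra.trace ℤ (𝓞 k) (x - t) = u at *
  generalize Algebra.trace ℤ (𝓞 k) ((x - t) ^ 2) = w at *
  push_cast at h3
  interval_cases u <;> omega

theorem aux_L3 {k : Type*} [Field k] [NumberField k]
    (hd : Module.finrank ℚ k = 3)
    (r : Fin 3 → (𝓞 k →+* ℝ)) (hinj : ∀ i, Function.Injective (r i))
    (htr : ∀ x, ((Algebra.trace ℤ (𝓞 k) x : ℤ) : ℝ) = ∑ i, r i x)
    (hnm : ∀ x, ((Algebra.norm ℤ x : ℤ) : ℝ) = ∏ i, r i x)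
    (x : 𝓞 k) (hx : ∀ t : ℤ, x ≠ t) :
    14 ≤ 3 * Algebra.trace ℤ (𝓞 k) (x ^ 2) - (Algebra.trace ℤ (𝓞 k) x) ^ 2 := by
  obtain ⟨h1, h2⟩ := aux_shift hd x ((Algebra.trace ℤ (𝓞 k) x + 1) / 3)
  set t := (Algebra.trace ℤ (𝓞 k) x + 1) / 3 with ht
  push_cast at h1 h2
  rw [← h2]
  have hy : ∀ s : ℤ, x - t ≠ s := by
    intro s h
    exact hx (s + t) (by push_cast; rw [← h]; ring)
  have h3 := aux_trace_ge (by norm_num) r hinj htr hnm (x - t) hy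
  have h4 := aux_parity k (x - t)
  have h5 : -1 ≤ Algebra.trace ℤ (𝓞 k) (x - t) := by omega
  have h6 : Algebra.trace ℤ (𝓞 k) (x - t) ≤ 1 := by omega
  have h7 : ¬ (Algebra.trace ℤ (𝓞 k) (x - t) = 0 ∧ Algebra.trace ℤ (𝓞 k) ((x - t) ^ 2) = 4) := by
    generalize x - (t : 𝓞 k) = y at hy
    rintro ⟨e1, e2⟩
    have f1 := htr y
    have f2 := htr (y ^ 2)
    have f3 := hnm y
    rw [e1, Fin.sum_univ_three] at f1
    rw [e2, Fin.sum_univ_three] at f2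
    rw [Fin.prod_univ_three] at f3
    simp only [map_pow] at f2
    push_cast at f1 f2
    have n1 : ∀ i, r i y ≠ 0 := fun i h => hy 0 (hinj i (by simp [h]))
    have n2 : ∀ i, r i y ≠ 1 := fun i h => hy 1 (hinj i (by simp [h]))
    have n3 : ∀ i, r i y ≠ -1 := fun i h => hy (-1) (hinj i (by simp [h]))
    have a0 := n1 0
    have a1 := n1 1
    have a2 := n1 2
    have b0 := sub_ne_zero.mpr (n2 0)
    have b1 := sub_ne_zero.mpr (n2 1)
    have b2 := sub_ne_zero.mpr (n2 2)
    have c0 := sub_ne_zero.mpr (n3 0)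
    have c1 := sub_ne_zero.mpr (n3 1)
    have c2 := sub_ne_zero.mpr (n3 2)
    generalize r 0 y = p at *
    generalize r 1 y = q at *
    generalize r 2 y = s at *
    generalize Algebra.norm ℤ y = c at *
    obtain rfl : s = -p - q := by linarith
    have hq : p ^ 2 + p * q + q ^ 2 = 2 := by nlinarith
    have hdisc : 27 * (c : ℝ) ^ 2 ≤ 32 := by
      have e : 32 - 27 * (c : ℝ) ^ 2 = ((p - q) * (2 * p + q) * (p + 2 * q)) ^ 2 := by
        rw [f3]
        have : (32 : ℝ) = 4 * (p ^ 2 + p * q + q ^ 2) ^ 3 := by rw [hq]; norm_num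
        rw [this]; ring
      nlinarith [sq_nonneg ((p - q) * (2 * p + q) * (p + 2 * q))]
    have hdisc' : 27 * c ^ 2 ≤ 32 := by exact_mod_cast hdisc
    have g1 : c ≤ 1 := by nlinarith
    have g2 : -1 ≤ c := by nlinarith
    have g3 : c = 0 ∨ c = 1 ∨ c = -1 := by omega
    rcases g3 with rfl | rfl | rfl
    · push_cast at f3
      exact (mul_ne_zero (mul_ne_zero a0 a1) a2) f3.symm
    · push_cast at f3
      exact (mul_ne_zero (mul_ne_zero c0 c1) c2) (by linear_combination (-1) * f3 - hq)
    · push_cast at f3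
      exact (mul_ne_zero (mul_ne_zero b0 b1) b2) (by linear_combination (-1) * f3 + hq)
  generalize Algebra.trace ℤ (𝓞 k) (x - t) = u at *
  generalize Algebra.trace ℤ (𝓞 k) ((x - t) ^ 2) = w at *
  push_cast at h3
  interval_cases u <;> omega

theorem aux_basis_one (k : Type*) [Field k] [NumberField k] {n : ℕ}
    (hd : Module.finrank ℚ k = n + 1) :
    ∃ b : Basis (Fin (n+1)) ℤ (𝓞 k), b 0 = 1 := by
  have hr : Module.finrank ℤ (𝓞 k) = n + 1 := by rw [RingOfIntegers.rank, hd]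
  apply aux_exists_basis (Module.finBasisOfFinrankEq ℤ (𝓞 k) hr) 1
  intro c w h
  have h1 : (1 : 𝓞 k) = (c : 𝓞 k) * w := by rw [h, zsmul_eq_mul]
  have h2 := congrArg (Algebra.norm ℤ) h1
  rw [map_one, map_mul] at h2
  have h3 : Algebra.norm ℤ (c : 𝓞 k) = c ^ (n + 1) := by
    have := Algebra.norm_algebraMap (R := ℤ) (S := 𝓞 k) c
    rw [hr] at this
    simpa using this
  rw [h3] at h2
  have : IsUnit (c ^ (n + 1)) := IsUnit.of_mul_eq_one _ h2.symm
  exact (isUnit_pow_iff (by omega)).mp this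

theorem aux_proj_trace {k : Type*} [Field k] [NumberField k] {n : ℕ}
    (hd : Module.finrank ℚ k = n + 1) (b : Basis (Fin (n+1)) ℤ (𝓞 k)) (hb : b 0 = 1)
    (x : Fin n → ℤ) (hx : x ≠ 0) :
    ∃ y : 𝓞 k, (∀ t : ℤ, y ≠ t) ∧ projForm (Algebra.traceForm ℤ (𝓞 k)) b x x =
      ((n + 1 : ℕ) : ℤ) * Algebra.trace ℤ (𝓞 k) (y ^ 2) - (Algebra.trace ℤ (𝓞 k) y) ^ 2 := by
  refine ⟨Fintype.linearCombination ℤ (fun i : Fin n => b i.succ) x, ?_, ?_⟩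
  · intro t
    simpa [hb] using aux_notmul b x hx 1 t one_ne_zero
  · rw [projForm_apply, hb]
    have h := aux_trace_int hd 1
    simp only [Algebra.traceForm_apply, mul_one]
    rw [Int.cast_one] at h
    rw [h]
    ring_nf

theorem aux_gram {k : Type*} [Field k] [NumberField k] {n : ℕ}
    (b : Basis (Fin n) ℤ (𝓞 k)) : gramDet (Algebra.traceForm ℤ (𝓞 k)) b = discr k := by
  rw [← discr_eq_discr k b]
  rfl

theorem aux_d3 (k : Type*) [Field k] [NumberField k]
    (hreal : ∀ v : InfinitePlace k, v.IsReal) (hd : Module.finrank ℚ k = 3) :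
    49 ≤ discr k := by
  obtain ⟨r, hinj, htr, hnm⟩ := aux_embeddings k hreal 3 hd
  obtain ⟨b, hb⟩ := aux_basis_one k (n := 2) hd
  have hsym : ∀ x y, Algebra.traceForm ℤ (𝓞 k) x y = Algebra.traceForm ℤ (𝓞 k) y x := by
    intro x y; simp only [Algebra.traceForm_apply, mul_comm]
  have key : ∀ x : Fin 2 → ℤ, x ≠ 0 → 14 ≤ projForm (Algebra.traceForm ℤ (𝓞 k)) b x x := by
    intro x hx
    obtain ⟨y, hy, h⟩ := aux_proj_trace hd b hb x hx
    rw [h]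
    exact aux_L3 hd r hinj htr hnm y hy
  obtain ⟨x, hx, h⟩ := herm2 (projForm (Algebra.traceForm ℤ (𝓞 k)) b)
    (projForm_symm _ hsym b) (Pi.basisFun ℤ (Fin 2)) (fun x hx => by linarith [key x hx])
  rw [gramDet_proj2 _ hsym, aux_gram, hb] at h
  have h1 := key x hx
  have h2 := aux_trace_int hd 1
  simp only [Algebra.traceForm_apply, mul_one] at h
  rw [Int.cast_one] at h2
  rw [h2] at h
  push_cast at h
  nlinarith

theorem aux_d4 (k : Type*) [Field k] [NumberField k]
    (hreal : ∀ v : InfinitePlace k, v.IsReal) (hd : Module.finrank ℚ k = 4) :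
    180 ≤ discr k := by
  obtain ⟨r, hinj, htr, hnm⟩ := aux_embeddings k hreal 4 hd
  obtain ⟨b, hb⟩ := aux_basis_one k (n := 3) hd
  have hsym : ∀ x y, Algebra.traceForm ℤ (𝓞 k) x y = Algebra.traceForm ℤ (𝓞 k) y x := by
    intro x y; simp only [Algebra.traceForm_apply, mul_comm]
  have key : ∀ x : Fin 3 → ℤ, x ≠ 0 → 19 ≤ projForm (Algebra.traceForm ℤ (𝓞 k)) b x x := by
    intro x hx
    obtain ⟨y, hy, h⟩ := aux_proj_trace hd b hb x hx
    rw [h]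
    exact aux_L4 hd r hinj htr hnm y hy
  obtain ⟨x, hx, h⟩ := herm3 (projForm (Algebra.traceForm ℤ (𝓞 k)) b)
    (projForm_symm _ hsym b) (Pi.basisFun ℤ (Fin 3)) (fun x hx => by linarith [key x hx])
  rw [gramDet_proj3 _ hsym, aux_gram, hb] at h
  have h1 := key x hx
  have h2 := aux_trace_int hd 1
  simp only [Algebra.traceForm_apply, mul_one] at h
  rw [Int.cast_one] at h2
  rw [h2] at h
  push_cast at h
  have h3 := pow_le_pow_left₀ (by norm_num) h1 3
  omega

theorem aux_fact (n : ℕ) (hn : 5 ≤ n) :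
    (49 : ℝ) ^ n * (n.factorial : ℝ) ^ 6 ≤ ((n : ℝ) ^ n) ^ 6 := by
  induction n, hn using Nat.le_induction with
  | base => norm_num [Nat.factorial]
  | succ n hn ih =>
    have hb : 2 * (n : ℝ) ^ n ≤ ((n : ℝ) + 1) ^ n := by
      have hn0 : (0 : ℝ) < n := by exact_mod_cast (by omega : 0 < n)
      have h := one_add_mul_le_pow (a := (1 / (n : ℝ))) (by
        have : (0 : ℝ) ≤ 1 / n := by positivity
        linarith) n
      have h1 : (1 : ℝ) + n * (1 / n) = 2 := by field_simp; norm_num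
      rw [h1] at h
      have h2 : ((n : ℝ) + 1) ^ n = (1 + 1 / (n : ℝ)) ^ n * (n : ℝ) ^ n := by
        rw [← mul_pow]; congr 1; field_simp
      rw [h2]
      exact mul_le_mul_of_nonneg_right h (by positivity)
    have hb6 := pow_le_pow_left₀ (by positivity) hb 6
    rw [Nat.factorial_succ]
    push_cast
    calc (49 : ℝ) ^ (n + 1) * (((n : ℝ) + 1) * n.factorial) ^ 6
        = 49 * ((n : ℝ) + 1) ^ 6 * (49 ^ n * (n.factorial : ℝ) ^ 6) := by ring
      _ ≤ 49 * ((n : ℝ) + 1) ^ 6 * ((n : ℝ) ^ n) ^ 6 := by gcongr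
      _ ≤ ((n : ℝ) + 1) ^ 6 * (2 * (n : ℝ) ^ n) ^ 6 := by
          have : 0 ≤ ((n : ℝ) + 1) ^ 6 * ((n : ℝ) ^ n) ^ 6 := by positivity
          rw [mul_pow]; linarith
      _ ≤ ((n : ℝ) + 1) ^ 6 * (((n : ℝ) + 1) ^ n) ^ 6 := by gcongr
      _ = (((n : ℝ) + 1) ^ (n + 1)) ^ 6 := by rw [pow_succ ((n : ℝ) + 1) n]; ring

theorem aux_d5 (k : Type*) [Field k] [NumberField k]
    (hreal : ∀ v : InfinitePlace k, v.IsReal)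
    (d : ℕ) (hd : Module.finrank ℚ k = d) (hd5 : 5 ≤ d) :
    (49 : ℤ) ^ d ≤ |NumberField.discr k| ^ 3 := by
  have htr : IsTotallyReal k := ⟨hreal⟩
  have h := abs_discr_ge' k
  rw [IsTotallyReal.nrComplexPlaces_eq_zero, hd] at h
  simp only [mul_zero, pow_zero, one_mul] at h
  have h1 := aux_fact d hd5
  have hf : (0 : ℝ) < (d.factorial : ℝ) := by exact_mod_cast d.factorial_pos
  have h2 := pow_le_pow_left₀ (by positivity) h 3
  have h3 : (49 : ℝ) ^ d ≤ ((d : ℝ) ^ (2 * d) / (d.factorial : ℝ) ^ 2) ^ 3 := by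
    rw [div_pow, le_div_iff₀ (by positivity), ← pow_mul, ← pow_mul]
    rw [← pow_mul] at h1
    rw [show 2 * d * 3 = d * 6 by ring]
    exact h1
  have h4 := h3.trans h2
  exact_mod_cast h4

/-- Let `k` be a totally real number field of degree `d ≥ 3` over `ℚ`.
Then the absolute value `D_k` of the discriminant of `k` satisfies `D_k^{1/d} ≥ 49^{1/3}`,
equivalently `D_k³ ≥ 49^d`. -/
theorem stmt_5 (k : Type*) [Field k] [NumberField k]
    (hreal : ∀ v : InfinitePlace k, v.IsReal)
    (d : ℕ) (hd : Module.finrank ℚ k = d) (hd3 : 3 ≤ d) :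
    (49 : ℤ) ^ d ≤ |NumberField.discr k| ^ 3 := by

  rcases Nat.lt_or_ge d 5 with h | h
  · obtain rfl | rfl : d = 3 ∨ d = 4 := by omega
    · have h1 := (aux_d3 k hreal hd).trans (le_abs_self _)
      exact pow_le_pow_left₀ (by norm_num) h1 3
    · have h1 := (aux_d4 k hreal hd).trans (le_abs_self _)
      exact le_trans (by norm_num) (pow_le_pow_left₀ (by norm_num) h1 3)
  · exact aux_d5 k hreal d hd h
end

section
/- Let k be a totally real number field of degree d ≥ 4 over ℚ. Then the absolute value D_k of the discriminant of k satisfies D_k^{1/d} ≥ 725^{1/4}; equivalently, D_k^4 ≥ 725^d. -/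
open NumberField

namespace St6
universe u


lemma offDiag_sum_log {N : ℕ} (h : Fin N → ℝ) (hm : StrictMono h) (C : ℝ)
    (hC : ∀ i, |∑ j, (h i - h j)⁻¹| ≤ C)
    (hV : ∏ p ∈ (Finset.univ : Finset (Fin N)).offDiag, |h p.1 - h p.2| ≤ 1)
    (y : Fin N → ℝ) (hy : Function.Injective y) :
    ∑ p ∈ (Finset.univ : Finset (Fin N)).offDiag, Real.log |y p.1 - y p.2| ≤
      2 * C * ∑ i, |y i| - N * (N - 1) := by
  classical
  set s := Tuple.sort y
  have hz : Monotone (y ∘ s) := Tuple.monotone_sort y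
  have hzi : Function.Injective (y ∘ s) := hy.comp s.injective
  set z := y ∘ s with hzdef
  have e1 : ∑ p ∈ (Finset.univ : Finset (Fin N)).offDiag, Real.log |y p.1 - y p.2| =
      ∑ p ∈ (Finset.univ : Finset (Fin N)).offDiag, Real.log |z p.1 - z p.2| := by
    symm
    apply Finset.sum_equiv (s.prodCongr s)
    · intro p; simp
    · intro p _; simp [hzdef]
  have e2 : ∑ i, |y i| = ∑ i, |z i| := by
    symm
    exact Equiv.sum_comp s (fun i => |y i|)
  rw [e1, e2]
  have hlogV : ∑ p ∈ (Finset.univ : Finset (Fin N)).offDiag, Real.log |h p.1 - h p.2| ≤ 0 := by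
    rw [← Real.log_prod]
    · apply Real.log_nonpos _ hV
      exact Finset.prod_nonneg fun _ _ => abs_nonneg _
    · intro p hp
      have : p.1 ≠ p.2 := by simpa using hp
      simpa [sub_eq_zero] using hm.injective.ne this
  have step : ∀ p ∈ (Finset.univ : Finset (Fin N)).offDiag, Real.log |z p.1 - z p.2| ≤
      (z p.1 - z p.2) * (h p.1 - h p.2)⁻¹ - 1 + Real.log |h p.1 - h p.2| := by
    intro p hp
    have hne : p.1 ≠ p.2 := by simpa using hp
    have h1 : |h p.1 - h p.2| ≠ 0 := by simpa [sub_eq_zero] using hm.injective.ne hne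
    have h2 : |z p.1 - z p.2| ≠ 0 := by simpa [sub_eq_zero] using hzi.ne hne
    have h3 : (z p.1 - z p.2) * (h p.1 - h p.2)⁻¹ = |z p.1 - z p.2| / |h p.1 - h p.2| := by
      rw [← abs_div, abs_of_nonneg, div_eq_mul_inv]
      rcases lt_or_gt_of_ne hne with hl | hl
      · apply div_nonneg_of_nonpos
        · linarith [hz hl.le]
        · linarith [hm hl]
      · apply div_nonneg
        · linarith [hz hl.le]
        · linarith [hm hl]
    rw [h3]
    have := Real.log_le_sub_one_of_pos (x := |z p.1 - z p.2| / |h p.1 - h p.2|) (by positivity)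
    rw [Real.log_div h2 h1] at this
    linarith
  have hsum := Finset.sum_le_sum step
  rw [Finset.sum_add_distrib, Finset.sum_sub_distrib] at hsum
  have hcard : (∑ p ∈ (Finset.univ : Finset (Fin N)).offDiag, (1 : ℝ)) = N * (N - 1) := by
    rw [Finset.sum_const, Finset.offDiag_card]
    simp only [Finset.card_univ, Fintype.card_fin, nsmul_eq_mul, mul_one]
    rw [Nat.cast_sub (Nat.le_mul_self N)]
    push_cast; ring
  have hsum2 : ∑ p ∈ (Finset.univ : Finset (Fin N)).offDiag,
      (z p.1 - z p.2) * (h p.1 - h p.2)⁻¹ = 2 * ∑ i, z i * ∑ j, (h i - h j)⁻¹ := by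
    have a1 : ∑ p ∈ (Finset.univ : Finset (Fin N)).offDiag,
        (z p.1 - z p.2) * (h p.1 - h p.2)⁻¹ =
        ∑ p ∈ (Finset.univ : Finset (Fin N)) ×ˢ Finset.univ,
        (z p.1 - z p.2) * (h p.1 - h p.2)⁻¹ := by
      apply Finset.sum_subset
      · intro p _; simp
      · intro p _ hp
        have : p.1 = p.2 := by simpa using hp
        simp [this]
    rw [a1, Finset.sum_product]
    have a2 : ∑ i, ∑ j, (z i - z j) * (h i - h j)⁻¹ =
        ∑ i, ∑ j, z i * (h i - h j)⁻¹ + ∑ i, ∑ j, z j * (h j - h i)⁻¹ := by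
      rw [← Finset.sum_add_distrib]
      refine Finset.sum_congr rfl fun i _ => ?_
      rw [← Finset.sum_add_distrib]
      refine Finset.sum_congr rfl fun j _ => ?_
      rw [show h j - h i = -(h i - h j) by ring, inv_neg]
      ring
    rw [a2, Finset.sum_comm (f := fun i j => z j * (h j - h i)⁻¹)]
    simp_rw [← Finset.mul_sum]
    ring
  have hfin : ∑ i, z i * ∑ j, (h i - h j)⁻¹ ≤ C * ∑ i, |z i| := by
    rw [Finset.mul_sum]
    refine Finset.sum_le_sum fun i _ => ?_
    calc z i * ∑ j, (h i - h j)⁻¹ ≤ |z i * ∑ j, (h i - h j)⁻¹| := le_abs_self _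
      _ = |z i| * |∑ j, (h i - h j)⁻¹| := abs_mul _ _
      _ ≤ |z i| * C := by gcongr; exact hC i
      _ = C * |z i| := mul_comm _ _
  rw [hsum2, hcard] at hsum
  linarith

/-- `Row N G`: any `N` points of `ℝ^ι` whose pairwise differences have norm at least one
satisfy `∑ ‖x_i‖₁ ≥ G * |ι|`. -/
def Row (N : ℕ) (G : ℝ) : Prop :=
  ∀ (ι : Type u) [Fintype ι] (x : Fin N → ι → ℝ),
    (∀ i j, i ≠ j → 1 ≤ ∏ l, |x i l - x j l|) → Fintype.card ι * G ≤ ∑ i, ∑ l, |x i l|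

lemma row_of {N : ℕ} (h : Fin N → ℝ) (hm : StrictMono h) (C G : ℝ) (hC0 : 0 < C)
    (hC : ∀ i, |∑ j, (h i - h j)⁻¹| ≤ C)
    (hV : ∏ p ∈ (Finset.univ : Finset (Fin N)).offDiag, |h p.1 - h p.2| ≤ 1)
    (hG : 2 * C * G ≤ N * (N - 1)) : Row.{u} N G := by
  classical
  intro ι _ x hx
  have hinj : ∀ l, Function.Injective (fun i => x i l) := by
    intro l i j hij
    by_contra hne
    have h1 := hx i j hne
    rw [Finset.prod_eq_zero (Finset.mem_univ l)] at h1
    · linarith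
    · simpa [sub_eq_zero] using hij
  have h0 : 0 ≤ ∑ l, ∑ p ∈ (Finset.univ : Finset (Fin N)).offDiag,
      Real.log |x p.1 l - x p.2 l| := by
    rw [Finset.sum_comm]
    refine Finset.sum_nonneg fun p hp => ?_
    have hne : p.1 ≠ p.2 := by simpa using hp
    rw [← Real.log_prod]
    · exact Real.log_nonneg (hx _ _ hne)
    · intro l _
      simpa [sub_eq_zero] using (hinj l).ne hne
  have h1 := Finset.sum_le_sum fun l (_ : l ∈ Finset.univ) =>
    offDiag_sum_log h hm C hC hV (fun i => x i l) (hinj l)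
  have h2 := h0.trans h1
  rw [Finset.sum_sub_distrib, ← Finset.mul_sum, Finset.sum_comm] at h2
  simp only [Finset.sum_const, Finset.card_univ, nsmul_eq_mul] at h2
  have h3 : (Fintype.card ι : ℝ) * (2 * C * G) ≤ 2 * C * ∑ i, ∑ l, |x i l| := by
    have := mul_le_mul_of_nonneg_left hG (Nat.cast_nonneg (α := ℝ) (Fintype.card ι))
    linarith
  have h4 : 2 * C * (Fintype.card ι * G) ≤ 2 * C * ∑ i, ∑ l, |x i l| := by linarith
  exact le_of_mul_le_mul_left h4 (by positivity)

lemma row_cert {N : ℕ} (H : Fin N → ℤ) (M : ℕ) (G : ℚ) (hM : 0 < M) (hG0 : 0 < G) (hN : 2 ≤ N)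
    (hm : ∀ i j, i < j → H i < H j)
    (hV : ∏ i, ∏ j, (if i = j then 1 else |H i - H j|) ≤ (M : ℤ) ^ (N * N - N))
    (hC : ∀ i, |∑ j, ((H i - H j : ℤ) : ℚ)⁻¹| * (2 * M * G) ≤ N * (N - 1)) :
    Row.{u} N (G : ℝ) := by
  classical
  have hM' : (0 : ℝ) < M := by exact_mod_cast hM
  have hG' : (0 : ℝ) < G := by exact_mod_cast hG0
  have hN' : (2 : ℝ) ≤ N := by exact_mod_cast hN
  refine row_of (fun i => (H i : ℝ) / M) ?_ (N * (N - 1) / (2 * G)) G ?_ ?_ ?_ ?_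
  · intro i j hij
    have : (H i : ℝ) < H j := by exact_mod_cast hm i j hij
    simp only
    gcongr
  · have : (0 : ℝ) < N - 1 := by linarith
    positivity
  · intro i
    have h1 := hC i
    have h2 : |∑ j, ((H i : ℝ) - H j)⁻¹| * (2 * M * G) ≤ N * (N - 1) := by
      have h1' := (Rat.cast_le (K := ℝ)).2 h1
      push_cast at h1'
      exact h1'
    have h3 : ∑ j, ((H i : ℝ) / M - H j / M)⁻¹ = M * ∑ j, ((H i : ℝ) - H j)⁻¹ := by
      rw [Finset.mul_sum]
      refine Finset.sum_congr rfl fun j _ => ?_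
      rw [← sub_div, inv_div, div_eq_mul_inv]
    rw [h3, abs_mul, abs_of_pos hM', le_div_iff₀ (by positivity)]
    linarith
  · have h1 : ∏ p ∈ (Finset.univ : Finset (Fin N)).offDiag, |H p.1 - H p.2| ≤
        (M : ℤ) ^ (N * N - N) := by
      refine le_trans (le_of_eq ?_) hV
      rw [← Finset.prod_product' (f := fun i j => if i = j then 1 else |H i - H j|)]
      have e1 : ∏ p ∈ (Finset.univ : Finset (Fin N)).offDiag,
          (if p.1 = p.2 then 1 else |H p.1 - H p.2|) =
          ∏ p ∈ (Finset.univ : Finset (Fin N)) ×ˢ Finset.univ,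
          (if p.1 = p.2 then 1 else |H p.1 - H p.2|) := by
        apply Finset.prod_subset
        · intro p _; simp
        · intro p _ hp
          have : p.1 = p.2 := by simpa using hp
          simp [this]
      rw [← e1]
      refine Finset.prod_congr rfl fun p hp => ?_
      have hne : p.1 ≠ p.2 := by simpa using hp
      simp [hne]
    have h2 : ∏ p ∈ (Finset.univ : Finset (Fin N)).offDiag, |(H p.1 : ℝ) - H p.2| ≤
        (M : ℝ) ^ (N * N - N) := by exact_mod_cast h1
    have h3 : ∏ p ∈ (Finset.univ : Finset (Fin N)).offDiag, |(H p.1 : ℝ) / M - H p.2 / M| =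
        (∏ p ∈ (Finset.univ : Finset (Fin N)).offDiag, |(H p.1 : ℝ) - H p.2|) /
          (M : ℝ) ^ (N * N - N) := by
      simp_rw [← sub_div, abs_div, abs_of_pos hM']
      rw [Finset.prod_div_distrib, Finset.prod_const, Finset.offDiag_card]
      simp
    rw [h3]
    exact div_le_one_of_le₀ h2 (by positivity)
  · apply le_of_eq
    field_simp

lemma row_2 : Row.{u} 2 (((2 - 267/200) * (9/10) : ℚ) : ℝ) :=
  row_cert ![-5, 5] 10 _
    (by norm_num) (by norm_num) (by norm_num) (by decide +kernel) (by decide +kernel)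
    (by decide +kernel)

lemma row_3 : Row.{u} 3 (((3 - 267/200) * (9/10) : ℚ) : ℝ) :=
  row_cert ![-79, 0, 79] 100 _
    (by norm_num) (by norm_num) (by norm_num) (by decide +kernel) (by decide +kernel)
    (by decide +kernel)

lemma row_4 : Row.{u} 4 (((4 - 267/200) * (9/10) : ℚ) : ℝ) :=
  row_cert ![-21, -4, 4, 21] 20 _
    (by norm_num) (by norm_num) (by norm_num) (by decide +kernel) (by decide +kernel)
    (by decide +kernel)

lemma row_5 : Row.{u} 5 (((5 - 267/200) * (9/10) : ℚ) : ℝ) :=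
  row_cert ![-1239, -413, 0, 413, 1239] 1000 _
    (by norm_num) (by norm_num) (by norm_num) (by decide +kernel) (by decide +kernel)
    (by decide +kernel)

lemma row_6 : Row.{u} 6 (((6 - 267/200) * (9/10) : ℚ) : ℝ) :=
  row_cert ![-70, -30, -6, 6, 30, 70] 50 _
    (by norm_num) (by norm_num) (by norm_num) (by decide +kernel) (by decide +kernel)
    (by decide +kernel)

lemma row_7 : Row.{u} 7 (((7 - 267/200) * (9/10) : ℚ) : ℝ) :=
  row_cert ![-760, -381, -138, 0, 138, 381, 760] 500 _
    (by norm_num) (by norm_num) (by norm_num) (by decide +kernel) (by decide +kernel)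
    (by decide +kernel)

lemma row_8 : Row.{u} 8 (((8 - 267/200) * (9/10) : ℚ) : ℝ) :=
  row_cert ![-327, -181, -83, -17, 17, 83, 181, 327] 200 _
    (by norm_num) (by norm_num) (by norm_num) (by decide +kernel) (by decide +kernel)
    (by decide +kernel)

lemma row_9 : Row.{u} 9 (((9 - 267/200) * (9/10) : ℚ) : ℝ) :=
  row_cert ![-343, -205, -109, -41, 0, 41, 109, 205, 343] 200 _
    (by norm_num) (by norm_num) (by norm_num) (by decide +kernel) (by decide +kernel)
    (by decide +kernel)

lemma row_10 : Row.{u} 10 (((10 - 267/200) * (9/10) : ℚ) : ℝ) :=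
  row_cert ![-180, -113, -66, -32, -7, 7, 32, 66, 113, 180] 100 _
    (by norm_num) (by norm_num) (by norm_num) (by decide +kernel) (by decide +kernel)
    (by decide +kernel)

lemma row_11 : Row.{u} 11 (((11 - 267/200) * (9/10) : ℚ) : ℝ) :=
  row_cert ![-373, -245, -154, -84, -33, 0, 33, 84, 154, 245, 373] 200 _
    (by norm_num) (by norm_num) (by norm_num) (by decide +kernel) (by decide +kernel)
    (by decide +kernel)

lemma row_12 : Row.{u} 12 (((12 - 267/200) * (9/10) : ℚ) : ℝ) :=
  row_cert ![-387, -263, -173, -104, -51, -11, 11, 51, 104, 173, 263, 387] 200 _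
    (by norm_num) (by norm_num) (by norm_num) (by decide +kernel) (by decide +kernel)
    (by decide +kernel)

lemma row_13 : Row.{u} 13 (((13 - 267/200) * (9/10) : ℚ) : ℝ) :=
  row_cert ![-396, -277, -190, -122, -68, -27, 0, 27, 68, 122, 190, 277, 396] 200 _
    (by norm_num) (by norm_num) (by norm_num) (by decide +kernel) (by decide +kernel)
    (by decide +kernel)

lemma row_14 : Row.{u} 14 (((14 - 267/200) * (9/10) : ℚ) : ℝ) :=
  row_cert ![-1018, -729, -517, -349, -213, -105, -23, 23, 105, 213, 349, 517, 729, 1018] 500 _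
    (by norm_num) (by norm_num) (by norm_num) (by decide +kernel) (by decide +kernel)
    (by decide +kernel)

lemma row_15 : Row.{u} 15 (((15 - 267/200) * (9/10) : ℚ) : ℝ) :=
  row_cert ![-415, -304, -221, -155, -101, -57, -23, 0, 23, 57, 101, 155, 221, 304, 415] 200 _
    (by norm_num) (by norm_num) (by norm_num) (by decide +kernel) (by decide +kernel)
    (by decide +kernel)

lemma row_16 : Row.{u} 16 (((16 - 267/200) * (9/10) : ℚ) : ℝ) :=
  row_cert ![-212, -158, -118, -85, -58, -36, -18, -4, 4, 18, 36, 58, 85, 118, 158, 212] 100 _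
    (by norm_num) (by norm_num) (by norm_num) (by decide +kernel) (by decide +kernel)
    (by decide +kernel)

lemma row_17 : Row.{u} 17 (((17 - 267/200) * (9/10) : ℚ) : ℝ) :=
  row_cert ![-216, -163, -124, -92, -65, -43, -25, -10, 0, 10, 25, 43, 65, 92, 124, 163, 216] 100 _
    (by norm_num) (by norm_num) (by norm_num) (by decide +kernel) (by decide +kernel)
    (by decide +kernel)

lemma row_18 : Row.{u} 18 (((18 - 267/200) * (9/10) : ℚ) : ℝ) :=
  row_cert ![-219, -168, -130, -98, -72, -50, -31, -16, -4, 4, 16, 31, 50, 72, 98, 130, 168, 219] 100 _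
    (by norm_num) (by norm_num) (by norm_num) (by decide +kernel) (by decide +kernel)
    (by decide +kernel)

lemma row_19 : Row.{u} 19 (((19 - 267/200) * (9/10) : ℚ) : ℝ) :=
  row_cert ![-1113, -864, -675, -521, -392, -281, -187, -108, -44, 0, 44, 108, 187, 281, 392, 521, 675, 864, 1113] 500 _
    (by norm_num) (by norm_num) (by norm_num) (by decide +kernel) (by decide +kernel)
    (by decide +kernel)

lemma row_20 : Row.{u} 20 (((20 - 267/200) * (9/10) : ℚ) : ℝ) :=
  row_cert ![-113, -88, -70, -55, -42, -31, -22, -14, -7, -2, 2, 7, 14, 22, 31, 42, 55, 70, 88, 113] 50 _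
    (by norm_num) (by norm_num) (by norm_num) (by decide +kernel) (by decide +kernel)
    (by decide +kernel)

lemma row_21 : Row.{u} 21 (((21 - 267/200) * (9/10) : ℚ) : ℝ) :=
  row_cert ![-228, -181, -145, -115, -90, -68, -49, -33, -19, -8, 0, 8, 19, 33, 49, 68, 90, 115, 145, 181, 228] 100 _
    (by norm_num) (by norm_num) (by norm_num) (by decide +kernel) (by decide +kernel)
    (by decide +kernel)

lemma row_22 : Row.{u} 22 (((22 - 267/200) * (9/10) : ℚ) : ℝ) :=
  row_cert ![-462, -369, -299, -240, -190, -147, -109, -77, -48, -25, -6, 6, 25, 48, 77, 109, 147, 190, 240, 299, 369, 462] 200 _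
    (by norm_num) (by norm_num) (by norm_num) (by decide +kernel) (by decide +kernel)
    (by decide +kernel)

lemma row_23 : Row.{u} 23 ((23 * (9/10) : ℚ) : ℝ) :=
  row_cert ![-11684, -9417, -7683, -6246, -5016, -3945, -3008, -2186, -1470, -856, -351, 0, 351, 856, 1470, 2186, 3008, 3945, 5016, 6246, 7683, 9417, 11684] 5000 _
    (by norm_num) (by norm_num) (by norm_num) (by decide +kernel) (by decide +kernel)
    (by decide +kernel)

end St6

namespace St6
universe u

lemma row_apply {N : ℕ} {G : ℝ} (hrow : Row.{u} N G) {ι : Type u} [Fintype ι]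
    (T : Finset (ι → ℝ)) (hT : T.card = N)
    (hS : ∀ p ∈ T, ∀ q ∈ T, p ≠ q → 1 ≤ ∏ l, |p l - q l|) :
    Fintype.card ι * G ≤ ∑ p ∈ T, ∑ l, |p l| := by
  let e := T.equivFinOfCardEq hT
  have h1 := hrow ι (fun i => (e.symm i : ι → ℝ)) (by
    intro i j hij
    refine hS _ (e.symm i).2 _ (e.symm j).2 ?_
    intro h
    exact hij (e.symm.injective (Subtype.ext h)))
  have h2 : ∑ i, ∑ l, |(e.symm i : ι → ℝ) l| = ∑ p : T, ∑ l, |(p : ι → ℝ) l| :=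
    Equiv.sum_comp e.symm (fun p : T => ∑ l, |(p : ι → ℝ) l|)
  rw [h2, Finset.sum_coe_sort T (fun p => ∑ l, |p l|)] at h1
  exact h1

lemma rows (k : ℕ) (h2 : 2 ≤ k) (h22 : k ≤ 22) : Row.{u} k ((k - 267/200) * (9/10)) := by
  interval_cases k
  · have := row_2.{u}; push_cast at this ⊢; exact this
  · have := row_3.{u}; push_cast at this ⊢; exact this
  · have := row_4.{u}; push_cast at this ⊢; exact this
  · have := row_5.{u}; push_cast at this ⊢; exact this
  · have := row_6.{u}; push_cast at this ⊢; exact this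
  · have := row_7.{u}; push_cast at this ⊢; exact this
  · have := row_8.{u}; push_cast at this ⊢; exact this
  · have := row_9.{u}; push_cast at this ⊢; exact this
  · have := row_10.{u}; push_cast at this ⊢; exact this
  · have := row_11.{u}; push_cast at this ⊢; exact this
  · have := row_12.{u}; push_cast at this ⊢; exact this
  · have := row_13.{u}; push_cast at this ⊢; exact this
  · have := row_14.{u}; push_cast at this ⊢; exact this
  · have := row_15.{u}; push_cast at this ⊢; exact this
  · have := row_16.{u}; push_cast at this ⊢; exact this
  · have := row_17.{u}; push_cast at this ⊢; exact this
  · have := row_18.{u}; push_cast at this ⊢; exact this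
  · have := row_19.{u}; push_cast at this ⊢; exact this
  · have := row_20.{u}; push_cast at this ⊢; exact this
  · have := row_21.{u}; push_cast at this ⊢; exact this
  · have := row_22.{u}; push_cast at this ⊢; exact this

lemma pointBound {ι : Type u} [Fintype ι] [Nonempty ι] (S : Finset (ι → ℝ))
    (hS : ∀ p ∈ S, ∀ q ∈ S, p ≠ q → 1 ≤ ∏ l, |p l - q l|) :
    ∑ p ∈ S, max 0 (1 - (∑ l, |p l|) / (Fintype.card ι * (9/10))) ≤ 267/200 := by
  classical
  set n : ℝ := (Fintype.card ι : ℝ) with hn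
  have hn0 : 0 < n := by rw [hn]; exact_mod_cast Fintype.card_pos
  set g : (ι → ℝ) → ℝ := fun p => 1 - (∑ l, |p l|) / (n * (9/10)) with hg
  set S' := S.filter (fun p => 0 < g p) with hS'
  have hsub : ∀ p ∈ S', p ∈ S ∧ 0 < g p := by intro p hp; simpa [hS'] using hp
  have e1 : ∑ p ∈ S, max 0 (g p) = ∑ p ∈ S', g p := by
    rw [hS', Finset.sum_filter]
    refine Finset.sum_congr rfl fun p _ => ?_
    split_ifs with h
    · exact max_eq_right h.le
    · exact max_eq_left (not_lt.1 h)
  change ∑ p ∈ S, max 0 (g p) ≤ _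
  rw [e1]
  have hsum : ∀ T : Finset (ι → ℝ), ∑ p ∈ T, g p =
      T.card - (∑ p ∈ T, ∑ l, |p l|) / (n * (9/10)) := by
    intro T
    rw [hg, Finset.sum_sub_distrib, Finset.sum_div]
    simp
  rcases Nat.lt_or_ge S'.card 2 with hk | hk
  · rw [hsum]
    have h1 : (S'.card : ℝ) ≤ 1 := by exact_mod_cast (by omega : S'.card ≤ 1)
    have h2 : 0 ≤ (∑ p ∈ S', ∑ l, |p l|) / (n * (9/10)) := by positivity
    linarith
  rcases Nat.lt_or_ge S'.card 23 with hk' | hk'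
  · rw [hsum]
    have := row_apply (rows S'.card hk (by omega)) S' rfl
      (fun p hp q hq => hS p (hsub p hp).1 q (hsub q hq).1)
    have h3 : (S'.card : ℝ) - 267/200 ≤ (∑ p ∈ S', ∑ l, |p l|) / (n * (9/10)) := by
      rw [le_div_iff₀ (by positivity)]
      linarith
    linarith
  · exfalso
    obtain ⟨T, hTS, hT⟩ := Finset.exists_subset_card_eq hk'
    have h1 := row_apply row_23.{u} T hT
      (fun p hp q hq => hS p (hsub p (hTS hp)).1 q (hsub q (hTS hq)).1)
    have h2 : 0 < ∑ p ∈ T, g p := by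
      apply Finset.sum_pos
      · intro p hp; exact (hsub p (hTS hp)).2
      · rw [← Finset.card_pos]; omega
    rw [hsum, hT] at h2
    have h3 : (23 : ℝ) ≤ (∑ p ∈ T, ∑ l, |p l|) / (n * (9/10)) := by
      rw [le_div_iff₀ (by positivity)]
      push_cast at h1
      linarith
    push_cast at h2
    linarith

open NumberField.mixedEmbedding NumberField.InfinitePlace MeasureTheory Module

variable (K : Type u) [Field K] [NumberField K] 

open scoped Classical in
lemma lintegral_tent [IsTotallyReal K] (R : ℝ) (hR : 0 < R) :
    ∫⁻ x : mixedSpace K, ENNReal.ofReal (max 0 (1 - convexBodySumFun x / R)) =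
      ENNReal.ofReal ((2 * R) ^ finrank ℚ K / (finrank ℚ K + 1).factorial) := by
  set n := finrank ℚ K with hn
  rw [lintegral_eq_lintegral_meas_le]
  rotate_left
  · exact Filter.Eventually.of_forall fun x => le_max_left _ _
  · apply Measurable.aemeasurable
    have := (convexBodySumFun_continuous K).measurable
    fun_prop
  have h1 : ∀ t ∈ Set.Ioi (0:ℝ), volume {x : mixedSpace K | t ≤ max 0 (1 - convexBodySumFun x / R)} =
      ENNReal.ofReal ((2 * R) ^ n / n.factorial * (max 0 (1 - t)) ^ n) := by
    intro t ht
    have ht : 0 < t := ht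
    have : {x : mixedSpace K | t ≤ max 0 (1 - convexBodySumFun x / R)} =
        convexBodySum K (R * (1 - t)) := by
      ext x
      simp only [Set.mem_ofPred_eq, le_max_iff, not_le.2 ht, false_or]
      constructor
      · intro h
        have : convexBodySumFun x / R ≤ 1 - t := by linarith
        rw [div_le_iff₀ hR] at this
        linarith
      · intro h
        have : convexBodySumFun x / R ≤ 1 - t := by
          rw [div_le_iff₀ hR]; linarith
        linarith
    rw [this, convexBodySum_volume, ← hn]
    have hr : nrRealPlaces K = n := by
      rw [hn, IsTotallyReal.finrank]
    have hc : nrComplexPlaces K = 0 := IsTotallyReal.nrComplexPlaces_eq_zero K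
    have hm : ENNReal.ofReal (R * (1 - t)) = ENNReal.ofReal (R * max 0 (1 - t)) := by
      rcases le_total 0 (1 - t) with h | h
      · rw [max_eq_right h]
      · rw [max_eq_left h, mul_zero, ENNReal.ofReal_zero, ENNReal.ofReal_eq_zero]
        exact mul_nonpos_of_nonneg_of_nonpos hR.le h
    have hf : (convexBodySumFactor K : ENNReal) = ENNReal.ofReal (2 ^ n / n.factorial) := by
      rw [ENNReal.ofReal, ENNReal.coe_inj]
      ext
      rw [Real.coe_toNNReal _ (by positivity), convexBodySumFactor, hr, hc, ← hn]
      push_cast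
      simp
    rw [hm, hf, ← ENNReal.ofReal_pow (by positivity), ← ENNReal.ofReal_mul (by positivity)]
    congr 1
    rw [mul_pow, mul_pow]
    ring
  rw [setLIntegral_congr_fun measurableSet_Ioi h1]
  have h2 : ∫⁻ t in Set.Ioi (0:ℝ), ENNReal.ofReal ((2 * R) ^ n / n.factorial * (max 0 (1 - t)) ^ n)
      = ∫⁻ t in Set.Ioc (0:ℝ) 1, ENNReal.ofReal ((2 * R) ^ n / n.factorial * (1 - t) ^ n) := by
    rw [← Set.Ioc_union_Ioi_eq_Ioi (zero_le_one (α := ℝ)), lintegral_union measurableSet_Ioi]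
    · have a : ∫⁻ t in Set.Ioi (1:ℝ), ENNReal.ofReal ((2 * R) ^ n / n.factorial * (max 0 (1 - t)) ^ n) = 0 := by
        rw [setLIntegral_congr_fun (g := fun _ => 0) measurableSet_Ioi]
        · simp
        · intro t ht
          have ht : 1 < t := ht
          have hn0 : n ≠ 0 := by rw [hn]; exact finrank_pos.ne'
          simp [max_eq_left (show 1 - t ≤ 0 by linarith), hn0]
      rw [a, add_zero]
      apply setLIntegral_congr_fun measurableSet_Ioc
      intro t ht
      simp only
      rw [max_eq_right (by linarith [ht.2])]
    · rw [Set.disjoint_iff]; rintro x ⟨h, h'⟩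
      exact absurd h.2 (not_le.2 h')
  rw [h2, ← ofReal_integral_eq_lintegral_ofReal]
  · congr 1
    rw [integral_const_mul, ← intervalIntegral.integral_of_le zero_le_one]
    rw [intervalIntegral.integral_comp_sub_left (fun t => t ^ n) 1]
    simp only [sub_self, sub_zero, integral_pow, one_pow]
    rw [Nat.factorial_succ]
    push_cast
    have : (n.factorial : ℝ) ≠ 0 := by positivity
    field_simp
    simp
  · apply IntegrableOn.integrable
    apply Continuous.integrableOn_Ioc
    fun_prop
  · rw [Filter.EventuallyLE, ae_restrict_iff' measurableSet_Ioc]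
    refine Filter.Eventually.of_forall fun t ht => ?_
    have : 0 ≤ 1 - t := by linarith [ht.2]
    simp only [Pi.zero_apply]
    positivity

end St6

namespace St6
universe u
open NumberField.mixedEmbedding NumberField.InfinitePlace MeasureTheory Module

variable (K : Type u) [Field K] [NumberField K]

lemma norm_lattice_ge (y : mixedSpace K) (hy : y ∈ mixedEmbedding.integerLattice K) (h0 : y ≠ 0) :
    1 ≤ mixedEmbedding.norm y := by
  obtain ⟨a, rfl⟩ := hy
  change mixedEmbedding K (algebraMap (𝓞 K) K a) ≠ 0 at h0
  change 1 ≤ mixedEmbedding.norm (mixedEmbedding K (algebraMap (𝓞 K) K a))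
  have ha : a ≠ 0 := by rintro rfl; simp at h0
  rw [norm_eq_norm]
  have h1 : Algebra.norm ℚ (algebraMap (𝓞 K) K a) = ((Algebra.norm ℤ a : ℤ) : ℚ) :=
    (Algebra.coe_norm_int a).symm
  rw [h1]
  have h2 : (1:ℤ) ≤ |Algebra.norm ℤ a| := Int.one_le_abs (Algebra.norm_ne_zero_iff.2 ha)
  exact_mod_cast h2

/-- coordinates -/
noncomputable def crd [IsTotallyReal K] (y : mixedSpace K) (w : InfinitePlace K) : ℝ :=
  y.1 ⟨w, IsTotallyReal.isReal w⟩

lemma norm_eq_crd [IsTotallyReal K] (y : mixedSpace K) :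
    mixedEmbedding.norm y = ∏ w, |crd K y w| := by
  rw [mixedEmbedding.norm_apply]
  refine Finset.prod_congr rfl fun w _ => ?_
  rw [IsTotallyReal.mult_eq, pow_one, normAtPlace_apply_of_isReal (IsTotallyReal.isReal w)]
  rfl

lemma sumFun_eq_crd [IsTotallyReal K] (y : mixedSpace K) :
    convexBodySumFun y = ∑ w, |crd K y w| := by
  rw [convexBodySumFun_apply]
  refine Finset.sum_congr rfl fun w _ => ?_
  rw [IsTotallyReal.mult_eq, normAtPlace_apply_of_isReal (IsTotallyReal.isReal w)]
  simp [crd]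

lemma crd_inj [IsTotallyReal K] : Function.Injective (crd K) := by
  intro x y h
  apply Prod.ext
  · ext ⟨w, hw⟩
    exact congrFun h w
  · ext ⟨w, hw⟩
    exact absurd (IsTotallyReal.isReal w) (not_isReal_iff_isComplex.2 hw)

lemma card_places [IsTotallyReal K] : Fintype.card (InfinitePlace K) = finrank ℚ K := by
  rw [card_eq_nrRealPlaces_add_nrComplexPlaces, IsTotallyReal.nrComplexPlaces_eq_zero K,
    IsTotallyReal.finrank, add_zero]

lemma tent_sum [IsTotallyReal K] (x : mixedSpace K) :
    ∑' g : mixedEmbedding.integerLattice K,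
      ENNReal.ofReal (max 0 (1 - convexBodySumFun (g +ᵥ x) / (finrank ℚ K * (9/10)))) ≤
      ENNReal.ofReal (267/200) := by
  classical
  rw [ENNReal.tsum_eq_iSup_sum]
  refine iSup_le fun s => ?_
  rw [← ENNReal.ofReal_sum_of_nonneg (fun _ _ => le_max_left _ _)]
  apply ENNReal.ofReal_le_ofReal
  have hinj : Function.Injective (fun g : mixedEmbedding.integerLattice K => crd K (g +ᵥ x)) := by
    intro g g' h
    have := crd_inj K h
    exact Subtype.ext (add_right_cancel this)
  have key := pointBound (s.image (fun g => crd K (g +ᵥ x))) (by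
    intro p hp q hq hpq
    rw [Finset.mem_image] at hp hq
    obtain ⟨g, -, rfl⟩ := hp
    obtain ⟨g', -, rfl⟩ := hq
    have h1 := norm_lattice_ge K ((g : mixedSpace K) - g') (sub_mem g.2 g'.2) (by
      intro h
      apply hpq
      rw [Subtype.ext (sub_eq_zero.1 h)])
    rw [norm_eq_crd] at h1
    convert h1 using 3 with w
    change ((g : mixedSpace K) + x).1 _ - ((g' : mixedSpace K) + x).1 _ =
      ((g : mixedSpace K) - g').1 _
    simp)
  rw [Finset.sum_image (fun a _ b _ h => hinj h), card_places] at key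
  simp only [sumFun_eq_crd]
  exact key

theorem sqrt_bound [IsTotallyReal K] :
    (2 * (finrank ℚ K * (9/10))) ^ finrank ℚ K / (finrank ℚ K + 1).factorial ≤
      267/200 * √(|discr K| : ℝ) := by
  classical
  have hR : (0:ℝ) < finrank ℚ K * (9/10) := by
    have : 0 < finrank ℚ K := finrank_pos
    positivity
  have h1 := lintegral_tent K _ hR
  have : Countable (mixedEmbedding.integerLattice K) := by
    rw [← span_latticeBasis]; infer_instance
  have hva : VAddInvariantMeasure (mixedEmbedding.integerLattice K) (mixedSpace K) volume := by
    change VAddInvariantMeasure (mixedEmbedding.integerLattice K).toAddSubgroup (mixedSpace K) volume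
    infer_instance
  have hm : Measurable (fun x : mixedSpace K => ENNReal.ofReal (max 0 (1 - convexBodySumFun x / (finrank ℚ K * (9/10))))) := by
    have := (convexBodySumFun_continuous K).measurable
    fun_prop
  rw [(fundamentalDomain_integerLattice K).lintegral_eq_tsum'', ← lintegral_tsum] at h1
  · have h2 : ∫⁻ x in ZSpan.fundamentalDomain (latticeBasis K), ∑' g : mixedEmbedding.integerLattice K,
      ENNReal.ofReal (max 0 (1 - convexBodySumFun (g +ᵥ x) / (finrank ℚ K * (9/10)))) ≤
       ∫⁻ x in ZSpan.fundamentalDomain (latticeBasis K), ENNReal.ofReal (267/200) :=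
      lintegral_mono fun x => tent_sum K x
    rw [h1, setLIntegral_const, volume_fundamentalDomain_latticeBasis,
      IsTotallyReal.nrComplexPlaces_eq_zero K, pow_zero, one_mul] at h2
    have h3 : ((NNReal.sqrt ‖discr K‖₊ : NNReal) : ENNReal) = ENNReal.ofReal (√(|discr K| : ℝ)) := by
      rw [ENNReal.ofReal, ENNReal.coe_inj]
      ext
      rw [Real.coe_toNNReal _ (by positivity), Real.coe_sqrt, coe_nnnorm, Int.norm_eq_abs]
    rw [h3, ← ENNReal.ofReal_mul (by norm_num), ENNReal.ofReal_le_ofReal_iff (by positivity)] at h2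
    exact h2
  · intro g
    apply Measurable.aemeasurable
    exact hm.comp (measurable_const_vadd g)

lemma growth (n : ℕ) (hn : 5 ≤ n) :
    (725:ℝ) ^ n * (267/200 * (n+1).factorial) ^ 8 ≤ ((2 * (n * (9/10))) ^ n) ^ 8 := by
  induction n, hn using Nat.le_induction with
  | base => norm_num [Nat.factorial]
  | succ n hn ih =>
    have hn' : (5:ℝ) ≤ n := by exact_mod_cast hn
    have hb : 2 * (n:ℝ)^n ≤ (n+1:ℝ)^n := by
      have h := one_add_mul_le_pow (a := 1/(n:ℝ)) (by have : 0 ≤ 1/(n:ℝ) := by positivity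
                                                      linarith) n
      have h2 : (1:ℝ) + n * (1/n) = 2 := by field_simp; norm_num
      rw [h2] at h
      have h3 : (n+1:ℝ)^n = (1+1/n)^n * n^n := by
        rw [← mul_pow]; congr 1; field_simp
      rw [h3]
      gcongr
    -- ratio
    have h1 : (267/200 * ((n+1+1).factorial:ℝ)) = (n+2) * (267/200 * (n+1).factorial) := by
      rw [Nat.factorial_succ]; push_cast; ring
    have h2 : 3 * (n+2) * ((2 * (n * (9/10))) ^ n) ≤ (2 * (((n+1:ℕ):ℝ) * (9/10))) ^ (n+1) := by
      have e1 : (2 * ((n:ℝ) * (9/10))) ^ n = (9/5)^n * n^n := by rw [← mul_pow]; congr 1; ring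
      have e2 : (2 * (((n+1:ℕ):ℝ) * (9/10))) ^ (n+1) = (9/5)^n * (9/5) * ((n+1)^n * (n+1)) := by
        rw [← pow_succ, ← pow_succ, ← mul_pow]; congr 1; push_cast; ring
      rw [e1, e2]
      have : 3 * (n+2) * ((n:ℝ)^n) ≤ (9/5) * ((n+1)^n * (n+1)) := by
        have : (9/5) * (2 * (n:ℝ)^n * (n+1)) ≤ (9/5) * ((n+1)^n * (n+1)) := by gcongr
        have h5 : 0 ≤ (n:ℝ)^n := by positivity
        nlinarith
      have h6 : (0:ℝ) ≤ (9/5)^n := by positivity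
      nlinarith
    have h3 : ((3 * (n+2) * ((2 * ((n:ℝ) * (9/10))) ^ n)))^8 ≤ ((2 * (((n+1:ℕ):ℝ) * (9/10))) ^ (n+1))^8 := by
      gcongr
    refine le_trans ?_ h3
    rw [h1, mul_pow, mul_pow (3 * ((n:ℝ)+2)), mul_pow 3, pow_succ]
    calc _ = 725 * ((n:ℝ)+2)^8 * ((725:ℝ) ^ n * (267/200 * (n+1).factorial) ^ 8) := by ring
      _ ≤ 3^8 * ((n:ℝ)+2)^8 * ((2 * (n * (9/10))) ^ n) ^ 8 := by
        gcongr; norm_num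

theorem ge_five [IsTotallyReal K] (h : 5 ≤ finrank ℚ K) :
    (725 : ℤ) ^ finrank ℚ K ≤ |discr K| ^ 4 := by
  have h1 := sqrt_bound K
  have h2 := growth _ h
  set n := finrank ℚ K
  rw [div_le_iff₀ (by positivity)] at h1
  have h3 := pow_le_pow_left₀ (by positivity) h1 8
  have h4 := h2.trans h3
  have e : (267/200 * √(|discr K| : ℝ) * ((n+1).factorial : ℝ))^8 =
      (|discr K| : ℝ)^4 * (267/200 * (n+1).factorial) ^ 8 := by
    have : √(|discr K| : ℝ)^2 = (|discr K| : ℝ) := Real.sq_sqrt (abs_nonneg _)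
    calc _ = (√(|discr K| : ℝ)^2)^4 * (267/200 * (n+1).factorial) ^ 8 := by ring
      _ = _ := by rw [this]
  rw [e] at h4
  have hf : (0:ℝ) < (267/200 * (n+1).factorial) ^ 8 := by positivity
  have h5 := le_of_mul_le_mul_right h4 hf
  have : (725 : ℝ) ^ n ≤ ((|discr K| : ℤ) : ℝ) ^ 4 := by
    rw [Int.cast_abs]; exact h5
  exact_mod_cast this

end St6

namespace St6
universe u

section Lattice
variable {V : Type*} [AddCommGroup V] [Module ℚ V]

/-- next Gram-Schmidt projection -/
noncomputable def nxt (b : V →ₗ[ℚ] V →ₗ[ℚ] ℚ) (p : V →ₗ[ℚ] V) (a : V) : V →ₗ[ℚ] V :=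
  p - ((b (p a) (p a))⁻¹ • ((b.flip (p a)).comp p)).smulRight (p a)

lemma nxt_apply (b : V →ₗ[ℚ] V →ₗ[ℚ] ℚ) (p : V →ₗ[ℚ] V) (a x : V) :
    nxt b p a x = p x - ((b (p a) (p a))⁻¹ * b (p x) (p a)) • p a := by
  simp [nxt]

/-- `a` gives the minimum of the projected form -/
def IsMin (b : V →ₗ[ℚ] V →ₗ[ℚ] ℚ) (L : AddSubgroup V) (p : V →ₗ[ℚ] V) (a : V) : Prop :=
  a ∈ L ∧ p a ≠ 0 ∧ ∀ x ∈ L, p x ≠ 0 → b (p a) (p a) ≤ b (p x) (p x)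

variable {b : V →ₗ[ℚ] V →ₗ[ℚ] ℚ} {L : AddSubgroup V} {p : V →ₗ[ℚ] V}

lemma nxt_self (hpos : ∀ x, x ≠ 0 → 0 < b x x) {a : V} (ha : p a ≠ 0) : nxt b p a a = 0 := by
  rw [nxt_apply, inv_mul_cancel₀ (hpos _ ha).ne', one_smul, sub_self]

lemma nxt_zero {a x : V} (hx : p x = 0) : nxt b p a x = 0 := by
  rw [nxt_apply, hx]; simp

lemma nxt_orth (hpos : ∀ x, x ≠ 0 → 0 < b x x) {a x : V} (ha : p a ≠ 0) :
    b (nxt b p a x) (p a) = 0 := by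
  rw [nxt_apply]
  simp only [map_sub, map_smul, LinearMap.sub_apply, LinearMap.smul_apply, smul_eq_mul]
  have := (hpos _ ha).ne'
  field_simp
  ring

lemma nxt_orth' {w : V} (hw : ∀ x, b (p x) w = 0) (a x : V) : b (nxt b p a x) w = 0 := by
  rw [nxt_apply]
  simp [hw]

lemma nxt_int (hintg : ∀ x ∈ L, ∀ y ∈ L, ∃ n : ℤ, b x y = n) (hpos : ∀ x, x ≠ 0 → 0 < b x x)
    (hp : ∃ M : ℤ, M ≠ 0 ∧ ∀ x ∈ L, (M : ℚ) • p x ∈ L) {a : V} (haL : a ∈ L) (ha : p a ≠ 0) :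
    ∃ M : ℤ, M ≠ 0 ∧ ∀ x ∈ L, (M : ℚ) • nxt b p a x ∈ L := by
  obtain ⟨M, hM, h⟩ := hp
  obtain ⟨m, hm⟩ := hintg _ (h a haL) _ (h a haL)
  have hMq : (M:ℚ) ≠ 0 := by exact_mod_cast hM
  simp only [map_smul, LinearMap.smul_apply, smul_eq_mul] at hm
  have hpa := (hpos _ ha).ne'
  have hm0 : m ≠ 0 := by
    rintro rfl
    simp [hM, hpa] at hm
  refine ⟨M * m, mul_ne_zero hM hm0, fun x hx => ?_⟩
  obtain ⟨k, hk⟩ := hintg _ (h x hx) _ (h a haL)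
  simp only [map_smul, LinearMap.smul_apply, smul_eq_mul] at hk
  have : ((M * m : ℤ) : ℚ) • nxt b p a x = m • ((M:ℚ) • p x) - k • ((M:ℚ) • p a) := by
    rw [nxt_apply, ← Int.cast_smul_eq_zsmul ℚ m, ← Int.cast_smul_eq_zsmul ℚ k, smul_sub, smul_smul,
      smul_smul, smul_smul, ← hk]
    congr 2
    · push_cast; ring
    · push_cast; rw [← hm]; field_simp
  rw [this]
  exact L.sub_mem (L.zsmul_mem (h x hx) _) (L.zsmul_mem (h a haL) _)

lemma exists_min (hintg : ∀ x ∈ L, ∀ y ∈ L, ∃ n : ℤ, b x y = n) (hpos : ∀ x, x ≠ 0 → 0 < b x x)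
    (hp : ∃ M : ℤ, M ≠ 0 ∧ ∀ x ∈ L, (M : ℚ) • p x ∈ L)
    (hspan : ∀ x : V, ∃ n : ℤ, n ≠ 0 ∧ (n : ℚ) • x ∈ L) (hne : ∃ x, p x ≠ 0) :
    ∃ a, IsMin b L p a := by
  classical
  obtain ⟨M, hM, h⟩ := hp
  have hMq : (M:ℚ) ≠ 0 := by exact_mod_cast hM
  obtain ⟨x0, hx0⟩ := hne
  obtain ⟨n, hn, hnx⟩ := hspan x0
  have hnq : (n:ℚ) ≠ 0 := by exact_mod_cast hn
  have key : ∀ x ∈ L, ∃ m : ℕ, (M:ℚ)^2 * b (p x) (p x) = m := by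
    intro x hx
    obtain ⟨k, hk⟩ := hintg _ (h x hx) _ (h x hx)
    simp only [map_smul, LinearMap.smul_apply, smul_eq_mul] at hk
    have h0 : 0 ≤ b (p x) (p x) := by
      by_cases h0 : p x = 0
      · rw [h0]; simp
      · exact (hpos _ h0).le
    have hk0 : 0 ≤ k := by
      have : (0:ℚ) ≤ k := by
        rw [← hk]
        have : 0 ≤ (M:ℚ)^2 * b (p x) (p x) := by positivity
        linarith
      exact_mod_cast this
    lift k to ℕ using hk0
    refine ⟨k, ?_⟩
    rw [Int.cast_natCast] at hk
    rw [← hk]; ring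
  have hex : ∃ m : ℕ, ∃ x ∈ L, p x ≠ 0 ∧ (M:ℚ)^2 * b (p x) (p x) = m := by
    obtain ⟨m, hm⟩ := key _ hnx
    exact ⟨m, _, hnx, by simp [hnq, hx0], hm⟩
  obtain ⟨a, haL, ha0, ha⟩ := Nat.find_spec hex
  refine ⟨a, haL, ha0, fun x hx hx0 => ?_⟩
  obtain ⟨m, hm⟩ := key x hx
  have := Nat.find_min' hex ⟨x, hx, hx0, hm⟩
  have h2 : (M:ℚ)^2 * b (p a) (p a) ≤ (M:ℚ)^2 * b (p x) (p x) := by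
    rw [ha, hm]; exact_mod_cast this
  exact le_of_mul_le_mul_left h2 (by positivity)

lemma round_sq (c : ℚ) : (c - round c) ^ 2 ≤ 1 / 4 := by
  have := abs_sub_round c
  rw [← sq_abs]
  nlinarith [abs_nonneg (c - round c)]

lemma IsMin.int (hpos : ∀ x, x ≠ 0 → 0 < b x x) {a : V} (ha : IsMin b L p a) {x : V} (hx : x ∈ L)
    {c : ℚ} (hc : p x = c • p a) : ∃ n : ℤ, c = n := by
  obtain ⟨haL, ha0, hmin⟩ := ha
  refine ⟨round c, ?_⟩
  by_contra hne
  have hy : p (x - (round c : ℤ) • a) = (c - round c) • p a := by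
    rw [map_sub, map_zsmul, hc, sub_smul, ← Int.cast_smul_eq_zsmul ℚ]
  have h1 := hmin (x - (round c : ℤ) • a) (L.sub_mem hx (L.zsmul_mem haL _)) (by
    rw [hy]
    exact smul_ne_zero (sub_ne_zero.2 hne) ha0)
  rw [hy] at h1
  simp only [map_smul, LinearMap.smul_apply, smul_eq_mul] at h1
  have := round_sq c
  have h2 := hpos _ ha0
  nlinarith

lemma IsMin.red (hsymm : ∀ x y, b x y = b y x) (hpos : ∀ x, x ≠ 0 → 0 < b x x) {a : V}
    (ha : IsMin b L p a) {x : V} (hx : x ∈ L) (h0 : nxt b p a x ≠ 0) :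
    3 * b (p a) (p a) ≤ 4 * b (nxt b p a x) (nxt b p a x) := by
  obtain ⟨haL, ha0, hmin⟩ := ha
  set c := (b (p a) (p a))⁻¹ * b (p x) (p a) with hc
  have e1 : p x = nxt b p a x + c • p a := by rw [nxt_apply]; abel
  have hy : p (x - (round c : ℤ) • a) = nxt b p a x + (c - round c) • p a := by
    rw [map_sub, map_zsmul, e1, sub_smul, ← Int.cast_smul_eq_zsmul ℚ]; abel
  have h1 := hmin (x - (round c : ℤ) • a) (L.sub_mem hx (L.zsmul_mem haL _)) (by
    intro h
    apply h0
    have h2 : nxt b p a (x - (round c : ℤ) • a) = 0 := nxt_zero h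
    rw [map_sub, map_zsmul, nxt_self hpos ha0] at h2
    simpa using h2)
  rw [hy] at h1
  have o1 := nxt_orth hpos (x := x) ha0
  have o2 := hsymm (p a) (nxt b p a x)
  simp only [map_add, map_smul, LinearMap.add_apply, LinearMap.smul_apply, smul_eq_mul, o2, o1] at h1
  have := round_sq c
  have h2 := hpos _ ha0
  nlinarith

lemma not_span3 (hdim : Module.finrank ℚ V = 4) (x y z : V) :
    ∃ v, v ∉ Submodule.span ℚ {x, y, z} := by
  classical
  by_contra! h
  have h1 : Submodule.span ℚ ((({x, y, z} : Finset V)) : Set V) = ⊤ := by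
    rw [eq_top_iff]; intro v _; simpa using h v
  have h2 := finrank_span_finset_le_card (R := ℚ) ({x, y, z} : Finset V)
  rw [Set.finrank, h1, finrank_top, hdim] at h2
  have := Finset.card_le_three (a := x) (b := y) (c := z)
  omega

theorem hkz (hsymm : ∀ x y, b x y = b y x) (hpos : ∀ x, x ≠ 0 → 0 < b x x)
    (hintg : ∀ x ∈ L, ∀ y ∈ L, ∃ n : ℤ, b x y = n)
    (hspan : ∀ x : V, ∃ n : ℤ, n ≠ 0 ∧ (n : ℚ) • x ∈ L)
    (hdim : Module.finrank ℚ V = 4) (u : V) (huL : u ∈ L) (hu4 : b u u = 4)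
    (hprim : ∀ c : ℚ, c • u ∈ L → ∃ n : ℤ, c = n) :
    ∃ α ∈ L, ∃ β ∈ L, ∃ γ ∈ L, ∃ e2 e3 e4 : V, ∃ l1 l2 l3 m1 m2 m3 : ℚ,
      α = e2 + l1 • u ∧ β = e3 + l2 • u + l3 • e2 ∧ γ = e4 + m1 • u + m2 • e2 + m3 • e3 ∧
      b e2 u = 0 ∧ b e3 u = 0 ∧ b e4 u = 0 ∧ b e3 e2 = 0 ∧ b e4 e2 = 0 ∧ b e4 e3 = 0 ∧
      0 < b e2 e2 ∧ 3 * b e2 e2 ≤ 4 * b e3 e3 ∧ 3 * b e3 e3 ≤ 4 * b e4 e4 ∧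
      (b α u = 0 ∨ b α u = 1 ∨ b α u = 2) ∧
      (∀ c d : ℚ, c • u + d • α ∈ L → (∃ n : ℤ, c = n) ∧ ∃ n : ℤ, d = n) ∧
      LinearIndependent ℚ ![u, α, β, γ] ∧
      (∀ x ∈ L, ∃ n : Fin 4 → ℤ, x = n 0 • u + n 1 • α + n 2 • β + n 3 • γ) := by
  classical
  have hu0 : u ≠ 0 := by rintro rfl; simp at hu4
  have hi0 : ∃ M : ℤ, M ≠ 0 ∧ ∀ x ∈ L, (M : ℚ) • (LinearMap.id : V →ₗ[ℚ] V) x ∈ L :=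
    ⟨1, one_ne_zero, fun x hx => by simpa using hx⟩
  set p2 := nxt b (LinearMap.id) u with hp2
  have p2a : ∀ x, p2 x = x - (b x u / 4) • u := by
    intro x; rw [hp2, nxt_apply]; simp only [LinearMap.id_apply, hu4]; congr 2; ring
  have p2u : p2 u = 0 := nxt_self hpos hu0
  have hi2 := nxt_int hintg hpos hi0 huL hu0
  rw [← hp2] at hi2
  have o2u : ∀ x, b (p2 x) u = 0 := fun x => nxt_orth hpos (p := LinearMap.id) hu0
  -- first minimum
  have hne2 : ∃ x, p2 x ≠ 0 := by
    obtain ⟨v, hv⟩ := not_span3 hdim u u u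
    refine ⟨v, fun h => hv ?_⟩
    rw [p2a, sub_eq_zero] at h
    rw [h]
    exact Submodule.smul_mem _ _ (Submodule.subset_span (by simp))
  obtain ⟨α0, hα0⟩ := exists_min hintg hpos hi2 hspan hne2
  obtain ⟨α, hα, hαt⟩ : ∃ α, IsMin b L p2 α ∧ (b α u = 0 ∨ b α u = 1 ∨ b α u = 2) := by
    obtain ⟨t, ht⟩ := hintg _ hα0.1 _ huL
    have shift : ∀ n : ℤ, IsMin b L p2 (α0 + n • u) := by
      intro n
      have : p2 (α0 + n • u) = p2 α0 := by rw [map_add, map_zsmul, p2u]; simp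
      refine ⟨L.add_mem hα0.1 (L.zsmul_mem huL _), ?_, ?_⟩
      · rw [this]; exact hα0.2.1
      · rw [this]; exact hα0.2.2
    have shift' : ∀ n : ℤ, IsMin b L p2 (-α0 + n • u) := by
      intro n
      have : p2 (-α0 + n • u) = -p2 α0 := by rw [map_add, map_zsmul, p2u, map_neg]; simp
      refine ⟨L.add_mem (L.neg_mem hα0.1) (L.zsmul_mem huL _), ?_, ?_⟩
      · rw [this]; exact neg_ne_zero.2 hα0.2.1
      · rw [this]; simpa using hα0.2.2
    have val : ∀ n : ℤ, b (α0 + n • u) u = ((t + 4 * n : ℤ) : ℚ) := by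
      intro n
      rw [← Int.cast_smul_eq_zsmul ℚ]
      simp only [map_add, map_smul, LinearMap.add_apply, LinearMap.smul_apply, smul_eq_mul, ht, hu4]
      push_cast; ring
    have val' : ∀ n : ℤ, b (-α0 + n • u) u = ((-t + 4 * n : ℤ) : ℚ) := by
      intro n
      rw [← Int.cast_smul_eq_zsmul ℚ]
      simp only [map_add, map_neg, map_smul, LinearMap.add_apply, LinearMap.neg_apply,
        LinearMap.smul_apply, smul_eq_mul, ht, hu4]
      push_cast; ring
    have hcase : t % 4 = 0 ∨ t % 4 = 1 ∨ t % 4 = 2 ∨ t % 4 = 3 := by omega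
    rcases hcase with h | h | h | h
    · refine ⟨_, shift (-(t/4)), Or.inl ?_⟩
      rw [val]; exact_mod_cast (by omega : t + 4 * (-(t/4)) = 0)
    · refine ⟨_, shift (-(t/4)), Or.inr (Or.inl ?_)⟩
      rw [val]; exact_mod_cast (by omega : t + 4 * (-(t/4)) = 1)
    · refine ⟨_, shift (-(t/4)), Or.inr (Or.inr ?_)⟩
      rw [val]; exact_mod_cast (by omega : t + 4 * (-(t/4)) = 2)
    · refine ⟨_, shift' (t/4 + 1), Or.inr (Or.inl ?_)⟩
      rw [val']; exact_mod_cast (by omega : -t + 4 * (t/4 + 1) = 1)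
  -- second minimum
  set p3 := nxt b p2 α with hp3
  have p3u : p3 u = 0 := nxt_zero p2u
  have p3α : p3 α = 0 := nxt_self hpos hα.2.1
  have p3a : ∀ x, p3 x = x - (b x u / 4) • u - ((b (p2 α) (p2 α))⁻¹ * b (p2 x) (p2 α)) • p2 α := by
    intro x; rw [hp3, nxt_apply, p2a x]
  have hi3 := nxt_int hintg hpos hi2 hα.1 hα.2.1
  rw [← hp3] at hi3
  have o3u : ∀ x, b (p3 x) u = 0 := fun x => nxt_orth' o2u _ _
  have o32 : ∀ x, b (p3 x) (p2 α) = 0 := fun x => nxt_orth hpos hα.2.1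
  have hne3 : ∃ x, p3 x ≠ 0 := by
    obtain ⟨v, hv⟩ := not_span3 hdim u (p2 α) (p2 α)
    refine ⟨v, fun h => hv ?_⟩
    rw [p3a, sub_eq_zero, sub_eq_iff_eq_add] at h
    rw [h]
    exact Submodule.add_mem _ (Submodule.smul_mem _ _ (Submodule.subset_span (by simp)))
      (Submodule.smul_mem _ _ (Submodule.subset_span (by simp)))
  obtain ⟨β, hβ⟩ := exists_min hintg hpos hi3 hspan hne3
  -- third minimum
  set p4 := nxt b p3 β with hp4
  have p4u : p4 u = 0 := nxt_zero p3u
  have p4α : p4 α = 0 := nxt_zero p3α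
  have p4β : p4 β = 0 := nxt_self hpos hβ.2.1
  have p4a : ∀ x, p4 x = x - (b x u / 4) • u - ((b (p2 α) (p2 α))⁻¹ * b (p2 x) (p2 α)) • p2 α
      - ((b (p3 β) (p3 β))⁻¹ * b (p3 x) (p3 β)) • p3 β := by
    intro x; rw [hp4, nxt_apply, p3a x]
  have hi4 := nxt_int hintg hpos hi3 hβ.1 hβ.2.1
  rw [← hp4] at hi4
  have o4u : ∀ x, b (p4 x) u = 0 := fun x => nxt_orth' o3u _ _
  have o42 : ∀ x, b (p4 x) (p2 α) = 0 := fun x => nxt_orth' o32 _ _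
  have o43 : ∀ x, b (p4 x) (p3 β) = 0 := fun x => nxt_orth hpos hβ.2.1
  have hne4 : ∃ x, p4 x ≠ 0 := by
    obtain ⟨v, hv⟩ := not_span3 hdim u (p2 α) (p3 β)
    refine ⟨v, fun h => hv ?_⟩
    rw [p4a, sub_eq_zero, sub_eq_iff_eq_add, sub_eq_iff_eq_add] at h
    rw [h]
    exact Submodule.add_mem _ (Submodule.add_mem _ (Submodule.smul_mem _ _ (Submodule.subset_span (by simp)))
      (Submodule.smul_mem _ _ (Submodule.subset_span (by simp))))
      (Submodule.smul_mem _ _ (Submodule.subset_span (by simp)))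
  obtain ⟨γ, hγ⟩ := exists_min hintg hpos hi4 hspan hne4
  have int2 : ∀ c d : ℚ, c • u + d • α ∈ L → (∃ n : ℤ, c = n) ∧ ∃ n : ℤ, d = n := by
    intro c d h
    obtain ⟨n, rfl⟩ := hα.int hpos h (c := d) (by simp [p2u])
    refine ⟨hprim c ?_, n, rfl⟩
    have := L.sub_mem h (L.zsmul_mem hα.1 n)
    rwa [← Int.cast_smul_eq_zsmul ℚ, add_sub_cancel_right] at this
  have hli : LinearIndependent ℚ ![u, α, β, γ] := by
    rw [Fintype.linearIndependent_iff]
    intro g hg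
    rw [Fin.sum_univ_four] at hg
    simp only [Matrix.cons_val] at hg
    have h3 : g 3 = 0 := by
      have := congrArg p4 hg
      simpa [p4u, p4α, p4β, hγ.2.1] using this
    rw [h3] at hg
    have h2 : g 2 = 0 := by
      have := congrArg p3 hg
      simpa [p3u, p3α, hβ.2.1] using this
    rw [h2] at hg
    have h1 : g 1 = 0 := by
      have := congrArg p2 hg
      simpa [p2u, hα.2.1] using this
    rw [h1] at hg
    have h0 : g 0 = 0 := by simpa [hu0] using hg
    intro i; fin_cases i <;> assumption
  refine ⟨α, hα.1, β, hβ.1, γ, hγ.1, p2 α, p3 β, p4 γ, b α u / 4, b β u / 4,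
    (b (p2 α) (p2 α))⁻¹ * b (p2 β) (p2 α), b γ u / 4, (b (p2 α) (p2 α))⁻¹ * b (p2 γ) (p2 α),
    (b (p3 β) (p3 β))⁻¹ * b (p3 γ) (p3 β),
    eq_add_of_sub_eq (p2a α).symm, ?_, ?_, o2u _, o3u _, o4u _, o32 _, o42 _, o43 _,
    hpos _ hα.2.1, hα.red hsymm hpos hβ.1 hβ.2.1, hβ.red hsymm hpos hγ.1 hγ.2.1, hαt, int2,
    hli, ?_⟩
  · rw [p3a]; abel
  · rw [p4a]; abel
  · intro x hx
    let bs := basisOfLinearIndependentOfCardEqFinrank hli (by simp [hdim])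
    have hx1 := bs.sum_repr x
    rw [Fin.sum_univ_four] at hx1
    simp only [bs, coe_basisOfLinearIndependentOfCardEqFinrank, Matrix.cons_val] at hx1
    generalize (basisOfLinearIndependentOfCardEqFinrank hli _).repr x = c at hx1
    obtain ⟨n3, h3⟩ := hγ.int hpos hx (c := c 3) (by rw [← hx1]; simp [p4u, p4α, p4β])
    have hx2 : x - n3 • γ ∈ L := L.sub_mem hx (L.zsmul_mem hγ.1 _)
    have e2 : x - n3 • γ = c 0 • u + c 1 • α + c 2 • β := by
      rw [← hx1, h3, Int.cast_smul_eq_zsmul]; abel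
    obtain ⟨n2, h2⟩ := hβ.int hpos hx2 (c := c 2) (by rw [e2]; simp [p3u, p3α])
    have hx3 : x - n3 • γ - n2 • β ∈ L := L.sub_mem hx2 (L.zsmul_mem hβ.1 _)
    have e3 : x - n3 • γ - n2 • β = c 0 • u + c 1 • α := by
      rw [e2, h2, Int.cast_smul_eq_zsmul]; abel
    obtain ⟨⟨n0, h0⟩, ⟨n1, h1⟩⟩ := int2 (c 0) (c 1) (e3 ▸ hx3)
    refine ⟨![n0, n1, n2, n3], ?_⟩
    rw [← hx1, h0, h1, h2, h3]
    simp only [Int.cast_smul_eq_zsmul, Matrix.cons_val]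
end Lattice

end St6

namespace St6
universe u
open Module
variable {K : Type u} [Field K] [NumberField K]

lemma exists_emb [IsTotallyReal K] (h4 : finrank ℚ K = 4) :
    ∃ σ : Fin 4 → (K →+* ℝ), ∀ x, ((Algebra.trace ℚ K x : ℚ) : ℝ) = ∑ i, σ i x := by
  classical
  have hc : Fintype.card (K →ₐ[ℚ] ℂ) = 4 := by rw [AlgHom.card, h4]
  let e := Fintype.equivFinOfCardEq hc
  refine ⟨fun i => (IsTotallyReal.complexEmbedding_isReal ((e.symm i : K →ₐ[ℚ] ℂ) : K →+* ℂ)).embedding,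
    fun x => ?_⟩
  have h := trace_eq_sum_embeddings (K := ℚ) (L := K) ℂ (x := x)
  rw [← Equiv.sum_comp e.symm] at h
  apply Complex.ofReal_injective
  rw [Complex.ofReal_sum]
  simp only [ComplexEmbedding.IsReal.coe_embedding_apply]
  convert h using 1
  · simp
  · rfl

lemma rat_int {q : ℚ} {E : Type*} [Field E] [CharZero E] (h : IsIntegral ℤ (q : E)) :
    ∃ n : ℤ, q = n := by
  have h1 : IsIntegral ℤ q := by
    have : (q : E) = algebraMap ℚ E q := by simp
    rw [this] at h
    exact (isIntegral_algebraMap_iff (algebraMap ℚ E).injective).1 h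
  obtain ⟨n, hn⟩ := IsIntegrallyClosed.isIntegral_iff.1 h1
  exact ⟨n, by simpa using hn.symm⟩

lemma trace_int {x : K} (hx : IsIntegral ℤ x) : ∃ n : ℤ, Algebra.trace ℚ K x = n := by
  have h1 := Algebra.isIntegral_trace (L := ℚ) hx
  obtain ⟨n, hn⟩ := IsIntegrallyClosed.isIntegral_iff.1 h1
  exact ⟨n, by simpa using hn.symm⟩

lemma exists_basis (h4 : finrank ℚ K = 4) : ∃ v : Fin 4 → K, (∀ i, IsIntegral ℤ (v i)) ∧
    Algebra.discr ℚ v = discr K ∧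
    ∀ x, IsIntegral ℤ x → ∃ n : Fin 4 → ℤ, x = ∑ i, n i • v i := by
  classical
  have hc : Fintype.card (Module.Free.ChooseBasisIndex ℤ (𝓞 K)) = 4 := by
    rw [← finrank_eq_card_chooseBasisIndex, RingOfIntegers.rank, h4]
  let e := Fintype.equivFinOfCardEq hc
  refine ⟨integralBasis K ∘ e.symm, fun i => ?_, ?_, fun x hx => ?_⟩
  · simp only [Function.comp, integralBasis_apply]
    exact RingOfIntegers.isIntegral_coe _
  · rw [Algebra.discr_reindex, coe_discr]
  · obtain ⟨y, rfl⟩ : ∃ y : 𝓞 K, algebraMap (𝓞 K) K y = x := ⟨⟨x, hx⟩, rfl⟩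
    refine ⟨fun i => (RingOfIntegers.basis K).repr y (e.symm i), ?_⟩
    have h := (RingOfIntegers.basis K).sum_repr y
    have h2 := congrArg (algebraMap (𝓞 K) K) h
    rw [map_sum] at h2
    refine Eq.trans ?_ (Equiv.sum_comp e.symm (fun i => (RingOfIntegers.basis K).repr y i • integralBasis K i)).symm
    refine (h2.symm.trans ?_)
    refine Finset.sum_congr rfl fun i _ => ?_
    rw [map_zsmul, integralBasis_apply]

lemma discr_comb (v w : Fin 4 → K) (h : ∀ j, ∃ n : Fin 4 → ℤ, w j = ∑ i, n i • v i) :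
    ∃ f : ℤ, Algebra.discr ℚ w = f ^ 2 * Algebra.discr ℚ v := by
  choose n hn using h
  refine ⟨(Matrix.of n).det, ?_⟩
  have := Algebra.discr_of_matrix_mulVec (A := ℚ) v ((Matrix.of n).map (Int.cast : ℤ → ℚ))
  have hw : ((((Matrix.of n).map (Int.cast : ℤ → ℚ))).map (algebraMap ℚ K)).mulVec v = w := by
    ext j
    rw [hn]
    simp [Matrix.mulVec, dotProduct]
  rw [hw] at this
  rw [this]
  congr 2
  have := Int.cast_det (R := ℚ) (Matrix.of n)
  rw [this]
  

lemma discr_mul (h4 : finrank ℚ K = 4) (w : Fin 4 → K) (hw : ∀ i, IsIntegral ℤ (w i)) :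
    ∃ f : ℤ, Algebra.discr ℚ w = f ^ 2 * discr K := by
  obtain ⟨v, -, hv, hs⟩ := exists_basis (K := K) h4
  rw [← hv]
  exact discr_comb v w fun j => hs _ (hw j)

lemma discr_orth (e : Fin 4 → K) (g : Fin 4 → ℚ)
    (h : ∀ i j, Algebra.traceForm ℚ K (e i) (e j) = if i = j then g i else 0) :
    Algebra.discr ℚ e = g 0 * g 1 * g 2 * g 3 := by
  rw [Algebra.discr_def]
  have : Algebra.traceMatrix ℚ e = Matrix.diagonal g := by
    ext i j
    rw [Algebra.traceMatrix_apply, h, Matrix.diagonal_apply]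
  rw [this, Matrix.det_diagonal, Fin.prod_univ_four]

theorem nf_hkz [IsTotallyReal K] (h4 : finrank ℚ K = 4) :
    ∃ α β e3 : K, ∃ c d A B : ℚ, IsIntegral ℤ α ∧ IsIntegral ℤ β ∧
      β = e3 + c • 1 + d • α ∧ Algebra.trace ℚ K e3 = 0 ∧ Algebra.trace ℚ K (e3 * α) = 0 ∧
      A = Algebra.trace ℚ K (α * α) - (Algebra.trace ℚ K α) ^ 2 / 4 ∧
      B = Algebra.trace ℚ K (e3 * e3) ∧ 0 < A ∧ 0 < B ∧
      27 * A ^ 3 ≤ 16 * discr K ∧ 3 * A * B ^ 2 ≤ discr K ∧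
      (Algebra.trace ℚ K α = 0 ∨ Algebra.trace ℚ K α = 1 ∨ Algebra.trace ℚ K α = 2) ∧
      (∀ c d : ℚ, IsIntegral ℤ (c • 1 + d • α) → (∃ n : ℤ, c = n) ∧ ∃ n : ℤ, d = n) := by
  classical
  obtain ⟨σ, hσ⟩ := exists_emb (K := K) h4
  let b := Algebra.traceForm ℚ K
  have hb : ∀ x y, b x y = Algebra.trace ℚ K (x * y) := fun x y => rfl
  let L : AddSubgroup K := (integralClosure ℤ K).toSubmodule.toAddSubgroup
  have hL : ∀ x, x ∈ L ↔ IsIntegral ℤ x := fun x => Iff.rfl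
  have hsymm : ∀ x y, b x y = b y x := fun x y => by rw [hb, hb, mul_comm]
  obtain ⟨α, hα, β, hβ, γ, hγ, e2, e3, e4, l1, l2, l3, m1, m2, m3, h1, h2, h3, o1, o2, o3, o4, o5, o6,
      hA, hAB, hBC, ht, hint2, hli, hsp⟩ :=
    hkz (b := b) (L := L) hsymm (by
      intro x hx
      have h : (0:ℝ) < ((b x x : ℚ) : ℝ) := by
        rw [hb, hσ]
        refine Finset.sum_pos (fun i _ => ?_) ⟨0, Finset.mem_univ _⟩
        rw [map_mul]
        exact mul_self_pos.2 (by simpa using hx)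
      exact_mod_cast h) (by
      intro x hx y hy
      exact trace_int (IsIntegral.mul ((hL x).1 hx) ((hL y).1 hy))) (by
      intro x
      obtain ⟨n, hn, h⟩ := exists_integral_multiples ℤ ℚ {x}
      refine ⟨n, hn, ?_⟩
      rw [Int.cast_smul_eq_zsmul]
      exact h x (by simp)) h4 1 ((hL 1).2 isIntegral_one) (by
      rw [hb, mul_one]
      have := Algebra.trace_algebraMap (R := ℚ) (S := K) 1
      rw [map_one] at this
      rw [this, h4]; norm_num) (by
      intro c hc
      rw [hL, Algebra.smul_def, mul_one] at hc
      exact rat_int (E := K) (by simpa using hc))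
  have h11 : b 1 1 = 4 := by
    rw [hb, mul_one]
    have := Algebra.trace_algebraMap (R := ℚ) (S := K) 1
    rw [map_one] at this
    rw [this, h4]; norm_num
  have hB : 0 < b e3 e3 := by linarith
  have hC : 0 < b e4 e4 := by linarith
  have hD1 : Algebra.discr ℚ ![1, e2, e3, e4] = 4 * b e2 e2 * b e3 e3 * b e4 e4 := by
    rw [discr_orth ![1, e2, e3, e4] ![4, b e2 e2, b e3 e3, b e4 e4]]
    · simp
    · have o1' := hsymm 1 e2
      have o2' := hsymm 1 e3
      have o3' := hsymm 1 e4
      have o4' := hsymm e2 e3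
      have o5' := hsymm e2 e4
      have o6' := hsymm e3 e4
      rw [o1] at o1'; rw [o2] at o2'; rw [o3] at o3'; rw [o4] at o4'; rw [o5] at o5'; rw [o6] at o6'
      intro i j
      change b _ _ = _
      fin_cases i <;> fin_cases j <;>
        simp [h11, o1, o2, o3, o4, o5, o6, o1', o2', o3', o4', o5', o6']
  have hD2 : Algebra.discr ℚ ![1, α, β, γ] = Algebra.discr ℚ ![1, e2, e3, e4] := by
    have := Algebra.discr_of_matrix_mulVec (A := ℚ) ![1, e2, e3, e4]
      !![1, 0, 0, 0; l1, 1, 0, 0; l2, l3, 1, 0; m1, m2, m3, 1]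
    have hdet : (!![1, 0, 0, 0; l1, 1, 0, 0; l2, l3, 1, 0; m1, m2, m3, 1] : Matrix (Fin 4) (Fin 4) ℚ).det = 1 := by
      simp [Matrix.det_succ_row_zero, Fin.sum_univ_succ]
    rw [hdet, one_pow, one_mul] at this
    rw [← this]
    congr 1
    ext i
    fin_cases i
    · simp [Matrix.mulVec, dotProduct, Fin.sum_univ_four]
    · simp [Matrix.mulVec, dotProduct, Fin.sum_univ_four, h1, Algebra.smul_def]; ring
    · simp [Matrix.mulVec, dotProduct, Fin.sum_univ_four, h2, Algebra.smul_def]; ring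
    · simp [Matrix.mulVec, dotProduct, Fin.sum_univ_four, h3, Algebra.smul_def]; ring
  have hDK : (discr K : ℚ) = 4 * b e2 e2 * b e3 e3 * b e4 e4 := by
    obtain ⟨v, hv, hvd, -⟩ := exists_basis (K := K) h4
    obtain ⟨f, hf⟩ := discr_mul h4 ![1, α, β, γ] (by
      intro i; fin_cases i
      · exact isIntegral_one
      · exact hα
      · exact hβ
      · exact hγ)
    obtain ⟨g, hg⟩ := discr_comb ![1, α, β, γ] v (by
      intro j
      obtain ⟨n, hn⟩ := hsp (v j) (hv j)
      exact ⟨n, by rw [hn, Fin.sum_univ_four]; simp⟩)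
    rw [hvd, hf] at hg
    have hD0 : (discr K : ℚ) ≠ 0 := by exact_mod_cast discr_ne_zero K
    have hfg : (g:ℚ)^2 * f^2 = 1 := by
      apply mul_right_cancel₀ hD0; rw [one_mul]; rw [mul_assoc]; exact hg.symm
    have hfg' : g^2 * f^2 = 1 := by exact_mod_cast hfg
    have hf1 : f^2 = 1 := by
      have hu : IsUnit (f^2) := IsUnit.of_mul_eq_one (g^2) (by linarith)
      rcases Int.isUnit_iff.1 hu with h | h
      · exact h
      · nlinarith
    have hf1' : (f:ℚ)^2 = 1 := by exact_mod_cast hf1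
    rw [hf1', one_mul, hD2, hD1] at hf
    exact hf.symm
  have hl1 : l1 = Algebra.trace ℚ K α / 4 := by
    have : b α 1 = 4 * l1 := by
      rw [h1]
      simp only [map_add, map_smul, LinearMap.add_apply, LinearMap.smul_apply, smul_eq_mul, o1, h11]
      ring
    rw [hb, mul_one] at this
    rw [this]; ring
  refine ⟨α, β, e3, l2 - l3 * l1, l3, b e2 e2, b e3 e3, hα, hβ, ?_, ?_, ?_, ?_, rfl, hA, hB, ?_, ?_,
    ?_, hint2⟩
  · rw [h2, h1]; simp only [Algebra.smul_def, map_sub, map_mul]; ring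
  · rw [← o2, hb, mul_one]
  · rw [← hb, h1]
    simp only [map_add, map_smul, smul_eq_mul, o2, o4]; ring
  · have : b α α = b e2 e2 + 4 * l1^2 := by
      rw [h1]
      have o1' := hsymm 1 e2
      simp only [map_add, map_smul, LinearMap.add_apply, LinearMap.smul_apply, smul_eq_mul, o1', o1, h11]
      ring
    rw [hb α α] at this
    rw [this, hl1]; ring
  · rw [hDK]
    set A := b e2 e2
    set B := b e3 e3
    set C := b e4 e4
    have a1 : 9 * A ≤ 16 * C := by linarith
    have a2 : (3 * A) * (9 * A) ≤ (4 * B) * (16 * C) := mul_le_mul hAB a1 (by positivity) (by positivity)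
    have := mul_le_mul_of_nonneg_left a2 hA.le
    nlinarith
  · rw [hDK]
    set A := b e2 e2
    set B := b e3 e3
    set C := b e4 e4
    have := mul_le_mul_of_nonneg_left hBC (mul_pos hA hB).le
    nlinarith
  · simpa [hb] using ht

end St6

namespace St6
universe u
open Module

/-- power sums -/
def P2 (e1 e2 : ℤ) : ℤ := e1 * e1 - 2 * e2
/-- power sums -/
def P3 (e1 e2 e3 : ℤ) : ℤ := e1 * P2 e1 e2 - e2 * e1 + 3 * e3
/-- power sums -/
def P4 (e1 e2 e3 e4 : ℤ) : ℤ := e1 * P3 e1 e2 e3 - e2 * P2 e1 e2 + e3 * e1 - e4 * 4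
/-- power sums -/
def P5 (e1 e2 e3 e4 : ℤ) : ℤ :=
  e1 * P4 e1 e2 e3 e4 - e2 * P3 e1 e2 e3 + e3 * P2 e1 e2 - e4 * e1
/-- power sums -/
def P6 (e1 e2 e3 e4 : ℤ) : ℤ :=
  e1 * P5 e1 e2 e3 e4 - e2 * P4 e1 e2 e3 e4 + e3 * P3 e1 e2 e3 - e4 * P2 e1 e2

/-- three by three determinant -/
def d3 (a b c d e f g h i : ℤ) : ℤ := a * (e * i - f * h) - b * (d * i - f * g) + c * (d * h - e * g)

/-- Gram determinant of `1, α, α²` -/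
def hk3 (p1 p2 p3 p4 : ℤ) : ℤ := d3 4 p1 p2 p1 p2 p3 p2 p3 p4

/-- Gram determinant of `1, α, α², α³` -/
def hk4 (p1 p2 p3 p4 p5 p6 : ℤ) : ℤ :=
  4 * d3 p2 p3 p4 p3 p4 p5 p4 p5 p6 - p1 * d3 p1 p3 p4 p2 p4 p5 p3 p5 p6
  + p2 * d3 p1 p2 p4 p2 p3 p5 p3 p4 p6 - p3 * d3 p1 p2 p3 p2 p3 p4 p3 p4 p5

/-- Gram determinant in terms of the elementary symmetric functions -/
def H3 (e1 e2 e3 e4 : ℤ) : ℤ := hk3 e1 (P2 e1 e2) (P3 e1 e2 e3) (P4 e1 e2 e3 e4)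
/-- Gram determinant in terms of the elementary symmetric functions -/
def H4 (e1 e2 e3 e4 : ℤ) : ℤ := hk4 e1 (P2 e1 e2) (P3 e1 e2 e3) (P4 e1 e2 e3 e4)
  (P5 e1 e2 e3 e4) (P6 e1 e2 e3 e4)

/-- outcome of the enumeration -/
def good (e1 e2 e3 e4 : ℤ) : Prop :=
  H3 e1 e2 e3 e4 ≤ 0 ∨ H4 e1 e2 e3 e4 ≤ 0 ∨ e4 = 0 ∨ 1 - e1 + e2 - e3 + e4 = 0 ∨
    1 + e1 + e2 + e3 + e4 = 0 ∨ (e1 = 0 ∧ e2 = -3 ∧ e3 = 0 ∧ e4 = 1) ∨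
    (e1 = 1 ∧ e2 = -3 ∧ e3 = -2 ∧ e4 = 2) ∨
    (H4 e1 e2 e3 e4 = 725 ∧ (e1 = 1 ∧ e2 = -3 ∨ e1 = 2 ∧ e2 = -2))

instance (e1 e2 e3 e4 : ℤ) : Decidable (good e1 e2 e3 e4) := by unfold good; infer_instance

lemma enum_aux : ∀ c ∈ ([(0,-1),(0,-2),(0,-3),(1,0),(1,-1),(1,-2),(1,-3),(2,1),(2,0),(2,-1),(2,-2)] : List (ℤ × ℤ)),
    ∀ i : Fin 31, ∀ j : Fin 9, good c.1 c.2 ((i : ℕ) - 15) ((j : ℕ) - 4) := by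
  decide +kernel

lemma enum (e1 e2 e3 e4 : ℤ)
    (hc : (e1, e2) ∈ ([(0,-1),(0,-2),(0,-3),(1,0),(1,-1),(1,-2),(1,-3),(2,1),(2,0),(2,-1),(2,-2)] : List (ℤ × ℤ)))
    (h4 : -4 ≤ e4) (h4' : e4 ≤ 4) : good e1 e2 e3 e4 := by
  by_cases h3 : -15 ≤ e3 ∧ e3 ≤ 15
  · have := enum_aux _ hc ⟨(e3 + 15).toNat, by omega⟩ ⟨(e4 + 4).toNat, by omega⟩
    simp only at this
    rwa [Int.toNat_of_nonneg (by omega), Int.toNat_of_nonneg (by omega), add_sub_cancel_right,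
      add_sub_cancel_right] at this
  · left
    have h3' : 16 * 16 ≤ e3 ^ 2 := by
      rcases lt_or_ge e3 (-15) with h | h
      · nlinarith
      · have : 15 < e3 := by omega
        nlinarith
    simp only [List.mem_cons, Prod.mk.injEq, List.not_mem_nil, or_false] at hc
    rcases hc with ⟨rfl, rfl⟩ | ⟨rfl, rfl⟩ | ⟨rfl, rfl⟩ | ⟨rfl, rfl⟩ | ⟨rfl, rfl⟩ | ⟨rfl, rfl⟩ |
      ⟨rfl, rfl⟩ | ⟨rfl, rfl⟩ | ⟨rfl, rfl⟩ | ⟨rfl, rfl⟩ | ⟨rfl, rfl⟩ <;>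
    simp only [H3, hk3, d3, P2, P3, P4] <;> nlinarith [sq_nonneg (e3 - 8), sq_nonneg (e3 + 8)]

lemma hk4_det (p1 p2 p3 p4 p5 p6 : ℤ) (q1 q2 q3 q4 q5 q6 : ℝ) (h1 : (p1 : ℝ) = q1) (h2 : (p2 : ℝ) = q2)
    (h3 : (p3 : ℝ) = q3) (h4 : (p4 : ℝ) = q4) (h5 : (p5 : ℝ) = q5) (h6 : (p6 : ℝ) = q6) :
    (hk4 p1 p2 p3 p4 p5 p6 : ℝ) =
    (!![4, q1, q2, q3; q1, q2, q3, q4; q2, q3, q4, q5; q3, q4, q5, q6] : Matrix (Fin 4) (Fin 4) ℝ).det := by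
  subst h1 h2 h3 h4 h5 h6
  simp [hk4, d3, Matrix.det_succ_row_zero, Fin.sum_univ_succ, Fin.succAbove]
  ring

/-- product of differences -/
def vdm (x : Fin 4 → ℝ) : ℝ :=
  (x 1 - x 0) * (x 2 - x 0) * (x 3 - x 0) * (x 2 - x 1) * (x 3 - x 1) * (x 3 - x 2)

lemma hankel (x : Fin 4 → ℝ) (q : ℕ → ℝ) (hq : ∀ k, q k = ∑ i, x i ^ k) :
    (Matrix.of (fun i j : Fin 4 => q (i + j))).det = vdm x ^ 2 := by
  have h : Matrix.of (fun i j : Fin 4 => q (i + j)) =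
      (Matrix.vandermonde x).transpose * Matrix.vandermonde x := by
    ext i j
    simp [Matrix.mul_apply, Matrix.vandermonde_apply, hq, pow_add]
  rw [h, Matrix.det_mul, Matrix.det_transpose, Matrix.det_vandermonde, ← sq]
  congr 1
  have e0 : Finset.Ioi (0 : Fin 4) = {1, 2, 3} := by decide
  have e1 : Finset.Ioi (1 : Fin 4) = {2, 3} := by decide
  have e2 : Finset.Ioi (2 : Fin 4) = {3} := by decide
  have e3 : Finset.Ioi (3 : Fin 4) = ∅ := by decide
  rw [Fin.prod_univ_four, e0, e1, e2, e3, vdm, Finset.prod_insert (by decide),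
    Finset.prod_pair (by decide), Finset.prod_pair (by decide), Finset.prod_singleton,
    Finset.prod_empty]
  ring

lemma psums (x : Fin 4 → ℝ) (e1 e2 e3 e4 : ℤ) (h1 : (e1 : ℝ) = x 0 + x 1 + x 2 + x 3)
    (h2 : (e2 : ℝ) = x 0 * x 1 + x 0 * x 2 + x 0 * x 3 + x 1 * x 2 + x 1 * x 3 + x 2 * x 3)
    (h3 : (e3 : ℝ) = x 0 * x 1 * x 2 + x 0 * x 1 * x 3 + x 0 * x 2 * x 3 + x 1 * x 2 * x 3)
    (h4 : (e4 : ℝ) = x 0 * x 1 * x 2 * x 3) :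
    (P2 e1 e2 : ℝ) = ∑ i, x i ^ 2 ∧ (P3 e1 e2 e3 : ℝ) = ∑ i, x i ^ 3 ∧
    (P4 e1 e2 e3 e4 : ℝ) = ∑ i, x i ^ 4 ∧ (P5 e1 e2 e3 e4 : ℝ) = ∑ i, x i ^ 5 ∧
    (P6 e1 e2 e3 e4 : ℝ) = ∑ i, x i ^ 6 := by
  have a2 : (P2 e1 e2 : ℝ) = ∑ i, x i ^ 2 := by
    rw [P2]; push_cast; rw [h1, h2, Fin.sum_univ_four]; ring
  have a3 : (P3 e1 e2 e3 : ℝ) = ∑ i, x i ^ 3 := by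
    rw [P3]; push_cast; rw [a2, h1, h2, h3, Fin.sum_univ_four, Fin.sum_univ_four]; ring
  have a4 : (P4 e1 e2 e3 e4 : ℝ) = ∑ i, x i ^ 4 := by
    rw [P4]; push_cast; rw [a3, a2, h1, h2, h3, h4]; simp only [Fin.sum_univ_four]; ring
  have a5 : (P5 e1 e2 e3 e4 : ℝ) = ∑ i, x i ^ 5 := by
    rw [P5]; push_cast; rw [a4, a3, a2, h1, h2, h3, h4]; simp only [Fin.sum_univ_four]; ring
  have a6 : (P6 e1 e2 e3 e4 : ℝ) = ∑ i, x i ^ 6 := by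
    rw [P6]; push_cast; rw [a5, a4, a3, a2, h2, h3, h4, h1]; simp only [Fin.sum_univ_four]; ring
  exact ⟨a2, a3, a4, a5, a6⟩

lemma H4_eq (x : Fin 4 → ℝ) (e1 e2 e3 e4 : ℤ) (h1 : (e1 : ℝ) = x 0 + x 1 + x 2 + x 3)
    (h2 : (e2 : ℝ) = x 0 * x 1 + x 0 * x 2 + x 0 * x 3 + x 1 * x 2 + x 1 * x 3 + x 2 * x 3)
    (h3 : (e3 : ℝ) = x 0 * x 1 * x 2 + x 0 * x 1 * x 3 + x 0 * x 2 * x 3 + x 1 * x 2 * x 3)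
    (h4 : (e4 : ℝ) = x 0 * x 1 * x 2 * x 3) :
    (H4 e1 e2 e3 e4 : ℝ) = vdm x ^ 2 := by
  obtain ⟨a2, a3, a4, a5, a6⟩ := psums x e1 e2 e3 e4 h1 h2 h3 h4
  rw [H4, hk4_det _ _ _ _ _ _ _ _ _ _ _ _ rfl a2 a3 a4 a5 a6,
    ← hankel x (fun k => ∑ i, x i ^ k) (fun k => rfl)]
  have a1 : (e1 : ℝ) = ∑ i, x i ^ 1 := by rw [h1, Fin.sum_univ_four]; ring
  have a0 : (4 : ℝ) = ∑ i, x i ^ 0 := by simp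
  congr 1
  ext i j
  fin_cases i <;> fin_cases j <;> first | exact a0 | exact a1 | rfl

lemma H3_eq (x : Fin 4 → ℝ) (e1 e2 e3 e4 : ℤ) (h1 : (e1 : ℝ) = x 0 + x 1 + x 2 + x 3)
    (h2 : (e2 : ℝ) = x 0 * x 1 + x 0 * x 2 + x 0 * x 3 + x 1 * x 2 + x 1 * x 3 + x 2 * x 3)
    (h3 : (e3 : ℝ) = x 0 * x 1 * x 2 + x 0 * x 1 * x 3 + x 0 * x 2 * x 3 + x 1 * x 2 * x 3)
    (h4 : (e4 : ℝ) = x 0 * x 1 * x 2 * x 3) :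
    (H3 e1 e2 e3 e4 : ℝ) = ((x 0 - x 1) * (x 0 - x 2) * (x 1 - x 2)) ^ 2 +
     ((x 0 - x 1) * (x 0 - x 3) * (x 1 - x 3)) ^ 2 +
     ((x 0 - x 2) * (x 0 - x 3) * (x 2 - x 3)) ^ 2 +
     ((x 1 - x 2) * (x 1 - x 3) * (x 2 - x 3)) ^ 2 := by
  obtain ⟨a2, a3, a4, a5, a6⟩ := psums x e1 e2 e3 e4 h1 h2 h3 h4
  rw [H3, hk3, d3]
  push_cast
  rw [a2, a3, a4, h1]
  simp only [Fin.sum_univ_four]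
  ring

end St6

namespace St6
universe u
open Module
variable {K : Type u} [Field K] [NumberField K]

lemma discr_sigma (σ : Fin 4 → (K →+* ℝ))
    (hσ : ∀ x, ((Algebra.trace ℚ K x : ℚ) : ℝ) = ∑ i, σ i x) (w : Fin 4 → K) :
    ((Algebra.discr ℚ w : ℚ) : ℝ) = (Matrix.of fun i j => σ i (w j)).det ^ 2 := by
  have h : (Algebra.traceMatrix ℚ w).map (Rat.castHom ℝ) =
      (Matrix.of fun i j => σ i (w j)).transpose * (Matrix.of fun i j => σ i (w j)) := by
    ext i j
    simp [Matrix.mul_apply, Algebra.traceMatrix_apply, Algebra.traceForm_apply, hσ]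
  have e : (Matrix.of fun i j => σ i (w j)).det ^ 2 = ((Matrix.of fun i j => σ i (w j)).transpose *
      (Matrix.of fun i j => σ i (w j))).det := by
    rw [Matrix.det_mul, Matrix.det_transpose, sq]
  rw [Algebra.discr_def, e, ← h]
  exact RingHom.map_det (Rat.castHom ℝ) _

lemma discr_pow_sigma (σ : Fin 4 → (K →+* ℝ))
    (hσ : ∀ x, ((Algebra.trace ℚ K x : ℚ) : ℝ) = ∑ i, σ i x) (α : K) :
    ((Algebra.discr ℚ (fun i : Fin 4 => α ^ (i : ℕ)) : ℚ) : ℝ) = vdm (fun i => σ i α) ^ 2 := by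
  rw [discr_sigma σ hσ, ← hankel (fun i => σ i α) (fun k => ∑ i, (σ i α) ^ k) (fun k => rfl), sq]
  nth_rewrite 1 [← Matrix.det_transpose]
  rw [← Matrix.det_mul]
  congr 1
  ext i j
  simp [Matrix.mul_apply, pow_add]

lemma esymm (σ : Fin 4 → (K →+* ℝ))
    (hσ : ∀ x, ((Algebra.trace ℚ K x : ℚ) : ℝ) = ∑ i, σ i x) (α : K) (hα : IsIntegral ℤ α)
    (x : Fin 4 → ℝ) (hx : ∀ i, x i = σ i α) :
    ∃ e1 e2 e3 e4 : ℤ, (e1 : ℝ) = x 0 + x 1 + x 2 + x 3 ∧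
    (e2 : ℝ) = x 0 * x 1 + x 0 * x 2 + x 0 * x 3 + x 1 * x 2 + x 1 * x 3 + x 2 * x 3 ∧
    (e3 : ℝ) = x 0 * x 1 * x 2 + x 0 * x 1 * x 3 + x 0 * x 2 * x 3 + x 1 * x 2 * x 3 ∧
    (e4 : ℝ) = x 0 * x 1 * x 2 * x 3 := by
  have hi : ∀ i, IsIntegral ℤ (x i) := fun i => by
    rw [hx]; exact map_isIntegral_int (σ i) hα
  have hp : ∀ k : ℕ, ((Algebra.trace ℚ K (α ^ k) : ℚ) : ℝ) =
      x 0 ^ k + x 1 ^ k + x 2 ^ k + x 3 ^ k := fun k => by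
    rw [hσ, Fin.sum_univ_four]; simp only [map_pow, hx]
  have key : ∀ (r : ℝ) (q : ℚ), (q : ℝ) = r → IsIntegral ℤ r → ∃ n : ℤ, (n : ℝ) = r := by
    intro r q h hr
    obtain ⟨n, hn⟩ := rat_int (q := q) (E := ℝ) (by rwa [h])
    exact ⟨n, by rw [← h, hn]; simp⟩
  set p := fun k : ℕ => Algebra.trace ℚ K (α ^ k) with hpd
  have hp' : ∀ k : ℕ, ((p k : ℚ) : ℝ) = x 0 ^ k + x 1 ^ k + x 2 ^ k + x 3 ^ k := hp
  obtain ⟨e1, h1⟩ := key (x 0 + x 1 + x 2 + x 3) (p 1) (by rw [hp']; ring)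
    ((((hi 0).add (hi 1)).add (hi 2)).add (hi 3))
  obtain ⟨e2, h2⟩ := key (x 0 * x 1 + x 0 * x 2 + x 0 * x 3 + x 1 * x 2 + x 1 * x 3 + x 2 * x 3)
    ((p 1 ^ 2 - p 2) / 2) (by push_cast; rw [hp', hp']; ring)
    (((((((hi 0).mul (hi 1)).add ((hi 0).mul (hi 2))).add ((hi 0).mul (hi 3))).add
      ((hi 1).mul (hi 2))).add ((hi 1).mul (hi 3))).add ((hi 2).mul (hi 3)))
  obtain ⟨e3, h3⟩ := key (x 0 * x 1 * x 2 + x 0 * x 1 * x 3 + x 0 * x 2 * x 3 + x 1 * x 2 * x 3)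
    ((p 1 ^ 3 - 3 * p 1 * p 2 + 2 * p 3) / 6) (by push_cast; rw [hp', hp', hp']; ring)
    ((((((hi 0).mul (hi 1)).mul (hi 2)).add (((hi 0).mul (hi 1)).mul (hi 3))).add
      (((hi 0).mul (hi 2)).mul (hi 3))).add (((hi 1).mul (hi 2)).mul (hi 3)))
  obtain ⟨e4, h4⟩ := key (x 0 * x 1 * x 2 * x 3)
    ((p 1 ^ 4 - 6 * p 1 ^ 2 * p 2 + 3 * p 2 ^ 2 + 8 * p 1 * p 3 - 6 * p 4) / 24)
    (by push_cast; rw [hp', hp', hp', hp']; ring)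
    ((((hi 0).mul (hi 1)).mul (hi 2)).mul (hi 3))
  exact ⟨e1, e2, e3, e4, h1, h2, h3, h4⟩

lemma amgm (a b c d : ℝ) (h : a ^ 2 + b ^ 2 + c ^ 2 + d ^ 2 ≤ 8) : |a * b * c * d| ≤ 4 := by
  have q1 : |a * b| ≤ (a ^ 2 + b ^ 2) / 2 := by
    rw [abs_le]; constructor <;> nlinarith [sq_nonneg (a + b), sq_nonneg (a - b)]
  have q2 : |c * d| ≤ (c ^ 2 + d ^ 2) / 2 := by
    rw [abs_le]; constructor <;> nlinarith [sq_nonneg (c + d), sq_nonneg (c - d)]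
  have : a * b * c * d = (a * b) * (c * d) := by ring
  rw [this, abs_mul]
  refine (mul_le_mul q1 q2 (abs_nonneg _) (by positivity)).trans ?_
  have s0 : 0 ≤ a ^ 2 + b ^ 2 := by positivity
  have s1 : 0 ≤ c ^ 2 + d ^ 2 := by positivity
  set u := a ^ 2 + b ^ 2
  set v := c ^ 2 + d ^ 2
  have h' : u + v ≤ 8 := by simp only [u, v]; linarith
  nlinarith [sq_nonneg (u - v)]

set_option maxHeartbeats 1000000 in
lemma case1 (h4 : finrank ℚ K = 4) (σ : Fin 4 → (K →+* ℝ))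
    (hσ : ∀ x, ((Algebra.trace ℚ K x : ℚ) : ℝ) = ∑ i, σ i x) (α : K) (hα : IsIntegral ℤ α)
    (A : ℚ) (hA : A = Algebra.trace ℚ K (α * α) - (Algebra.trace ℚ K α) ^ 2 / 4)
    (hA0 : 0 < A) (hAD : 27 * A ^ 3 ≤ 16 * discr K)
    (ht : Algebra.trace ℚ K α = 0 ∨ Algebra.trace ℚ K α = 1 ∨ Algebra.trace ℚ K α = 2)
    (hv : vdm (fun i => σ i α) ≠ 0) (hD : discr K < 725) : False := by
  obtain ⟨e1, e2, e3, e4, h1, h2, h3, h4'⟩ := esymm σ hσ α hα (fun i => σ i α) (fun i => rfl)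
  have hH4 := H4_eq (fun i => σ i α) e1 e2 e3 e4 h1 h2 h3 h4'
  have hH3 := H3_eq (fun i => σ i α) e1 e2 e3 e4 h1 h2 h3 h4'
  obtain ⟨hP2, -⟩ := psums (fun i => σ i α) e1 e2 e3 e4 h1 h2 h3 h4'
  have hv' := hv
  simp only [vdm, mul_ne_zero_iff, sub_ne_zero] at hv'
  obtain ⟨⟨⟨⟨⟨n01, n02⟩, n03⟩, n12⟩, n13⟩, n23⟩ := hv'
  have hchar : α ^ 4 - e1 * α ^ 3 + e2 * α ^ 2 - e3 * α + e4 = 0 := by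
    apply (σ 0).injective
    simp only [map_add, map_sub, map_mul, map_pow, map_intCast, map_zero]
    rw [h1, h2, h3, h4']
    ring
  have tr1 : Algebra.trace ℚ K α = e1 := by
    have h := hσ α
    rw [Fin.sum_univ_four, ← h1] at h
    exact_mod_cast h
  have tr2 : Algebra.trace ℚ K (α * α) = P2 e1 e2 := by
    have h := hσ (α * α)
    have e : ∑ i, σ i (α * α) = P2 e1 e2 := by
      rw [hP2]
      exact Finset.sum_congr rfl fun i _ => by rw [map_mul, sq]
    rw [e] at h
    exact_mod_cast h
  have hDq : (discr K : ℚ) ≤ 724 := by exact_mod_cast (by omega : discr K ≤ 724)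
  have hA75 : A < 755 / 100 := by
    by_contra hcon
    push Not at hcon
    have := pow_le_pow_left₀ (by norm_num) hcon 3
    norm_num at this
    linarith
  rw [tr1] at ht hA
  rw [tr2] at hA
  have hlist : (e1, e2) ∈ ([(0,-1),(0,-2),(0,-3),(1,0),(1,-1),(1,-2),(1,-3),(2,1),(2,0),(2,-1),(2,-2)] : List (ℤ × ℤ)) ∧ P2 e1 e2 ≤ 8 := by
    have hP : P2 e1 e2 = e1 * e1 - 2 * e2 := rfl
    have hl : (0:ℚ) < 4 * P2 e1 e2 - e1 ^ 2 := by linarith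
    have hu : (4 * P2 e1 e2 - e1 ^ 2 : ℚ) < 31 := by linarith
    have hl' : 0 < 4 * P2 e1 e2 - e1 ^ 2 := by exact_mod_cast hl
    have hu' : 4 * P2 e1 e2 - e1 ^ 2 < 31 := by exact_mod_cast hu
    rw [hP] at hl' hu' ⊢
    have ht' : e1 = 0 ∨ e1 = 1 ∨ e1 = 2 := by
      rcases ht with h | h | h
      · left; exact_mod_cast h
      · right; left; exact_mod_cast h
      · right; right; exact_mod_cast h
    simp only [List.mem_cons, Prod.mk.injEq, List.not_mem_nil, or_false]
    rcases ht' with rfl | rfl | rfl <;> omega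
  obtain ⟨hlist, hP8⟩ := hlist
  have he4 : -4 ≤ e4 ∧ e4 ≤ 4 := by
    have hP8' : (P2 e1 e2 : ℝ) ≤ 8 := by exact_mod_cast hP8
    rw [hP2, Fin.sum_univ_four] at hP8'
    have q3 : |(e4 : ℝ)| ≤ 4 := by
      rw [h4']
      exact amgm _ _ _ _ hP8'
    rw [abs_le] at q3
    exact ⟨by exact_mod_cast q3.1, by exact_mod_cast q3.2⟩
  have hintg : ∀ r : ℤ, α ≠ r := by
    intro r hr
    apply n01
    rw [hr]; simp
  have hquad : ∀ u v : ℤ, α ^ 2 ≠ u * α + v := by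
    intro u v h
    have hh : ∀ i, (σ i α) ^ 2 = u * σ i α + v := fun i => by
      have := congrArg (σ i) h
      simpa using this
    have a1 : (σ 1 α - σ 0 α) * (σ 1 α + σ 0 α - u) = 0 := by linear_combination hh 1 - hh 0
    have a2 : (σ 2 α - σ 0 α) * (σ 2 α + σ 0 α - u) = 0 := by linear_combination hh 2 - hh 0
    have b1 := (mul_eq_zero.1 a1).resolve_left (sub_ne_zero.2 n01)
    have b2 := (mul_eq_zero.1 a2).resolve_left (sub_ne_zero.2 n02)
    apply n12
    linarith
  have hroot : ∀ r : ℤ, (r : ℤ) ^ 4 - e1 * r ^ 3 + e2 * r ^ 2 - e3 * r + e4 ≠ 0 := by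
    intro r h
    have h' : (r : ℝ) ^ 4 - e1 * r ^ 3 + e2 * r ^ 2 - e3 * r + e4 = 0 := by exact_mod_cast h
    rw [h1, h2, h3, h4'] at h'
    have h'' : (σ 0 α - r) * (σ 1 α - r) * (σ 2 α - r) * (σ 3 α - r) = 0 := by
      rw [← h']; ring
    have : ∃ i, σ i α = r := by
      simp only [mul_eq_zero, sub_eq_zero] at h''
      rcases h'' with ((h | h) | h) | h
      exacts [⟨_, h⟩, ⟨_, h⟩, ⟨_, h⟩, ⟨_, h⟩]
    obtain ⟨i, hi⟩ := this
    exact hintg r ((σ i).injective (by rw [hi]; simp))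
  rcases enum e1 e2 e3 e4 hlist he4.1 he4.2 with h | h | h | h | h | h | h | h
  · have h' : (H3 e1 e2 e3 e4 : ℝ) ≤ 0 := by exact_mod_cast h
    rw [hH3] at h'
    have : 0 < ((σ 0 α - σ 1 α) * (σ 0 α - σ 2 α) * (σ 1 α - σ 2 α)) ^ 2 := by
      have := mul_ne_zero (mul_ne_zero (sub_ne_zero.2 n01.symm) (sub_ne_zero.2 n02.symm)) (sub_ne_zero.2 n12.symm)
      positivity
    have p1 := sq_nonneg ((σ 0 α - σ 1 α) * (σ 0 α - σ 3 α) * (σ 1 α - σ 3 α))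
    have p2 := sq_nonneg ((σ 0 α - σ 2 α) * (σ 0 α - σ 3 α) * (σ 2 α - σ 3 α))
    have p3 := sq_nonneg ((σ 1 α - σ 2 α) * (σ 1 α - σ 3 α) * (σ 2 α - σ 3 α))
    linarith
  · have h' : (H4 e1 e2 e3 e4 : ℝ) ≤ 0 := by exact_mod_cast h
    rw [hH4] at h'
    have : 0 < vdm (fun i => σ i α) ^ 2 := by positivity
    linarith
  · exact hroot 0 (by linear_combination h)
  · exact hroot 1 (by linear_combination h)
  · exact hroot (-1) (by linear_combination h)
  · obtain ⟨rfl, rfl, rfl, rfl⟩ := h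
    have : (α ^ 2 - α - 1) * (α ^ 2 + α - 1) = 0 := by
      push_cast at hchar
      linear_combination hchar
    rcases mul_eq_zero.1 this with h | h
    · exact hquad 1 1 (by push_cast; linear_combination h)
    · exact hquad (-1) 1 (by push_cast; linear_combination h)
  · obtain ⟨rfl, rfl, rfl, rfl⟩ := h
    have : (α ^ 2 - 2) * (α ^ 2 - α - 1) = 0 := by
      push_cast at hchar
      linear_combination hchar
    rcases mul_eq_zero.1 this with h | h
    · exact hquad 0 2 (by push_cast; linear_combination h)
    · exact hquad 1 1 (by push_cast; linear_combination h)
  · obtain ⟨hH, hcase⟩ := h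
    have hA675 : (675 / 100 : ℚ) ≤ A := by
      rw [hA]
      rcases hcase with ⟨rfl, rfl⟩ | ⟨rfl, rfl⟩ <;> norm_num [P2]
    have hD518 : (518 : ℚ) ≤ discr K := by
      have := pow_le_pow_left₀ (by norm_num) hA675 3
      norm_num at this
      linarith
    have hD518' : 518 ≤ discr K := by exact_mod_cast hD518
    obtain ⟨f, hf⟩ := discr_mul h4 (fun i : Fin 4 => α ^ (i : ℕ)) (fun i => hα.pow _)
    have e := discr_pow_sigma σ hσ α
    rw [← hH4, hH, hf] at e
    have e' : f ^ 2 * discr K = 725 := by exact_mod_cast e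
    have hf1 : f ^ 2 = 1 := by
      have : 0 < f ^ 2 := by by_contra hc; nlinarith
      have : f ^ 2 < 2 := by nlinarith
      omega
    rw [hf1] at e'
    omega

end St6

namespace St6
universe u
open Module
variable {K : Type u} [Field K] [NumberField K]

lemma quad_of_discr (h4 : finrank ℚ K = 4) (α : K) (hα : IsIntegral ℤ α)
    (hz : Algebra.discr ℚ (fun i : Fin 4 => α ^ (i : ℕ)) = 0) (hr : ∀ q : ℚ, α ≠ q) :
    ∃ u v : ℤ, α ^ 2 = u * α + v := by
  have hαQ : IsIntegral ℚ α := IsIntegral.of_finite ℚ α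
  have hdvd : (minpoly ℚ α).natDegree ∣ 4 := by
    rw [← h4]; exact minpoly.degree_dvd hαQ
  have hne1 : (minpoly ℚ α).natDegree ≠ 1 := by
    intro h
    obtain ⟨q, hq⟩ := minpoly.natDegree_eq_one_iff.1 h
    exact hr q (by rw [← hq]; simp)
  have hne4 : (minpoly ℚ α).natDegree ≠ 4 := by
    intro h
    have hl := linearIndependent_pow (K := ℚ) α
    rw [h] at hl
    have hb := Algebra.discr_not_zero_of_basis ℚ
      (basisOfLinearIndependentOfCardEqFinrank hl (by rw [h4]; simp))
    rw [coe_basisOfLinearIndependentOfCardEqFinrank] at hb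
    exact hb hz
  have h2 : (minpoly ℚ α).natDegree = 2 := by
    have := Nat.le_of_dvd (by norm_num) hdvd
    interval_cases (minpoly ℚ α).natDegree <;> simp_all
  have hm := minpoly.isIntegrallyClosed_eq_field_fractions' ℚ hα
  have hmon := minpoly.monic hα
  have h2' : (minpoly ℤ α).natDegree = 2 := by
    rw [hm, hmon.natDegree_map] at h2
    exact h2
  have ha := minpoly.aeval ℤ α
  rw [Polynomial.aeval_eq_sum_range, h2'] at ha
  have hlc : (minpoly ℤ α).coeff 2 = 1 := by
    rw [← h2']; exact hmon
  simp only [Finset.sum_range_succ, Finset.sum_range_zero, hlc, zsmul_eq_mul] at ha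
  refine ⟨-(minpoly ℤ α).coeff 1, -(minpoly ℤ α).coeff 0, ?_⟩
  push_cast
  push_cast at ha
  linear_combination ha

lemma pairs (σ : Fin 4 → (K →+* ℝ))
    (hσ : ∀ x, ((Algebra.trace ℚ K x : ℚ) : ℝ) = ∑ i, σ i x) (α : K) (u v : ℤ)
    (hq : α ^ 2 = u * α + v) (hr : ∀ q : ℚ, α ≠ q) :
    ∃ s0 s1 s2 s3 : K →+* ℝ, (∀ x, ((Algebra.trace ℚ K x : ℚ) : ℝ) = s0 x + s1 x + s2 x + s3 x) ∧
      s1 α = s0 α ∧ s2 α = u - s0 α ∧ s3 α = u - s0 α := by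
  have hσ' : ∀ x, ((Algebra.trace ℚ K x : ℚ) : ℝ) = σ 0 x + σ 1 x + σ 2 x + σ 3 x := fun x => by
    rw [hσ, Fin.sum_univ_four]
  have hh : ∀ i, (σ i α) ^ 2 = u * σ i α + v := fun i => by
    have := congrArg (σ i) hq
    simpa using this
  have hor : ∀ i, σ i α = σ 0 α ∨ σ i α = u - σ 0 α := fun i => by
    have a1 : (σ i α - σ 0 α) * (σ i α - (u - σ 0 α)) = 0 := by linear_combination hh i - hh 0
    rcases mul_eq_zero.1 a1 with h | h
    · left; linarith
    · right; linarith
  have hrat : ∀ q : ℚ, σ 0 α ≠ q := fun q h => hr q ((σ 0).injective (by rw [h]; simp))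
  have ht := hσ' α
  set t := Algebra.trace ℚ K α
  rcases hor 1 with h1 | h1 <;> rcases hor 2 with h2 | h2 <;> rcases hor 3 with h3 | h3 <;>
    rw [h1, h2, h3] at ht
  · exact absurd (by push_cast; linarith) (hrat (t / 4))
  · exact absurd (by push_cast; linarith) (hrat ((t - u) / 2))
  · exact absurd (by push_cast; linarith) (hrat ((t - u) / 2))
  · exact ⟨σ 0, σ 1, σ 2, σ 3, hσ', h1, h2, h3⟩
  · exact absurd (by push_cast; linarith) (hrat ((t - u) / 2))
  · exact ⟨σ 0, σ 2, σ 1, σ 3, fun x => by rw [hσ']; ring, h2, h1, h3⟩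
  · exact ⟨σ 0, σ 3, σ 1, σ 2, fun x => by rw [hσ']; ring, h3, h1, h2⟩
  · exact absurd (by push_cast; linarith) (hrat ((3 * u - t) / 2))

lemma golden (s0 s1 s2 s3 : K →+* ℝ) (α : K) (u v : ℤ) 
    (hσ : ∀ x, ((Algebra.trace ℚ K x : ℚ) : ℝ) = s0 x + s1 x + s2 x + s3 x)
    (h1 : s1 α = s0 α) (h2 : s2 α = u - s0 α) (h3 : s3 α = u - s0 α)
    (hq : α ^ 2 = u * α + v) (hr : ∀ q : ℚ, α ≠ q)
    (A : ℚ) (hA : A = Algebra.trace ℚ K (α * α) - (Algebra.trace ℚ K α) ^ 2 / 4)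
    (hA0 : 0 < A) (hA8 : A < 755 / 100)
    (ht : Algebra.trace ℚ K α = 0 ∨ Algebra.trace ℚ K α = 1 ∨ Algebra.trace ℚ K α = 2) :
    u = 1 ∧ v = 1 ∧ A = 5 := by
  have e1 : Algebra.trace ℚ K α = 2 * u := by
    have := hσ α
    rw [h1, h2, h3] at this
    have : ((Algebra.trace ℚ K α : ℚ) : ℝ) = ((2 * u : ℚ) : ℝ) := by rw [this]; push_cast; ring
    exact_mod_cast this
  have e2 : Algebra.trace ℚ K (α * α) = 2 * u ^ 2 + 4 * v := by
    have hs : s0 α ^ 2 = u * s0 α + v := by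
      have := congrArg s0 hq
      simpa using this
    have := hσ (α * α)
    simp only [map_mul] at this
    rw [h1, h2, h3] at this
    have : ((Algebra.trace ℚ K (α * α) : ℚ) : ℝ) = ((2 * u ^ 2 + 4 * v : ℚ) : ℝ) := by
      rw [this]; push_cast; linear_combination 4 * hs
    exact_mod_cast this
  have eA : A = u ^ 2 + 4 * v := by rw [hA, e1, e2]; ring
  rw [e1] at ht
  have hu : u = 0 ∨ u = 1 := by
    rcases ht with h | h | h
    · have : 2 * u = 0 := by exact_mod_cast h
      omega
    · have : 2 * u = 1 := by exact_mod_cast h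
      omega
    · have : 2 * u = 2 := by exact_mod_cast h
      omega
  have b1 : (0 : ℚ) < u ^ 2 + 4 * v := by linarith
  have b2 : (u ^ 2 + 4 * v : ℚ) < 8 := by linarith
  have b1' : 0 < u ^ 2 + 4 * v := by exact_mod_cast b1
  have b2' : u ^ 2 + 4 * v < 8 := by exact_mod_cast b2
  rcases hu with rfl | rfl
  · have : v = 1 := by omega
    subst this
    have : (α - 1) * (α + 1) = 0 := by push_cast at hq; linear_combination hq
    rcases mul_eq_zero.1 this with h | h
    · exact absurd (by push_cast; linear_combination h) (hr 1)
    · exact absurd (by push_cast; linear_combination h) (hr (-1))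
  · have : v = 0 ∨ v = 1 := by omega
    rcases this with rfl | rfl
    · have : α * (α - 1) = 0 := by push_cast at hq; linear_combination hq
      rcases mul_eq_zero.1 this with h | h
      · exact absurd (by push_cast; linear_combination h) (hr 0)
      · exact absurd (by push_cast; linear_combination h) (hr 1)
    · exact ⟨rfl, rfl, by rw [eA]; norm_num⟩

/-- enumeration for the relative quadratic case -/
lemma enum2_aux : ∀ p : Fin 12, ∀ q : Fin 11, ∀ a b : Fin 4,
    (((p : ℕ) : ℤ) - 2 - (a * a + b * b : ℤ)) % 4 = 0 →
    (((q : ℕ) : ℤ) - 5 - (2 * a * b + b * b : ℤ)) % 4 = 0 →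
    0 < (((p : ℕ) : ℤ) - 2) ^ 2 + (((p : ℕ) : ℤ) - 2) * (((q : ℕ) : ℤ) - 5) - (((q : ℕ) : ℤ) - 5) ^ 2 →
    (((p : ℕ) : ℤ) - 2) ^ 2 + (((p : ℕ) : ℤ) - 2) * (((q : ℕ) : ℤ) - 5) - (((q : ℕ) : ℤ) - 5) ^ 2 ≤ 28 →
    0 < 2 * (((p : ℕ) : ℤ) - 2) + (((q : ℕ) : ℤ) - 5) →
    2 * (((p : ℕ) : ℤ) - 2) + (((q : ℕ) : ℤ) - 5) ≤ 13 →
    ∃ c d : Fin 7, (((p : ℕ) : ℤ) - 2) = (((c : ℕ) : ℤ) - 3) ^ 2 + (((d : ℕ) : ℤ) - 3) ^ 2 ∧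
      (((q : ℕ) : ℤ) - 5) = 2 * (((c : ℕ) : ℤ) - 3) * (((d : ℕ) : ℤ) - 3) + (((d : ℕ) : ℤ) - 3) ^ 2 := by
  decide +kernel

lemma enum2 (p q s t a b : ℤ) (hp : p = s ^ 2 + t ^ 2 - 4 * a) (hq : q = 2 * s * t + t ^ 2 - 4 * b)
    (h1 : 0 < p ^ 2 + p * q - q ^ 2) (h2 : p ^ 2 + p * q - q ^ 2 ≤ 28) (h3 : 0 < 2 * p + q)
    (h4 : 2 * p + q ≤ 13) : ∃ c d : ℤ, p = c ^ 2 + d ^ 2 ∧ q = 2 * c * d + d ^ 2 := by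
  have hT : (2 * p + q) ^ 2 ≤ 169 := by nlinarith
  have hq5 : 5 * q ^ 2 < 169 := by nlinarith
  have hq1 : q ≤ 5 := by nlinarith
  have hq2 : -5 ≤ q := by nlinarith
  have hp1 : -2 ≤ p := by omega
  have hp2 : p ≤ 9 := by omega
  obtain ⟨s', x, hx0, hx4, rfl⟩ : ∃ s' x, 0 ≤ x ∧ x < 4 ∧ s = 4 * s' + x :=
    ⟨s / 4, s % 4, by omega, by omega, by omega⟩
  obtain ⟨t', y, hy0, hy4, rfl⟩ : ∃ s' x, 0 ≤ x ∧ x < 4 ∧ t = 4 * s' + x :=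
    ⟨t / 4, t % 4, by omega, by omega, by omega⟩
  have := enum2_aux ⟨(p + 2).toNat, by omega⟩ ⟨(q + 5).toNat, by omega⟩ ⟨x.toNat, by omega⟩
    ⟨y.toNat, by omega⟩
  simp only at this
  rw [Int.toNat_of_nonneg (by omega), Int.toNat_of_nonneg (by omega),
    Int.toNat_of_nonneg (by omega), Int.toNat_of_nonneg (by omega), add_sub_cancel_right,
    add_sub_cancel_right] at this
  obtain ⟨c, d, hc, hd⟩ := this
    (Int.emod_eq_zero_of_dvd ⟨4 * s' ^ 2 + 2 * s' * x + 4 * t' ^ 2 + 2 * t' * y - a, by rw [hp]; ring⟩)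
    (Int.emod_eq_zero_of_dvd ⟨8 * s' * t' + 2 * s' * y + 2 * t' * x + 4 * t' ^ 2 + 2 * t' * y - b,
      by rw [hq]; ring⟩) h1 h2 h3 h4
  exact ⟨_, _, hc, hd⟩

end St6

namespace St6
universe u
open Module
variable {K : Type u} [Field K] [NumberField K]

lemma int_of_emb (s : K →+* ℝ) (x : K) (h : IsIntegral ℤ (s x)) : IsIntegral ℤ x :=
  (isIntegral_algHom_iff s.toIntAlgHom s.injective).1 h

lemma orth_zero (s0 s1 s2 s3 : K →+* ℝ) (α z : K)
    (hσ : ∀ x, ((Algebra.trace ℚ K x : ℚ) : ℝ) = s0 x + s1 x + s2 x + s3 x)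
    (h1 : s1 α = s0 α) (h2 : s2 α = 1 - s0 α) (h3 : s3 α = 1 - s0 α)
    (hq : α ^ 2 = α + 1) (t0 : Algebra.trace ℚ K z = 0) (t1 : Algebra.trace ℚ K (z * α) = 0) :
    s1 z = - s0 z ∧ s3 z = - s2 z := by
  have hφ : s0 α ^ 2 = s0 α + 1 := by
    have := congrArg s0 hq
    simpa using this
  have a0 := hσ z
  have a1 := hσ (z * α)
  rw [t0] at a0
  rw [t1] at a1
  simp only [map_mul, h1, h2, h3, Rat.cast_zero] at a0 a1
  have hne : 2 * s0 α - 1 ≠ 0 := by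
    intro h
    have : (2 * s0 α - 1) ^ 2 = 5 := by linear_combination 4 * hφ
    rw [h] at this
    norm_num at this
  have : (2 * s0 α - 1) * (s0 z + s1 z) = 0 := by linear_combination (1 - s0 α) * a0 - a1
  have := (mul_eq_zero.1 this).resolve_left hne
  constructor <;> linarith

lemma proj (s0 s1 s2 s3 : K →+* ℝ) (α z : K)
    (hσ : ∀ x, ((Algebra.trace ℚ K x : ℚ) : ℝ) = s0 x + s1 x + s2 x + s3 x)
    (h1 : s1 α = s0 α) (h2 : s2 α = 1 - s0 α) (h3 : s3 α = 1 - s0 α)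
    (hq : α ^ 2 = α + 1) (z1 : s1 z = s0 z) :
    ∃ a b : ℚ, z = a • 1 + b • α := by
  have hφ : s0 α ^ 2 = s0 α + 1 := by
    have := congrArg s0 hq
    simpa using this
  set T := Algebra.trace ℚ K z with hT
  set U := Algebra.trace ℚ K (z * α) with hU
  have f : ∀ (s : K →+* ℝ) (a b : ℚ), s (z - (a • 1 + b • α)) = s z - (a + b * s α) := by
    intro s a b
    simp [Algebra.smul_def]
  have aT := hσ z
  have aU := hσ (z * α)
  rw [← hT] at aT
  rw [← hU] at aU
  simp only [map_mul, h1, h2, h3] at aU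
  let b : ℚ := (2 * U - T) / 10
  let a : ℚ := (T - 2 * b) / 4
  have hb : ((b : ℚ) : ℝ) = (2 * U - T) / 10 := by simp [b]
  have ha : ((a : ℚ) : ℝ) = (T - 2 * b) / 4 := by simp [a]
  have key := orth_zero s0 s1 s2 s3 α (z - (a • 1 + b • α)) hσ h1 h2 h3 hq (by
    have := hσ (z - (a • 1 + b • α))
    rw [f, f, f, f, h1, h2, h3] at this
    have : ((Algebra.trace ℚ K (z - (a • 1 + b • α)) : ℚ) : ℝ) = 0 := by
      rw [this, ha]
      linear_combination - aT
    exact_mod_cast this) (by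
    have := hσ ((z - (a • 1 + b • α)) * α)
    simp only [map_mul] at this
    rw [f, f, f, f, h1, h2, h3] at this
    have : ((Algebra.trace ℚ K ((z - (a • 1 + b • α)) * α) : ℚ) : ℝ) = 0 := by
      rw [this, ha, hb]
      linear_combination - aU - (4 * (2 * U - T) / 10 : ℝ) * hφ
    exact_mod_cast this)
  refine ⟨a, b, ?_⟩
  have k := key.1
  rw [f, f, z1, h1] at k
  rw [← sub_eq_zero]
  apply s0.injective
  rw [f, map_zero]
  linarith

lemma det_rel (f b0 b1 b2 b3 : ℝ) :
    (!![1, f, b0, f * b0; 1, f, b1, f * b1; 1, 1 - f, b2, (1 - f) * b2; 1, 1 - f, b3, (1 - f) * b3] :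
      Matrix (Fin 4) (Fin 4) ℝ).det ^ 2 = (2 * f - 1) ^ 4 * (b0 - b1) ^ 2 * (b2 - b3) ^ 2 := by
  have : (!![1, f, b0, f * b0; 1, f, b1, f * b1; 1, 1 - f, b2, (1 - f) * b2; 1, 1 - f, b3, (1 - f) * b3] :
      Matrix (Fin 4) (Fin 4) ℝ).det = -((2 * f - 1) ^ 2 * (b0 - b1) * (b2 - b3)) := by
    simp [Matrix.det_succ_row_zero, Fin.sum_univ_succ, Fin.succAbove]
    ring
  rw [this]; ring

set_option maxHeartbeats 1000000 in
lemma case2 (h4 : finrank ℚ K = 4) (s0 s1 s2 s3 : K →+* ℝ) (α β e3 : K) (c d B : ℚ)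
    (hσ : ∀ x, ((Algebra.trace ℚ K x : ℚ) : ℝ) = s0 x + s1 x + s2 x + s3 x)
    (h1 : s1 α = s0 α) (h2 : s2 α = 1 - s0 α) (h3 : s3 α = 1 - s0 α)
    (hq : α ^ 2 = α + 1) (hα : IsIntegral ℤ α) (hβ : IsIntegral ℤ β)
    (hβe : β = e3 + c • 1 + d • α) (t0 : Algebra.trace ℚ K e3 = 0)
    (t1 : Algebra.trace ℚ K (e3 * α) = 0) (hB : B = Algebra.trace ℚ K (e3 * e3))
    (hB0 : 0 < B) (hBD : 15 * B ^ 2 ≤ discr K) (hD : discr K < 725)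
    (hintg : ∀ c d : ℚ, IsIntegral ℤ (c • 1 + d • α) → (∃ n : ℤ, c = n) ∧ ∃ n : ℤ, d = n) :
    False := by
  have hφ : s0 α ^ 2 = s0 α + 1 := by
    have := congrArg s0 hq
    simpa using this
  obtain ⟨k1, k3⟩ := orth_zero s0 s1 s2 s3 α e3 hσ h1 h2 h3 hq t0 t1
  have fβ : ∀ s : K →+* ℝ, s β = s e3 + (c + d * s α) := by
    intro s
    rw [hβe]; simp [Algebra.smul_def, add_assoc]
  have b0 := fβ s0
  have b1 := fβ s1
  have b2 := fβ s2
  have b3 := fβ s3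
  rw [h1, k1] at b1
  rw [h2] at b2
  rw [h3, k3] at b3
  -- relative trace
  have hS : IsIntegral ℤ ((2 * c) • (1 : K) + (2 * d) • α) := by
    apply int_of_emb s0
    have : s0 ((2 * c) • (1 : K) + (2 * d) • α) = s0 β + s1 β := by
      rw [b0, b1]; simp [Algebra.smul_def, map_ofNat s0 2]; ring
    rw [this]
    exact (map_isIntegral_int s0 hβ).add (map_isIntegral_int s1 hβ)
  obtain ⟨⟨m, hm⟩, n, hn⟩ := hintg _ _ hS
  -- relative norm
  have hTi : IsIntegral ℤ (β * (β - 2 * e3)) := by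
    apply int_of_emb s0
    have : s0 (β * (β - 2 * e3)) = s0 β * s1 β := by
      rw [map_mul, map_sub, map_mul, b0, b1, map_ofNat]; ring
    rw [this]
    exact (map_isIntegral_int s0 hβ).mul (map_isIntegral_int s1 hβ)
  obtain ⟨a, b, hab⟩ := proj s0 s1 s2 s3 α (β * (β - 2 * e3)) hσ h1 h2 h3 hq (by
    rw [map_mul, map_mul, map_sub, map_sub, map_mul, map_mul, b0, b1, k1, map_ofNat, map_ofNat]; ring)
  obtain ⟨⟨a', rfl⟩, b', rfl⟩ := hintg a b (by rw [← hab]; exact hTi)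
  have hS2 : 2 * β - 2 * e3 = m + n * α := by
    have e1 : (2 * c) • (1 : K) + (2 * d) • α = 2 * β - 2 * e3 := by
      rw [hβe]; simp only [Algebra.smul_def]; simp; ring
    rw [← e1, hm, hn]; simp [Algebra.smul_def]
  have hab' : β * (β - 2 * e3) = a' + b' * α := by
    rw [hab]; simp [Algebra.smul_def]
  obtain ⟨p, hp⟩ : ∃ p : ℤ, p = m ^ 2 + n ^ 2 - 4 * a' := ⟨_, rfl⟩
  obtain ⟨q, hqq⟩ : ∃ q : ℤ, q = 2 * m * n + n ^ 2 - 4 * b' := ⟨_, rfl⟩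
  have hδ : (2 * e3) ^ 2 = p + q * α := by
    rw [hp, hqq]; push_cast
    linear_combination (2 * β - 2 * e3 + m + n * α) * hS2 - 4 * hab' + n ^ 2 * hq
  have d0 : 4 * (s0 e3) ^ 2 = p + q * s0 α := by
    have := congrArg s0 hδ
    simp only [map_pow, map_mul, map_add, map_ofNat, map_intCast] at this
    linarith
  have d2 : 4 * (s2 e3) ^ 2 = p + q * (1 - s0 α) := by
    have := congrArg s2 hδ
    simp only [map_pow, map_mul, map_add, map_ofNat, map_intCast, h2] at this
    linarith
  have hBr : (B : ℝ) = 2 * s0 e3 ^ 2 + 2 * s2 e3 ^ 2 := by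
    rw [hB, hσ]; simp only [map_mul, k1, k3]; ring
  have hB2 : 2 * B = 2 * p + q := by
    have : ((2 * B : ℚ) : ℝ) = ((2 * p + q : ℚ) : ℝ) := by
      push_cast; rw [hBr]; linear_combination d0 + d2
    exact_mod_cast this
  have hne : e3 ≠ 0 := by
    rintro rfl
    simp at hB
    linarith
  have hN : ((p ^ 2 + p * q - q ^ 2 : ℤ) : ℝ) = 16 * s0 e3 ^ 2 * s2 e3 ^ 2 := by
    push_cast
    linear_combination (-4 * s2 e3 ^ 2) * d0 - (p + q * s0 α) * d2 + q ^ 2 * hφ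
  have hNpos : 0 < p ^ 2 + p * q - q ^ 2 := by
    have n0 : s0 e3 ≠ 0 := by simpa using hne
    have n2 : s2 e3 ≠ 0 := by simpa using hne
    have : (0:ℝ) < ((p ^ 2 + p * q - q ^ 2 : ℤ) : ℝ) := by rw [hN]; positivity
    exact_mod_cast this
  -- discriminant
  obtain ⟨w, hw⟩ := discr_mul h4 ![1, α, β, α * β] (by
    intro i
    fin_cases i
    · exact isIntegral_one
    · exact hα
    · exact hβ
    · exact hα.mul hβ)
  have hdisc := discr_sigma ![s0, s1, s2, s3] (fun x => by rw [hσ, Fin.sum_univ_four]; rfl) ![1, α, β, α * β]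
  have hmat : (Matrix.of fun i j => (![s0, s1, s2, s3] : Fin 4 → (K →+* ℝ)) i ((![1, α, β, α * β] : Fin 4 → K) j)) =
      !![1, s0 α, s0 β, s0 α * s0 β; 1, s0 α, s1 β, s0 α * s1 β; 1, 1 - s0 α, s2 β, (1 - s0 α) * s2 β;
        1, 1 - s0 α, s3 β, (1 - s0 α) * s3 β] := by
    ext i j
    fin_cases i <;> fin_cases j <;> simp [h1, h2, h3]
  rw [hmat, det_rel, hw] at hdisc
  have hwD : w ^ 2 * discr K = 25 * (p ^ 2 + p * q - q ^ 2) := by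
    have h5 : (2 * s0 α - 1) ^ 2 = 5 := by linear_combination 4 * hφ
    have : ((w ^ 2 * discr K : ℤ) : ℝ) = ((25 * (p ^ 2 + p * q - q ^ 2) : ℤ) : ℝ) := by
      rw [Int.cast_mul 25, hN]
      have e : (((w : ℚ) ^ 2 * (discr K : ℚ) : ℚ) : ℝ) = ((w ^ 2 * discr K : ℤ) : ℝ) := by
        push_cast; ring
      rw [← e, hdisc]
      have e1 : s0 β - s1 β = 2 * s0 e3 := by rw [b0, b1]; ring
      have e2 : s2 β - s3 β = 2 * s2 e3 := by rw [b2, b3]; ring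
      have e3 : (2 * s0 α - 1) ^ 4 = 25 := by
        rw [show (2 * s0 α - 1) ^ 4 = ((2 * s0 α - 1) ^ 2) ^ 2 by ring, h5]; norm_num
      rw [e1, e2, e3]; push_cast; ring
    exact_mod_cast this
  have hBD' : 15 * (2 * p + q) ^ 2 ≤ 4 * discr K := by
    have : (15 * (2 * p + q) ^ 2 : ℚ) ≤ 4 * discr K := by rw [← hB2]; linarith
    exact_mod_cast this
  have hT0 : 0 < 2 * p + q := by
    have : (0 : ℚ) < 2 * p + q := by linarith
    exact_mod_cast this
  have hNT : 4 * (p ^ 2 + p * q - q ^ 2) ≤ (2 * p + q) ^ 2 := by nlinarith [sq_nonneg q]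
  have hDpos : 0 < discr K := by nlinarith
  have hw1 : w ^ 2 = 1 := by
    have : 0 < w ^ 2 := by
      by_contra hc
      have : w ^ 2 = 0 := le_antisymm (not_lt.1 hc) (sq_nonneg w)
      rw [this] at hwD
      omega
    have : w ^ 2 < 2 := by
      by_contra hc
      push Not at hc
      nlinarith
    omega
  rw [hw1, one_mul] at hwD
  have hT13 : 2 * p + q ≤ 13 := by nlinarith
  obtain ⟨x, y, hx, hy⟩ := enum2 p q m n a' b' hp hqq hNpos (by omega) hT0 hT13
  have hsq : (2 * e3 - (x + y * α)) * (2 * e3 + (x + y * α)) = 0 := by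
    rw [hx, hy] at hδ
    push_cast at hδ
    linear_combination hδ - y ^ 2 * hq
  have hfin : s1 e3 = s0 e3 := by
    have hh : ∀ ε : ℝ, 2 * s0 e3 = ε * (x + y * s0 α) → 2 * s1 e3 = ε * (x + y * s1 α) → s1 e3 = s0 e3 := by
      intro ε q0 q1
      rw [h1] at q1
      linarith
    rcases mul_eq_zero.1 hsq with h | h
    · have g0 := congrArg s0 h
      have g1 := congrArg s1 h
      simp only [map_sub, map_add, map_mul, map_ofNat, map_intCast, map_zero] at g0 g1
      exact hh 1 (by linarith) (by linarith)
    · have g0 := congrArg s0 h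
      have g1 := congrArg s1 h
      simp only [map_sub, map_add, map_mul, map_ofNat, map_intCast, map_zero] at g0 g1
      exact hh (-1) (by linarith) (by linarith)
  have : s0 e3 = 0 := by linarith
  exact hne (by simpa using this)

theorem eq_four (K : Type u) [Field K] [NumberField K] [IsTotallyReal K] (h4 : finrank ℚ K = 4) :
    725 ≤ discr K := by
  by_contra hD
  push Not at hD
  obtain ⟨σ, hσ⟩ := exists_emb (K := K) h4
  obtain ⟨α, β, e3, c, d, A, B, hα, hβ, hβe, t0, t1, hA, hB, hA0, hB0, hAD, hBD, ht, hintg⟩ :=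
    nf_hkz (K := K) h4
  by_cases hv : vdm (fun i => σ i α) = 0
  · have hz : Algebra.discr ℚ (fun i : Fin 4 => α ^ (i : ℕ)) = 0 := by
      have := discr_pow_sigma σ hσ α
      rw [hv] at this
      simpa using this
    have hr : ∀ q : ℚ, α ≠ q := by
      rintro q rfl
      have tr : ∀ r : ℚ, Algebra.trace ℚ K (r : K) = 4 * r := fun r => by
        have := Algebra.trace_algebraMap (R := ℚ) (S := K) r
        rw [h4] at this
        simpa using this
      have h1 := tr q
      have h2 := tr (q * q)
      push_cast at h2
      rw [h1, h2] at hA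
      have : A = 0 := by rw [hA]; ring
      linarith
    obtain ⟨u, v, hq⟩ := quad_of_discr h4 α hα hz hr
    obtain ⟨s0, s1, s2, s3, hs, h1, h2, h3⟩ := pairs σ hσ α u v hq hr
    have hDq : (discr K : ℚ) ≤ 724 := by exact_mod_cast (by omega : discr K ≤ 724)
    have hA75 : A < 755 / 100 := by
      by_contra hcon
      push Not at hcon
      have := pow_le_pow_left₀ (by norm_num) hcon 3
      norm_num at this
      linarith
    obtain ⟨rfl, rfl, hA5⟩ := golden s0 s1 s2 s3 α u v hs h1 h2 h3 hq hr A hA hA0 hA75 ht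
    rw [hA5] at hBD
    exact case2 h4 s0 s1 s2 s3 α β e3 c d B hs h1 (by simpa using h2) (by simpa using h3)
      (by simpa using hq) hα hβ hβe t0 t1 hB hB0 (by linarith) hD hintg
  · exact case1 h4 σ hσ α hα A hA hA0 hAD ht hv hD

end St6

/-- Let `k` be a totally real number field of degree `d ≥ 4` over `ℚ`.
Then the absolute value `D_k` of the discriminant of `k` satisfies `D_k^{1/d} ≥ 725^{1/4}`,
equivalently `D_k⁴ ≥ 725^d`. -/
theorem stmt_6 (k : Type*) [Field k] [NumberField k]
    (hreal : ∀ v : InfinitePlace k, v.IsReal)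
    (d : ℕ) (hd : Module.finrank ℚ k = d) (hd4 : 4 ≤ d) :
    (725 : ℤ) ^ d ≤ |NumberField.discr k| ^ 4 := by
  have : IsTotallyReal k := ⟨hreal⟩
  rcases hd4.lt_or_eq with h | h
  · have := St6.ge_five k (by omega)
    rwa [hd] at this
  · subst h
    exact pow_le_pow_left₀ (by norm_num) ((St6.eq_four k hd).trans (le_abs_self _)) 4
end
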